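/- arXiv:1903.04214 — 3 statements merged into one kernel-verified Lean document; each statement's English description precedes it below -/
import Mathlib

section
/- Let Σ = {0,1,2,3} be a four-letter alphabet. For every sequence v_1, v_2, v_3, … of letters of Σ and every strictly increasing sequence of positive integers p_1 < p_2 < p_3 < … such that p_{i+1} − p_i ≥ 3 for all i ≥ 1, there exists an infinite square-free word u = u_1 u_2 u_3 … over Σ such that u_{p_i} = v_i for all i ≥ 1. (In other words, d({0,1,2,3}) ≤ 3.) -/
/-- An infinite word `u` (positions indexed from 1) is square-free: it has no factor
`u_i … u_{i+n-1} u_{i+n} … u_{i+2n-1}` with the two halves equal. -/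
def SqFreeSeq {α : Type*} (u : ℕ → α) : Prop :=
  ∀ i n : ℕ, 1 ≤ i → 1 ≤ n → ∃ k, k < n ∧ u (i + k) ≠ u (i + n + k)

def trieData : List ℕ := [
  3235426623039014836499362502918607277304855260445220782199159676791130903534184131601079833988722376213850065509579211672829341120298702773051796655222385411,
  2966950488453537829888321365880364642999106979201238690298004842467243049870500955430837311165899126719418640839113327680105908085686991667027722342307571239,
  3100626758261443240875408249344591508871534490605550853423684060531107742045923208699621857859782676863670915996466927006990394189180826657365745021041820502,
  1899824779031684479758662962231437728609155962405050135041347264221483942592674861714919698565638111177446968412133453140548423579346552529382539095320387565,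
  1778051377910027434517277399894761849357136685884142859910562196398881587868180089736472207764308271958051022219092940381591906869602241293284680131601926709,
  1631208848087512649353932044369082485698823851176072290956237838746491800301798755328949524174806645595928023809700593648465739815638820254866809558781806477,
  1910716706566554136260993294062869713287023904368468625125967969318528832032694082494050384490100808255849496987292787242488105187730954447668533338929097042,
  1779369067193690210114144403200287942220102526600160049970223028119333692863386995934833857138986110973168066618539272441696478073264421407178510922721534861,
  2956111050652976649241060938771122879404220822165292084085404788631994012662888126270744487390485139236412634884389161200881871963789048462005595525873654903,
  1766193918890509778285805286399780867951398801091383942431489694193490799272601086481993323634296538993017886351887289211110215291575345244324942682403736367,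
  2354384794671904089086341876419843932228890318589816473206198062263751819301887059007616386923418847617271578255404285904162448336161653202190675760549300429,
  1778042335531901545359966768517506875099548015706964621584941694869941227545809327645802585044274342403623765004695137561495704696319123352791644175260264145,
  1777057709383585607958270027076356758865090286090006530769193521814100121055477140568918115971906234549899006483784177878897445309393428323082883642931673639,
  2190390417924790562779156084964943312812323089868619869186682859567488329568354023663633255107625840596077021167064757926854033425744448527965878884908119791,
  1767114382355138710793259144935630720441842089257858434429969356554017781629931426152795705738350551165044327948093975574185554109089204758090981627577155005,
  1882358029860431488150612351642263392082994447999095991588980084185312320046339186094802269928852990188260243467154657338803950200484748760998788970494203143,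
  3222085286629734868558718034346705767675236945941492288733267723904935134837405191831104352089685076566669923385294068562926354992358858457804054701091739925,
  1618944291440851791102931106053887291508383153557466092545563855962847718090444605108893052604951333187213662740445112224183208720361922065662198325107866603,
  1632788712419900886071812840697310018782825243941768714215716677386551519034383547483278340457532707581521019024077920056168353077869203387957899555370850015,
  1618934310494982018845777139246911482533241693483195602498072363255368637463408372227594406412059153291544059938150545718443318409691012709373532135679993493,
  1775401124093570879090365116146398202476876508759012440759016830565574901814504353053316322390070575854809703258774640350692943044977460537120634822668476815,
  1777057709332121459239247914139529272028765061089911986935677063692107362368217979279838379865879893699917493717027060796262922148102733315967453616613233418,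
  2952361953920204927065121934906096965569336989590466597579698361489894422380015312768585472531122349455400626897577040873841225366749136265768851702515996155,
  1632412489098835284782308355589967828551636972311177148672149264810003847194797184520881960384487011885489116117070625589453924301518521565387864260954199247,
  2193825702805771612839308739400578565064344246434389002274614634672857541448837769933966784586126915856416327851181274030535011191151834498069992083783140434,
  3100735520681316355038725417527772730172999106828425241289313939895604868366390266981583568747564961555885661909585983262258527481047150704789414446212830441,
  1764902807979401767267543633328593502488513873608991662144182729478266723380873442957541292408961620176164287494074715508777254125985436644254517985639013528,
  2082219191602293406184881810399112710508400989393752415617105506710641360857171939912042879523252189774460606559999085488602106026156452567537241944817994358,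
  3114114373043933801551868722313527073020223526241746341761359721502901101619725264853183279258375239639278220955393030711610724037212659541923336056296553348,
  3088481909724020487803725439978536648489320107329797717942584951322248956162482700543999195628626944230836170429102479850966721959431344567602578956795723942,
  1752197612560924629326502293112689786750534460128510354388605144238506000450814854954742047202044073161683444172350968262456354225280416925006619327621751749,
  3102946342500942392927219141061282133223276269953343787654637602527945768011075378003730447661992015512958630409537846063161377682556570474723564708744242240,
  3062719921442761983985672923458322466570931381106382496332226245567332106581536736669910197158891125588748702840225599976907912084673657924369719814472620871,
  1778053051983047043964484717837476004349863998864557807171233442864227028589396130403302522955917972213245422793265932809147250832766545492246969307856429518,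
  1867663294318534735105205977493300232440089708464541885412770727102481174438487270158366082506193564755116719280633316823175770310907235139555379290711519087,
  1774701831933754209265368897147941209571040474783635085208876060339118125046386175856304389644642653430779107485025149211018613347480350569612767386447665502,
  3101750372287889291247106409517803852452449719666827221413837738137885712600418542014371234176593637914310705043188679699235113334109785835185606378051115168,
  2656462647554414481219237940350480328488513368044966491015191573140517575477607247112642041940981681308635057790826442477416877069874517784022604351025037992,
  3223282507390619736852419551073125589802324044646002510409640790901921482241221335017268220867427581490987334128906323115708351651993613011116157238102047626,
  2810039544451354898173511491891795894632323540394596328569759942137929635062672776542606431953848332626040000847287723679252610280569329588574262282759792482,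
  1766118971143656827292995387328866634515493819635817583791462996556085597517312658926730778540184042394672181914554428342657709145077584641002529312941104795,
  2819764609961848086545879553890076950338551225999920441203975102706159792173225076612933799017437925620064665577570691031658273061375631943087584278933869951,
  1899591106980481252152877425608559598953234040061483085668416415745570390379178803457111809922541681649911750905383716395553524294766901962019065355198500953,
  1910633925393410753975200024898531899152533856996273107259972110530456479178202878804685282104720543761374754044579685430707728857084282868926834251211902120,
  1774507338297236637345975284518209064080675299432140493386514283452059720178577511408397515211534740750657146923945314857325661617555672521188256075909830804,
  1734515508005366483597851248770863261127830015666308285883694674366565271365738075252514394939391332423562219821260208263564122704722724581184821093307499560,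
  1641694754505505963930046730962690499376703465732107569376907194342093443024161457893019296992244939937197036647111141200518118992640443149513162034543539230,
  1752738602321088461274943387886523184178946425734696123058654429524969431217930553310922917822595513783016350783723062070341452848261745604856154750770755821,
  1886135453931934543242468625396121650230948521015999331027770077533961119581047855543422283711028014408786199385859390025883936992909838333480529403498672093,
  1779358947589541301676775135710124636010375134240476892311070090071396161416022821719166843667051683813885829319828204332608846309825171214460785974217248829,
  2807620350177305103819267406554200739451873491462474700873665002856430031094217002841468631980780665201601738103642632516046453879844177215992057798153350674,
  1910643741643046426090233083597051283217395933070437556317529499669952537325815532157088460027355805475396041628321016687956133497686878617003152322931406422,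
  1632203278770579090350795247910287916463517138073670818751731799127082084859774709896905251374140772084133447004355075249127139798333178552840408031909353885,
  1631436965017380962202809990867669175443048640677229513180905973651963026002036728176622438317758696255622665384002106197044441893041051584641823685551031548,
  3223283246288840077044861702750113513771172143542212072613619900106507939221759245012742357158680608423488102746299902395304527792645172477913402898862220259,
  2367850025647514015695873206750030353601575846142788628234469554947511216733909513805108957428682592794069044206507509977181782559462143529928213783512774337,
  1763678329688361482956956507967866723175741557811452051158729284971073880490542755789268795715924184273129226063721411597500669231959597364890443417142728875,
  3235345268140008978192364214862078663317627325048410102733716486320824725444935742994477466503942311417656771018983977700045155093808519677639310388846927399,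
  3100596406396747903358528921383534303184900646805701031837361910306105356252276683555384148033499956250980202597105746328288067797773492237976292519043189450,
  1618944291435318424229514537385882528431866568050003352822550682870753632416835914664319410337878892586447428765224170348746023942469006690661404211733021531,
  3088279935497631636455684699357733769856240218657723908800074522006885882588517381405070671512553564492154802057056920500860518792054796121388787399060623348,
  1779368999260357276703750506540680116856881311690648654884454090719993968625000488840221991663434219358989813134387613394439200761129663720092898132392424927,
  3234441234571490852168739283766973163433257496757817053088197950376690664756990482204308400879639600246158114287096130933014609150631519035242362947312391209,
  1620038262791661838054597317824881008732875107663019243369100532280511774818556505766512349712747973481655082223261502338100648366755383632386989748972451935,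
  1734441633185806224152883138197493473615582848481119098932088759152874691235801157581291941293283515181017218657529811889528176494107491457738613243435199339,
  1774627678187090752170565394680902801385347530115563994935252993470346925165245706348152276645866277693835909970069711739410258497602863533759722492802943095,
  1881653825925941564198139057664226098131849991675123899558772629251802526738599009910571938713987233552092941977122201282194497280261533243369214492134055884,
  2102856485334370088100549582682148535341963737447705840472443236801326934460880083545835946019958425805333706369229533269474012909937128718730817442880580069,
  1659073098051840771483455032349906892344700021071213277919464948763996488947664325436974931027019090616228931773739681056616134955780077952586915510458525942,
  1661594969256153466784436879072754243050087709515946525114868668888010386131947313817995897154545626348434991652461159370109839228991941356555903608427805070,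
  1632390566413800122926586023642022741307716728675425668841531619785056306842928364212254013977163829509713171737670049994068991338760640327610958061574113162,
  1882434660344942815564178783141000981874021762093983401131677645416079628208001057609908921224031066391356129554584304760286327452817754394815810035540527473,
  1618944667887897953727723600613828558886604339841004224759087673901209776102733837827057354010331588852759876593890146520558899606282467635748877072789421338,
  1763687371028756604696844164226772989206209742336145975391102750449608341693484797130819868017984384460996666083478274850246239752631443834784485627331790784,
  3234432109905296546114468057407722121352692069559921953133403462745591730779369194387118355885280694908606376241958770652526571913690823646021739939445253880,
  1779240333527942806627333670443897570700334326803314874466747233989678183443682558877572652542636313485879674053553603752497220309597971334215655933350622608,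
  1752529488032085281546500991173343188152489145945449879648350952925673737373293521797293251299457888392899449069029636975221082911545233209482565552759274921,
  2956896442018669395524228859115615118569907210330315999439602930065021496258490339361994940860670093225253708277508867249600605358284213470045743928305462961,
  1619034687936991346368845001888671905037992643801423131570555029161938020613404093940813643856669637353916270919082827925622377339857117901735076617787787948,
  3224396493434462818847223148748474014742317810249805609915247743508722198803842452660737192135969903743584010539086229694957420935311564752437412943191177610,
  1763569367897051682410813134822991402751479961987372165800889412392048436166203727582858610770920440456453873422739539301691498797085472302622426988560582719,
  2955988762158550787907318743231269001173764599925900432055616833459666487133862882513634356143383753191685639424092372119970395000656841418469901241928195214,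
  3103064977853973456017421643254614823475381231486419970039400693624109191885338333554959711837352726911804702514152614897941739110694307580743634052405187304,
  1752529481557015540786876495203690213232948839091970884391395794954737997396961429252974015993678787062606618959738778795370924205637900085517592375016494578,
  1752421812112947845763361953882331682509870122526352369029186251223703724629607141838907049872988258075863600312079057176240387716654422552364049842747828807,
  3102854128479699634348868529897332402406269468950069825602514374121756635321254175066932566612110991187586907694722941387210203259818607115936157252264726959,
  3104170745375005759010045638127204390507685327907405163230730365941622689184612394692193993601150126490202997987987026493687578453488496082373668342208083815,
  2368753306466015419516829345747296754746000109367244706143288497496665089379867653368996625508510464768427332045534902414305497350982555734910832565531793459,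
  1632203209544915805219422823213344724926278913633731141034465531066655519561567263843811702039706975101897802169810344919728192714663217444378669004525101687,
  2368835393511365694010868744720821438562864596208693597349002580829324948029939483065854301003184610789854057142649416927423835785315550300504395664653619070,
  1910763517271226014644954518843536631038033391509041923427469518396869181598276553365663675885677208689120065957328804537209999562187241098025793121850775369,
  1764992220343454629377484321488455614355327548763665279936188775189768808146877978638935951646282400615189237542796162648655182382900692462211312804070124597,
  1911848275910273125002197041031110675182997396256298027014296005633208308496047511236132023924726819670537524760044968926669490688107875412500093882771709900,
  3074005599017331881822103072783486935558944340808583080067097099791453372363182145039632766948537225669826683607488392311965442553540272634080368188019673176,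
  1777038690954559438558849490588379837081316849785743537573126406749459902097142519750927621391205325750935467781406722562347572639534548336100426455905271123,
  3234350837447054892090801567451235320863787442939859255090563793083408877441412062145389561600889800348905106867296776432315831285735517352647655596938684327,
  3064062032580250740452408361660736861260447785684849848281303742262533169543322727202347281774012991732227726534439653155551011700108465308403583757775413097,
  1619034687936945473076323701683738807987634160914578357947530707878627410186913931875778645385750566251673745535995127803869795095595198151365818733796003723,
  1631654626166194607523750909283188900720641868768316754246771964483220424440650404573188923838084958442532960754257125620263345511031490331819100860223969023,
  1774587770681561531883806914860385455792743672348188557474866828731248398201444558407796002467839528950709238133050898707027202785919064940475395228219765962,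
  1788848312226479508226157497835898291480966204881677583458872802755422886223679503626089209921819472785495316259790976745815428800666045946604439547706807015,
  3234431204230065392210243399270633294173748798101092062014183288243313556978716791318586979203851512635813499751399606521292147683994679001621875256079574819,
  3223178477239453128038361326321793385819666106090885031583044651006085005074908696693387100945972412765961620637697602786367439004824271709687204790138263363,
  1619034619396835942743746813177506312933805198705733064357829841072486706831681395519443364153108440801317561881673253781793397783363800074079876542771071529,
  2844973308013407594548099272769521487512069856998205528726422242533636515524963555046687428537415873083367211100184525184269238633414176620786167768810683376,
  1752729402623280923182704642802504465136871347459060803401011908030360904117400387522542674567804952934686422158825638210941531706546023589791598867361590663,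
  2351951004869626206181799475881128769117991913644885443834713420136746395550936072156398063844658496514857772166989731654587899485460078940659611309023746903,
  1666522486128837318006072881341806542870258859108567030358107547040680542813410260106173421615371232307254804567627967624209877400658924102725401091289384585,
  1619034687318356191848650673579723445557753121968201971914973328653935140211348447698717731284665285467447924268086826239886649031596386895060689912345206461,
  3088574205512090211193300200534745238138642966001814172873438519642608483673068140420282930292995705193270216628880816228619257502309381953544840782347241511,
  1776939065892646201619837848374989824412429448073806968790790370952935743533463018917377877023147765940995529038118005379236262216557544154973846284797307835,
  1776939065889123854368464217785456369176435332119957220033858649136007522168996067828423753196066202902853119901022284093994546524203018562510264162244678941,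
  3088572034055364841686534897035791914244039587015063318720774026923513083007661900002646844823308281046397581686919137251506629691398496232513548016341747915,
  1899906964003559070673054542047835317289859721317714248254788438142259731666048854487552562530343969442458069743812087194229389149242370059700015231914895956,
  3088582259909086975085075504576849245946709109755238358480104251170276404403839298554104699069746219419030378112176905805904462857300582343994684388915072859,
  3223494284184129215857733385407637204342187361742224645786439760443763336263784265879761083714866576836278379897211037578287208741067996238274577759229695743,
  3100536122768240149483954128067936381757204738206735774616994964355421353146141126069344054193975039707131444724914617661666655315775072178911036241305277540,
  3222076238601724076209028666843957986088222575710164853419821100870554865927753297604589813158940355276449944950528747155206808150128746031258928316911539428,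
  1900900641447443182763939220407281719143517732352278136241874766848111545656265680894184112087334023757778021263857382598001636953407297194530184614730331388,
  1751429962684810322694827914045470837638411521084396814610152639068629549359535427063528070961283399386535459871870454809945258703565713076964425898928781200,
  2965833535173249110743344949407514176627412123038667283473650023828173553474270374178996160071733579512307738700844880075027771960927893040336350021671486033,
  1631208688920246719765592397971481777455976619022802065848907454213875921981666473128546368617924217465112869023039559801693319030723538196203002995716681444,
  1897042471773829673165374013972728287658338966011388350949421299081944962559994100368921719193485078664356946100444025033115939184211774305831521860510978187,
  1787956436748525092895593506995207414662190675774323971157028572424523687630562326144420042853761358292504847998067179898101935128888047547178845427704072756,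
  1783028366123196060382386338267733067732215464627306784788551438516523684587153477851474581796305659212521292716488390976113351169694707469693026113674569936,
  2102791946235462612933300450482818954688601781501996970856858117277107588518861138062704262751435098713543175828117022557065154741729533643324658777130927117,
  1781940722190117642470592659578424493306032410529688363220363998291892870801493676076410008278905392030199374700959853691028958767104766938836374535068780471,
  1672784192641296970780698162837655432037037457860845955785174007219550607498875449561848226445317813317332029040000791810533908263018958871669553154284661624,
  1881463941749729095791254152118578007366127111427912380675579902666876979977653201669446303737549446815570146771275130233877048099701137840455326737990150139,
  1778163378892704330272426343756348969920841917305482298403119738280106447018624116600774436142674322403817180403950885691581551262443762817674478794658221760,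
  1632091888965065205704752324900131593802099821562221676869663188695370085460839378139430533852318175040883707806744455274172205789897664275318872927654541144,
  3072699516849793819518485452571242197194838421337034389866245993060428789896287628575948522250568077441116369030976537639992049632468490598719658008096485976,
  1896146640931847408480802297996550101319473626247828487971439033057603218911999321179428411132325674830649608181146429434247740398681209397899456475141049373,
  2741605391626352141609193419062228049490107901278964473691458305510809325962341338875874853397969158371118348060986947787783599105037722953541329251527893100,
  2956894623813830387734355327779942530933817102265224810774457694100442394415126527860702656327396797571589828291729500915015870607371235895728691464712387483,
  1882547808682994731348154772246684010499201519208331543792488812001018200444798616541408272672240291325249214072911965759586834402731008992772065854848078066,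
  1633305507959631900552769568509570503782845084818680676967603524873259649744698441268575725683575380722283192567939416535165762473196727011414289936104400313,
  1766109158394162391269150098439713468888508073984380833350831072188509668057200643961178732500328712628217740488803669427295259193295625172401628292509102442,
  1631981401399387791058829019280643841996948048193029787802026515985177616866198223522658463774523574000101757317261763617121655696568844935398197326845737812,
  1631207956014187165178210918277673614267154039845647253378929144120695872924520990805586121409832216748696735181813197269646098924579508570612606512901921204,
  1764944875052015593686940370014621085219573272439333469165473384829561636319960164968900776613599162410744637784780219020753769383955260718543393300712688190,
  2965823392916857671824591215348118328519988794591015279696071841303789039920145598333507695572338472100243065048451947493428918747404479476336965964644543012,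
  2941423949784695713859079617092885709876499807103297625868997207690589082066652304132233407080489723495233684321001038597235168209291531418072793078648503133,
  1711318525782575110203064199763966145077758122435506977217113973735680196744366988199172878750799656397055759212041995896008583857729924734903042923153395227,
  2742098488861413133880851523987874932660551982643287361098811567398571486478329379288409305188254114920184771254525277152774771610690088131508124061412419017,
  2228043678049002882505829570346503260972169098311745312279209870110613543122241527582658914535370100990118306734952333866416195063142117524571875827434615817,
  2740778112365532907218424789739934081788179141851996847439259619158797373895136699186878535031235086794335220702928601056354661303584902471993741878595051427,
  2669842136741839355592691851213555424372038497696942267217288426765517856481714797081910585923586581865171650943476904124081942052299887630180937763902894101,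
  2224665880104488230337915650598808902831751945279333075913205392656300255175613229765984207637166237718740258342834758741333138279663872012483708326321091014,
  2264771731782843164916506906700443239858377815459058262632739973069751346537774119682898169620014260260554015807460938344347401731370259787004640056400931098,
  2224665879917391317736534376438946630489286461557937195359143182129421470293156793845179112326991174766348045615133304697673041972758420662723112437464420056,
  1661503927726542649687850144787935428105514214690775312630434312242465348039077570087655915897950808779253855453495579242080263007594000913381646971939598730,
  1618944210167792590724637346124695437495888676777864821918743788126103464915545085711069746710787514823321217770777189359527775346708142230031914817849853515,
  2371879368669360670354573361683489443071829528041853324080766156279498643433116664033751022178365162074145507699279043875554575561108448533479769641721011197,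
  2462180395775144280631170141740557812570568449309559757730903186652069371574333929036003565622102033998258777726890452836969503935297272904174297527380929862,
  1871931468835167882837945608198637069375647388095620079717007363887229550505007008332785610810482006517123040035726605195251763398639296753191702345898008035,
  1712521728754608589160017793148511818089771330539630351496495933973779217462386869804473896823213112735384059095326337998420057673218128873238956097113324003,
  1764901887442793055224738000539283783999606024435102343231099483001575109540033184462132487707030913058164959706498324536002143320979753829963030312713889894,
  2916875306798413009248694461818963104023620662090711403555013951277922128239670835252264271662089387187106210500220250636328859184844979005909124756799435545,
  1632091888409028185697190835571981130573792183140890343853875566886915795247323759486148096073255982823147231840913507745430595626260605280231952681652671528,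
  1619045411279822668997404286559259350474503508844428378941319899374387471705451930290450905949523635364749130705031867055697729607024468803751883138327585739,
  3072570995923940120169190606821537190748890901643842398134003060532689051260255170821957428648852726875250256072416960505896097361926789458657943305933354604,
  1897061407132154922014137108044359321616448317540108112632243402632174774417192680866093645487227814010039735085616282926798347870861165923129661668071007278,
  1632091893893333928985489065385589203983669237838465193857840851618200610311050972560424643543458011611876730091523697300722842661113731692769266012992568061,
  1886325610711272684806502791914155588922408339413915200006370623670046665707799538809499375882667390085682587115839311662049975269357904940263004696504652660,
  1775832414690550572987477227589535258554463732285112815748234162502501949035498278859832927063905011975328607882939981840767481643170297180655350421737988431,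
  1764901887442758640544375308307184194521499555646268085956657051199808992815789025778251088119157907704756418059602274675534669763188201849289469232726752224,
  1673256930054360637554380248989752497313193385655593205877743993899235904868999651905161368155681595576350376526107212333706402237757953365262780813136161583,
  1783473324035003199907718039368355209665475408276065439905965019305320090446824975147778687276651033014871426935246787936389411987014206086608545367612215315,
  2902610750300624832019025774769044891311101682047561947479503960071271635750868899698466433751647911902191773307697500660737271144730865903117562836824677576,
  1823605186405981411494324843385433783843094155544756574932868686595594826420833181759981982935064030284537165783656823575456089602343533902242186276076687383,
  1618974344082768155629269193628590518849385809225461151798793689332387340658505989482852565544529731945916560887378380856189508689753624672038406120898156550,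
  1778497039816301838304255976632536049551653900642529070384987184280831876736399903100905042626652354819112672411535301870313917743930443131388449712268099772,
  1783166273440491635506526256785284106140920164317919678286966558391513050940148525827446757608300665163543693194423007053796774032656497956098537890661333538,
  2206093094989063692448257553824699932603806999189378237981987305076220748386137493459158568525082883133827396022161955570080684296957362403189650423122254084,
  1764897321596072301747509203749495334327381957931380002272156059817914713595854071706450538065605988149776936000524172805157880853475675296682050045846741184,
  1806231770374620275106315351662247723164108606552954579807202415860953424741567761297370652086432187728507179511124433509786534356189523168402030358117977713,
  1778162715704176613303435568521120046611176939435654061019798741767874997480246226965247533348612349358880267098280172409330511309120167660928940805532928815,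
  1769645676381733623932101679740151873144193215376158492760439687722606877609294606920000329619811665685309166486924396311973882683097575920073996111972776821,
  1672412440602323874098606875174840415022473451024585902201008293811640405138366856125855072117523335908415716602299874070089378250021557233573037595725327725,
  1672412440601433965630019027083196645793275419439917429478800773421331310164412006704586185859372192791064180130290902644127779250675932967722102730586207455,
  2075942465702697747757228238382063001629930164325453721030882655208417006475212670158084429782484694950470041269141768766515394613268907588747458651938162185,
  2260716405390582468139991379485839849964602887570907386207544941238229922640199542907261758264043988511212107128156463614560527514629813753078868462189910931,
  1764904969936639089505571441437557866279397195544390197569528706933832645170366948126110334399177472930559552540593438555037141672669251130026988001014282602,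
  1808689724184384784560014206811030399125962977913698940661500075701351540835841880093227471448734595417996399013436756880454891069356347751752075990564752159,
  1823609171039805724642141985955993510181660192641962896729444121542223392750208513761748237115314996341802664294033152199348292728483984238528789411211548923,
  2588293697922954164136349836091053650675096241054507627971440019468628151566122632928670591214025920452807474451924575575010503400260904228130864812437206925,
  1914409772887361489006960838685298625576441752777121264210623187790107885736677362497211037288642797590932658637992179304336723194478379422636781699978097983,
  1766140593094124677707251247132547383663199293265363933553754401913238403886463949231867429586883092666107154483917705884326622269654147759471738375431768760,
  1845010559943293872963200276376753216254328241262415367604066204500385653567511603087145121285662067020496475430151997447939617949769572536851211775733313141,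
  2373882969632913365966463090501389386398124831091903380589482159645180886641327751564328861355181016374187481529923465336767942799774958810772358995333983735,
  2588343921697900491385344688922907616306244711320111194780875602452350363948727324104750047242372576237050945347752813912108540679516759767883297306363852696,
  1819962714761070246510579018620302852782306655563790189460897303754994727808490013709266211783640432381936116814074056233130942612175165544932389895720590736,
  1631098379110524134278658636482702760849475262702664303737959538494123550698775097635437601409849536476855792176665533194773180170928020162194048221152020369,
  1941140683926281313959936423682631936447414936211374835486590991597484730410913194055514131224698196278347626937449292475498889967211871231664500271198278531,
  1794084739669109905633315455206254248004270096507517099627411606043240192162810075667312853948557567166765162493225323153037849800931687062130290665970670306,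
  1794186017364051905672954566720505554415978531659443139852793997809494809697236114090161567732422967559334316179055099182055906755259252315844819410173115702,
  1911958934374615888294052718025518984177699879915495666996968211160262561586942861804074004963752927941369066139140180001238031351215448375941163850351199330,
  1632525805348517413881975027017507337069135264283114757814141804382218726162266929878613448783845678933862746770276588643351764738567641271062224236791375012,
  1778394650442006545627398903547020705667460430566661050403837554870384788295937816596471636031674253154332945448059753031527105876082356770135607689665066874,
  1690697631026179594102316329016911667361597630249166670710152201855262741114222349167251367266528833666531251936524606102569899002713598475537015707750643370,
  1632363598337887885588043624449973405140624604522350022038040120462764850491638839648511228640559513478999305616734451766238202164326565823518148212568744584,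
  2513489004475913644706152237149401081232074612975575532801783144613151147317779304460469272256467714139934776388533478253760327036016028805106375054770820910,
  1698613756980093729424424124734303098920710869321397980160923336488897857623023491957893681559412619363131614134634651857434879570084178784152478010479051435,
  1819653157077207742009114847811127406393842344656632246891011545443816877802510567580164382951138977265149492137168059351404011615751276475073631556594145183,
  1914280194793322456651326275932416637995864455944189810180605582178481786137694267414809095200865520397229769777367340824394369014111166696330517615307351531,
  1632363598301478001043109230203024447543848446287308776462465290309222384018462802239684077623827802584861767295699362871239772200155632617392442152796657833,
  1619049268733024296263941107635982736400150874409140079954459896013298093145966631787771880397715194493415951602794286632809963064414878072512554072835161884,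
  2581663662167226739592350207313226649017018697558224429903428865058807258840204923873189001025259532684990634907722597817811781583781925750548216508191390800,
  1632363594564759524682480173654997584149117825066116442250061754536441838035420047545112827530658097736640614758321519770333558504295369057710233999650661338,
  1846217333580990333805342054849913364744215666905961155191156163019660886363587362548220973691575515840720755978648790157753982879639758906260881051077089219,
  1778598367424110876700148027594460255892163169740985634101954666719269059159512062585941360613369621549161996960611645447037945583699892833923841431231034770,
  1778162715532619214613833876697394547442101091449261173258815076111152225250311975676846952218469851211953217897548118258996958662890150315676594389823791150,
  1823277470734987219580852057260886975199900607763749033340940032563733043833157058115115521170478378881733003505333399563565632692820979259217967097927560825,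
  2227319953077216112764199076984821613695488635146574072657092427286954463293465353057456465207661596480247748380343963554529765519219055629450343666416846427,
  2588348072423102647720951105158550906606994346209576235177755034065042028193313164487437881462341870760096027124319821545111768262168861729338853985042884083,
  1852469321909515793690078138936249174057569267775938110173075111189660798259538103404079219859189408087449849419846330875116049580354315283012907398797574922,
  2587790962710680174309455637673836958960488814873897099116539574392351936735357948650920212536076401090943576527897825800477706108438964336008358775693330209,
  2500231093872596099545906315676206680144857149430043069886574207766175443784466589391890140530945145822141994280573859978776411409577344915289295651612623345,
  1632304073057302156580059146994330198198742077850408960978002647552335758450186040655112944872437638698005129597949702561756391038665483861586295935870740674,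
  1764903642361153210641188196022392798126144850767821582953736275040607462416128116480166694118181915885577108623603056517053820903553895884877808472280596300,
  1764904969843601671216516482576527351260859103521657310065908854228438307953734547115566519404545369680848804896081428071765569368909767273268187881373673153,
  1619043857345311951775163074563926509633253494434270338084415473471037542450622753149044477677694997728032741520769947908531845917555725728663457231044438557,
  1823288818749613298016205848848819737103405405315080475436002887763686371238340954958075389825339962004759729584953783802268204670188368896071683278795031796,
  1632303989777701854265662841142645209682262275694623315993338605083186165316215618163368986004415070136399860594341670774889403066692995322701867554667041309,
  1619495873452380323218736557715364662544941533604633466383951190372087152100747420175646640069562884912117297439384947558231414097944228271569460899289465499,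
  1779851502423061055376106707108458433454451611229554372236192291519472602992863283698785527841882760266996477731814324599139088491804302116855998286774832078,
  1618934247372700102928295527517324356322365527357354022476410797179561968907700763489544675627738400837516336654187311706312227984979780989180488286016958063,
  1632303825994108839436086829017996257421067578355067195863894895070914042634973458841867183545304997627958008987566501261423390827785957593674674997161684441,
  1632454769580133724076645272865179484045943163105231746761732461437562220001548717590431054899141968900971475153031922095179303813109091814720534886512202294,
  33014496254513106176401226383996654110621845729204391067812646604841304283348362313908420
]

inductive A4 | a0 | a1 | a2 | a3
  deriving DecidableEq

instance : Fintype A4 := ⟨{.a0, .a1, .a2, .a3}, by intro x; cases x <;> simp⟩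

namespace A4
noncomputable def n (x : A4) : ℕ := @A4.rec (fun _ => ℕ) 0 1 2 3 x
noncomputable def sc (x : A4) : A4 := @A4.rec (fun _ => A4) a1 a2 a3 a3 x
noncomputable def sh (x : A4) : ℕ := @A4.rec (fun _ => ℕ) 0 64 128 192 x
noncomputable def pw (x : A4) : ℕ := @A4.rec (fun _ => ℕ) 1 18446744073709551616
  340282366920938463463374607431768211456
  6277101735386680763835789423207666416102355444464034512896 x
end A4
open A4

inductive T | lf (v : ℕ) | nd (t0 t1 t2 t3 : T)

noncomputable def T.ch (t : T) (x : A4) : T :=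
  @T.rec (fun _ => T) (fun v => .lf v)
    (fun t0 t1 t2 t3 _ _ _ _ => @A4.rec (fun _ => T) t0 t1 t2 t3 x) t

/-- leaf value -/
def lv (c : ℕ) : ℕ := bif Nat.ble c 1 then 0 else bif Nat.ble 20 (c+10) then 20 else c+10

def pushT (c : ℕ) (st : List T) : List T :=
  bif Nat.beq c 0 then
    match st with
    | t0 :: t1 :: t2 :: t3 :: r => .nd t0 t1 t2 t3 :: r
    | _ => []
  else .lf (lv c) :: st

def runChunk : ℕ → ℕ → List T → List T
  | 0, _, st => st
  | n+1, c, st => bif Nat.beq c 1 then st else runChunk n (c / 11) (pushT (c % 11) st)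

def runAll : List ℕ → List T → List T
  | [], st => st
  | c :: r, st => runAll r (runChunk 150 c st)

def trie : T := match runAll trieData [] with
  | t :: _ => t
  | [] => .lf 0

inductive TS | done (v : ℕ) | go (t : T) (k : A4) (p : A4 → Option A4)

noncomputable def mkTS (t : T) (k : A4) (p : A4 → Option A4) : TS :=
  @T.rec (fun _ => TS) (fun v => .done v)
    (fun t0 t1 t2 t3 _ _ _ _ => .go (.nd t0 t1 t2 t3) k p) t

noncomputable def A4.eq (x y : A4) : Bool :=
  @A4.rec (fun _ => Bool)
    (@A4.rec (fun _ => Bool) true false false false y)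
    (@A4.rec (fun _ => Bool) false true false false y)
    (@A4.rec (fun _ => Bool) false false true false y)
    (@A4.rec (fun _ => Bool) false false false true y) x

noncomputable def TS.step (ts : TS) (x : A4) : TS :=
  @TS.rec (fun _ => TS) (fun v => .done v)
    (fun t k p => @Option.rec A4 (fun _ => TS)
      (mkTS (t.ch k) k.sc
        (fun y => @Bool.rec (fun _ => Option A4) (p y) (some k) (A4.eq y x)))
      (fun l => mkTS (t.ch l) k p) (p x)) ts

noncomputable def tsOf : List A4 → TS
  | [] => .go trie a0 (fun _ => none)
  | x :: z => (tsOf z).step x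

noncomputable def Mof : List A4 → ℕ
  | [] => 25704731606408457729301013980576636981897203979495152770093055
  | x :: z => Nat.lor (Nat.mul 2 (Mof z)) x.pw

def km (l : ℕ) : ℕ := Nat.sub (Nat.pow 2 (Nat.succ (Nat.div l 2))) 1

noncomputable def Aof : List A4 → ℕ
  | [] => 2046
  | x :: z => Nat.land (Aof z) (Nat.lor (Nat.mul 2 (Nat.shiftRight (Mof z) x.sh)) (km z.length))

structure W where
  e : List A4
  c : ℕ
  M : ℕ
  A : ℕ

structure Item where
  ws : List W
  e : List A4
  t : TS

structure Goal where
  id : Option A4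
  num : ℕ
  acc : ℕ
  its : List Item

/-- step the W's; `none` if dead -/
noncomputable def stepW (x : A4) (L : ℕ) (ws : List W) : List W → Option (List W) :=
  @List.rec W (fun _ => List W → Option (List W)) (fun out => some out)
    (fun w _ ih out => @W.rec (fun _ => Option (List W))
      (fun e c M A =>
        (fun A' : ℕ => @Bool.rec (fun _ => Option (List W))
          (@Bool.rec (fun _ => Option (List W)) none
            (ih (⟨e, c, Nat.lor (Nat.mul 2 M) x.pw, A'⟩ :: out))
            (Nat.beq (Nat.land A' (km (Nat.succ (Nat.add L c)))) 0))
          (ih out)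
          (Nat.beq A' 0))
        (Nat.land A (Nat.lor (Nat.mul 2 (Nat.shiftRight M x.sh)) (km (Nat.add L c))))) w) ws

noncomputable def stepIts (x : A4) (L : ℕ) (id : Option A4) (num : ℕ) (its : List Item) :
    ℕ → List Item → Goal :=
  @List.rec Item (fun _ => ℕ → List Item → Goal) (fun acc out => ⟨id, num, acc, out⟩)
    (fun it _ ih acc out => @Item.rec (fun _ => Goal)
      (fun ws e t => @TS.rec (fun _ => Goal)
        (fun v => @Bool.rec (fun _ => Goal)
          (@Option.rec (List W) (fun _ => Goal) (ih acc out)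
            (fun l => @List.rec W (fun _ => Goal) (ih (Nat.add acc v) out)
              (fun w l _ => ih acc (⟨w :: l, e, .done v⟩ :: out)) l)
            (stepW x L ws []))
          (ih acc out)
          (Nat.beq v 0))
        (fun t' k p => @Option.rec (List W) (fun _ => Goal) (ih acc out)
            (fun l => ih acc (⟨l, e, .go t' k p⟩ :: out))
            (stepW x L ws []))
        (t.step x)) it) its

noncomputable def stepGoals (x : A4) (L : ℕ) (v : ℕ) (gs : List Goal) : List Goal → List Goal :=
  @List.rec Goal (fun _ => List Goal → List Goal) (fun out => out)
    (fun g _ ih out => @Goal.rec (fun _ => List Goal)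
      (fun id num acc its => @Goal.rec (fun _ => List Goal)
        (fun id num acc its => @Bool.rec (fun _ => List Goal)
          (ih (⟨id, num, acc, its⟩ :: out))
          (ih out)
          (Nat.ble (Nat.mul num v) (Nat.mul acc 25)))
        (stepIts x L id num its acc [])) g) gs

/-- prefix-square check -/
noncomputable def sqc (en L : ℕ) (l : List (ℕ × ℕ)) : Bool :=
  @List.rec (ℕ × ℕ) (fun _ => Bool) false
    (fun q _ ih => @Prod.rec ℕ ℕ (fun _ => Bool) (fun d m =>
      @Bool.rec (fun _ => Bool) false
        (@Bool.rec (fun _ => Bool) ih true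
          (Nat.beq (Nat.mod en m) (Nat.mod (Nat.div en m) m)))
        (Nat.ble d L)) q) l

def sqL : List (ℕ × ℕ) := [(2, 4), (4, 16), (6, 64), (8, 256), (10, 1024), (12, 4096), (14, 16384), (16, 65536), (18, 262144), (20, 1048576)]

noncomputable def tsv (t : TS) : ℕ := @TS.rec (fun _ => ℕ) (fun v => v) (fun _ _ _ => 20) t

noncomputable def node (f : ℕ) : ℕ → ℕ → TS → List Goal → Bool :=
  @Nat.rec (fun _ => ℕ → ℕ → TS → List Goal → Bool)
    (fun _ _ ts gs => @Bool.rec (fun _ => Bool)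
      (@List.rec Goal (fun _ => Bool) true (fun _ _ _ => false) gs)
      true (Nat.beq (tsv ts) 0))
    (fun _ ih L en ts gs => @Bool.rec (fun _ => Bool)
      (@List.rec Goal (fun _ => Bool) true
        (fun g gr _ =>
          (fun go : A4 → Bool =>
            @Bool.rec (fun _ => Bool) false
            (@Bool.rec (fun _ => Bool) false
            (@Bool.rec (fun _ => Bool) false (go a3) (go a2)) (go a1)) (go a0))
          (fun x => 
            @Bool.rec (fun _ => Bool)
              (ih (Nat.succ L) (Nat.add (Nat.mul 4 en) x.n) (ts.step x)
                (stepGoals x L (tsv (ts.step x)) (g :: gr) []))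
              true
              (sqc (Nat.add (Nat.mul 4 en) x.n) (Nat.succ L) sqL))) gs)
      true (Nat.beq (tsv ts) 0)) f

noncomputable def mkW (s e : List A4) : W := ⟨e, e.length, Mof (s ++ e), Aof (s ++ e)⟩
noncomputable def mkItem (s : List A4) (ws : List (List A4)) (e : List A4) : Item :=
  ⟨ws.map (mkW s), e, tsOf (s ++ e)⟩

def allA : List A4 := [a0, a1, a2, a3]

def exts : Option A4 → List (List (List A4) × List A4)
  | none => allA.map fun c => ([[c]], [c])
  | some y => allA.flatMap fun a => allA.map fun b => ([[a], [a,b], [a,b,y]], [a,b,y])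

noncomputable def mkGoal (s : List A4) (id : Option A4) (num : ℕ) : Goal :=
  ⟨id, num, 0, (exts id).map fun q => mkItem s q.1 q.2⟩

noncomputable def enc : List A4 → ℕ
  | [] => 0
  | x :: z => 4 * enc z + x.n

noncomputable def start (f : ℕ) (s : List A4) : Bool :=
  node f s.length (enc s) (tsOf s)
    [mkGoal s none 46, mkGoal s (some a0) 92, mkGoal s (some a1) 92,
     mkGoal s (some a2) 92, mkGoal s (some a3) 92]


theorem c2 : start 15 [a2,a0,a1,a0] = true := by decide +kernel
theorem c1 : start 16 [a2,a1,a0] = true := by decide +kernel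

attribute [irreducible] trie

def okv (v : ℕ) : Prop := v ≤ 20 ∧ (v = 0 ∨ 12 ≤ v)

def T.ok : T → Prop
  | .lf v => okv v
  | .nd t0 t1 t2 t3 => t0.ok ∧ t1.ok ∧ t2.ok ∧ t3.ok

theorem okv_lv (c : ℕ) : okv (lv c) := by
  unfold lv okv
  cases h : Nat.ble c 1
  · have h1 : ¬ (c ≤ 1) := by
      intro h3; have := Nat.ble_eq_true_of_le h3; rw [h] at this; cases this
    cases h2 : Nat.ble 20 (c+10)
    · have : ¬ (20 ≤ c + 10) := by
        intro h3; have := Nat.ble_eq_true_of_le h3; rw [h2] at this; cases this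
      simp only [cond_false]
      omega
    · simp
  · simp

theorem pushT_ok (c : ℕ) (st : List T) (h : ∀ t ∈ st, t.ok) : ∀ t ∈ pushT c st, t.ok := by
  unfold pushT
  cases hc : Nat.beq c 0
  · simp only [cond_false, List.mem_cons, forall_eq_or_imp]
    exact ⟨okv_lv c, h⟩
  · simp only [cond_true]
    split
    · simp only [List.mem_cons, forall_eq_or_imp] at h ⊢
      exact ⟨⟨h.1, h.2.1, h.2.2.1, h.2.2.2.1⟩, h.2.2.2.2⟩
    · simp

theorem runChunk_ok (n c : ℕ) (st : List T) (h : ∀ t ∈ st, t.ok) :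
    ∀ t ∈ runChunk n c st, t.ok := by
  induction n generalizing c st with
  | zero => simpa [runChunk] using h
  | succ n ih =>
    unfold runChunk
    cases Nat.beq c 1
    · exact ih _ _ (pushT_ok _ _ h)
    · exact h

theorem runAll_ok (l : List ℕ) (st : List T) (h : ∀ t ∈ st, t.ok) :
    ∀ t ∈ runAll l st, t.ok := by
  induction l generalizing st with
  | nil => simpa [runAll] using h
  | cons c l ih => exact ih _ (runChunk_ok _ _ _ h)

theorem trie_ok : trie.ok := by
  have h := runAll_ok trieData [] (by simp)
  unfold trie
  generalize runAll trieData [] = l at *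
  cases l with
  | nil => exact ⟨by norm_num, Or.inl rfl⟩
  | cons t r => exact h t (by simp)

def TS.ok : TS → Prop
  | .done v => okv v
  | .go t _ _ => t.ok

theorem T.ch_ok (t : T) (x : A4) (h : t.ok) : (t.ch x).ok := by
  cases t with
  | lf v => exact h
  | nd t0 t1 t2 t3 =>
    obtain ⟨h0, h1, h2, h3⟩ := h
    cases x <;> assumption

theorem mkTS_ok (t : T) (k p) (h : t.ok) : (mkTS t k p).ok := by
  cases t <;> exact h

theorem TS.step_ok (ts : TS) (x : A4) (h : ts.ok) : (ts.step x).ok := by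
  cases ts with
  | done v => exact h
  | go t k p =>
    unfold TS.step
    cases hp : p x <;> simp only [hp] <;> exact mkTS_ok _ _ _ (T.ch_ok _ _ h)

theorem tsOf_ok (z : List A4) : (tsOf z).ok := by
  induction z with
  | nil => simp only [tsOf, TS.ok]; exact trie_ok
  | cons x z ih => exact TS.step_ok _ _ ih

def TS.fv : TS → ℕ
  | .done v => v
  | .go _ _ _ => 0

/-- the weight -/
noncomputable def F (z : List A4) : ℕ := (tsOf z).fv

theorem F_okv (z : List A4) : okv (F z) := by
  have := tsOf_ok z
  unfold F
  cases h : tsOf z with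
  | done v => rw [h] at this; exact this
  | go => exact ⟨by simp [TS.fv], Or.inl rfl⟩

theorem tsOf_done (u s : List A4) (v : ℕ) (h : tsOf s = .done v) : tsOf (u ++ s) = .done v := by
  induction u with
  | nil => simpa using h
  | cons x u ih =>
    show (tsOf (u ++ s)).step x = _
    rw [ih]; rfl

theorem F_le_tsv (u s : List A4) : F (u ++ s) ≤ tsv (tsOf s) := by
  cases h : tsOf s with
  | done v => unfold F; rw [tsOf_done u s v h]; exact le_rfl
  | go => exact (F_okv _).1

/-! squares -/
def SS (z : List A4) : Prop := ∃ u t : List A4, t ≠ [] ∧ t.length ≤ 10 ∧ z = u ++ (t ++ t)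
def SSF (s : List A4) : Prop :=
  ∀ u t w : List A4, t ≠ [] → t.length ≤ 10 → s ≠ u ++ (t ++ (t ++ w))

theorem testBit_two_mul_succ' (m j : ℕ) : (2 * m).testBit (j+1) = m.testBit j := by
  rw [Nat.testBit_succ]; congr 1; omega

theorem Mof_bit (z : List A4) (j : ℕ) (x : A4) (hj : j < 10)
    (h : ∀ y, z[j]? = some y → y = x) : (Mof z).testBit (x.sh + j) = true := by
  induction z generalizing j with
  | nil =>
    clear h
    cases x <;> interval_cases j <;> decide +kernel
  | cons y z ih =>
    show (Nat.lor (Nat.mul 2 (Mof z)) y.pw).testBit _ = true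
    change ((2 * Mof z) ||| y.pw).testBit _ = true
    rw [Nat.testBit_or]
    cases j with
    | zero =>
      have : y = x := h y (by simp)
      subst this
      have : y.pw.testBit (y.sh + 0) = true := by cases y <;> decide +kernel
      rw [this, Bool.or_true]
    | succ j =>
      have := ih j (by omega) (fun y hy => h y (by simpa using hy))
      rw [← Nat.add_assoc, testBit_two_mul_succ', this]; rfl

theorem km_bit (l p : ℕ) (h : 2 * p ≤ l) : (km l).testBit p = true := by
  show (2 ^ (l/2+1) - 1).testBit p = true
  rw [Nat.testBit_two_pow_sub_one]; simp; omega

theorem Aof_bit (z u v t : List A4) (ht : t ≠ []) (h10 : t.length ≤ 10)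
    (h : u ++ z = v ++ (t ++ t)) : (Aof z).testBit t.length = true := by
  have hp : 0 < t.length := List.length_pos_iff.2 ht
  induction z generalizing u with
  | nil =>
    show Nat.testBit 2046 _ = true
    generalize t.length = p at *
    interval_cases p <;> decide
  | cons x z ih =>
    have h1 := ih (u ++ [x]) (by simpa using h)
    show (Nat.land (Aof z) (Nat.lor (Nat.mul 2 (Nat.shiftRight (Mof z) x.sh)) (km z.length))).testBit _ = true
    change ((Aof z) &&& ((2 * (Mof z >>> x.sh)) ||| (km z.length))).testBit _ = true
    rw [Nat.testBit_and, h1, Nat.testBit_or, Bool.true_and, Bool.or_eq_true]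
    by_cases hl : 2 * t.length ≤ z.length
    · exact Or.inr (km_bit _ _ hl)
    · left
      obtain ⟨p, hpp⟩ : ∃ p, t.length = p + 1 := ⟨t.length - 1, by omega⟩
      rw [hpp, testBit_two_mul_succ', Nat.testBit_shiftRight]
      apply Mof_bit _ _ _ (by omega)
      intro y hy
      have hlen := congrArg List.length h
      simp at hlen
      have e1 : (u ++ x :: z)[u.length]? = some x := by simp
      have e2 : (u ++ x :: z)[u.length + (p+1)]? = some y := by
        rw [List.getElem?_append_right (by omega)]; simpa using hy
      rw [h] at e1 e2
      have hlt : p < z.length := (List.getElem?_eq_some_iff.1 hy).1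
      rw [List.getElem?_append_right (by omega), List.getElem?_append_left (by omega)] at e1
      rw [List.getElem?_append_right (by omega), List.getElem?_append_right (by omega)] at e2
      have : u.length + (p+1) - v.length - t.length = u.length - v.length := by omega
      rw [this, e1] at e2
      exact (Option.some.inj e2).symm

def WOK (s : List A4) (w : W) : Prop :=
  w.c = w.e.length ∧ w.M = Mof (s ++ w.e) ∧ w.A = Aof (s ++ w.e)

def Bd (ws : List W) (s : List A4) : Prop := ∃ w ∈ ws, SS (s ++ w.e)

theorem stepW_spec (x : A4) (s : List A4) (ws out l : List W)
    (h1 : ∀ w ∈ ws, WOK s w) (h2 : ∀ w ∈ out, WOK (x :: s) w)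
    (h : stepW x s.length ws out = some l) :
    (∀ w ∈ l, WOK (x :: s) w) ∧
    ∀ u, (Bd ws (u ++ x :: s) ∨ Bd out (u ++ x :: s)) → Bd l (u ++ x :: s) := by
  induction ws generalizing out with
  | nil =>
    have : out = l := Option.some.inj h
    subst this
    refine ⟨h2, fun u hu => ?_⟩
    rcases hu with ⟨w, hw, _⟩ | hu
    · simp at hw
    · exact hu
  | cons w r ih =>
    obtain ⟨e, c, M, A⟩ := w
    have hw := h1 ⟨e, c, M, A⟩ (by simp)
    have hr : ∀ w ∈ r, WOK s w := fun w hw => h1 w (by simp [hw])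
    obtain ⟨hc, hM, hA⟩ := hw
    simp only at hc hM hA
    have hA' : Nat.land A (Nat.lor (Nat.mul 2 (Nat.shiftRight M x.sh)) (km (Nat.add s.length c)))
        = Aof (x :: s ++ e) := by
      rw [hA, hM, hc]
      show _ = Nat.land (Aof (s++e)) (Nat.lor (Nat.mul 2 (Nat.shiftRight (Mof (s++e)) x.sh)) (km (s ++ e).length))
      rw [List.length_append]; rfl
    have hu : stepW x s.length (⟨e, c, M, A⟩ :: r) out =
       @Bool.rec (fun _ => Option (List W))
          (@Bool.rec (fun _ => Option (List W)) none
            (stepW x s.length r (⟨e, c, Nat.lor (Nat.mul 2 M) x.pw, Aof (x :: s ++ e)⟩ :: out))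
            (Nat.beq (Nat.land (Aof (x :: s ++ e)) (km (Nat.succ (Nat.add s.length c)))) 0))
          (stepW x s.length r out)
          (Nat.beq (Aof (x :: s ++ e)) 0) := by
      rw [← hA']; rfl
    rw [hu] at h
    cases hb : Nat.beq (Aof (x :: s ++ e)) 0
    · rw [hb] at h
      cases hb2 : Nat.beq (Nat.land (Aof (x :: s ++ e)) (km (Nat.succ (Nat.add s.length c)))) 0
      · rw [hb2] at h; simp at h
      · rw [hb2] at h
        have := ih _ hr (by
          intro w hw
          rcases List.mem_cons.1 hw with rfl | hw
          · refine ⟨hc, ?_, rfl⟩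
            show Nat.lor (Nat.mul 2 M) x.pw = Nat.lor (Nat.mul 2 (Mof (s ++ e))) x.pw
            rw [hM]
          · exact h2 w hw) h
        refine ⟨this.1, fun u hu => this.2 u ?_⟩
        rcases hu with ⟨w, hw, hs⟩ | ⟨w, hw, hs⟩
        · rcases List.mem_cons.1 hw with rfl | hw
          · exact Or.inr ⟨_, List.mem_cons_self, hs⟩
          · exact Or.inl ⟨w, hw, hs⟩
        · exact Or.inr ⟨w, by simp [hw], hs⟩
    · rw [hb] at h
      have hz : Aof (x :: s ++ e) = 0 := Nat.eq_of_beq_eq_true hb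
      have := ih out hr h2 h
      refine ⟨this.1, fun u hu => this.2 u ?_⟩
      rcases hu with ⟨w, hw, hs⟩ | hu
      · rcases List.mem_cons.1 hw with rfl | hw
        · obtain ⟨v, t, ht, h10, he⟩ := hs
          have := Aof_bit (x :: s ++ e) u v t ht h10 (by simpa using he)
          rw [hz] at this
          simp at this
        · exact Or.inl ⟨w, hw, hs⟩
      · exact Or.inr hu

open Classical in
noncomputable def icv (s : List A4) (it : Item) : ℕ :=
  if Bd it.ws s then 0 else F (s ++ it.e)

noncomputable def isum (s : List A4) (l : List Item) : ℕ := (l.map (icv s)).sum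

def IOK (s : List A4) (it : Item) : Prop :=
  (∀ w ∈ it.ws, WOK s w) ∧ it.t = tsOf (s ++ it.e)

theorem stepIts_cons (x : A4) (L : ℕ) (id : Option A4) (num : ℕ) (ws : List W) (e : List A4)
    (t : TS) (r : List Item) (acc : ℕ) (out : List Item) :
    stepIts x L id num (⟨ws, e, t⟩ :: r) acc out =
      @TS.rec (fun _ => Goal)
        (fun v => @Bool.rec (fun _ => Goal)
          (@Option.rec (List W) (fun _ => Goal) (stepIts x L id num r acc out)
            (fun l => @List.rec W (fun _ => Goal) (stepIts x L id num r (Nat.add acc v) out)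
              (fun w l _ => stepIts x L id num r acc (⟨w :: l, e, .done v⟩ :: out)) l)
            (stepW x L ws []))
          (stepIts x L id num r acc out)
          (Nat.beq v 0))
        (fun t' k p => @Option.rec (List W) (fun _ => Goal) (stepIts x L id num r acc out)
            (fun l => stepIts x L id num r acc (⟨l, e, .go t' k p⟩ :: out))
            (stepW x L ws []))
        (t.step x) := rfl

theorem stepIts_spec (x : A4) (s : List A4) (id : Option A4) (num : ℕ) (its : List Item)
    (acc : ℕ) (out : List Item)
    (h1 : ∀ i ∈ its, IOK s i) (h2 : ∀ i ∈ out, IOK (x :: s) i) :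
    (stepIts x s.length id num its acc out).id = id ∧
    (stepIts x s.length id num its acc out).num = num ∧
    (∀ i ∈ (stepIts x s.length id num its acc out).its, IOK (x :: s) i) ∧
    ∀ u, (stepIts x s.length id num its acc out).acc +
      isum (u ++ x :: s) (stepIts x s.length id num its acc out).its ≤
      acc + isum (u ++ x :: s) its + isum (u ++ x :: s) out := by
  induction its generalizing acc out with
  | nil => 
    refine ⟨rfl, rfl, h2, fun u => ?_⟩
    show acc + isum _ out ≤ _
    omega
  | cons it r ih =>
    obtain ⟨ws, e, t⟩ := it
    have hr : ∀ i ∈ r, IOK s i := fun i hi => h1 i (by simp [hi])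
    obtain ⟨hw, ht⟩ := h1 ⟨ws, e, t⟩ (by simp)
    simp only at hw ht
    have hts : t.step x = tsOf (x :: s ++ e) := by rw [ht]; rfl
    have hcons : ∀ u (i : Item) l, isum u (i :: l) = icv u i + isum u l := by
      intro u i l; simp [isum]
    -- skip case
    have skip : ∀ G, G = stepIts x s.length id num r acc out → 
      G.id = id ∧ G.num = num ∧ (∀ i ∈ G.its, IOK (x :: s) i) ∧
      ∀ u, G.acc + isum (u ++ x :: s) G.its ≤
        acc + isum (u ++ x :: s) (⟨ws, e, t⟩ :: r) + isum (u ++ x :: s) out := by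
      rintro G rfl
      obtain ⟨a, b, c, d⟩ := ih acc out hr h2
      refine ⟨a, b, c, fun u => ?_⟩
      have := d u
      rw [hcons]; omega
    -- keep case
    have keep : ∀ G l, stepW x s.length ws [] = some l →
      G = stepIts x s.length id num r acc (⟨l, e, t.step x⟩ :: out) → 
      G.id = id ∧ G.num = num ∧ (∀ i ∈ G.its, IOK (x :: s) i) ∧
      ∀ u, G.acc + isum (u ++ x :: s) G.its ≤
        acc + isum (u ++ x :: s) (⟨ws, e, t⟩ :: r) + isum (u ++ x :: s) out := by
      rintro G l hl rfl
      obtain ⟨q1, q2⟩ := stepW_spec x s ws [] l hw (by simp) hl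
      obtain ⟨a, b, c, d⟩ := ih acc (⟨l, e, t.step x⟩ :: out) hr (by
        intro i hi
        rcases List.mem_cons.1 hi with rfl | hi
        · exact ⟨q1, hts⟩
        · exact h2 i hi)
      refine ⟨a, b, c, fun u => ?_⟩
      have := d u
      rw [hcons] at this ⊢
      have : icv (u ++ x :: s) ⟨l, e, t.step x⟩ ≤ icv (u ++ x :: s) ⟨ws, e, t⟩ := by
        unfold icv
        by_cases hb : Bd ws (u ++ x :: s)
        · rw [if_pos (q2 u (Or.inl hb))]; omega
        · rw [if_neg hb]; split <;> simp
      omega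
    cases hs : t.step x with
    | done v =>
      have hu : stepIts x s.length id num (⟨ws, e, t⟩ :: r) acc out =
        @Bool.rec (fun _ => Goal)
          (@Option.rec (List W) (fun _ => Goal) (stepIts x s.length id num r acc out)
            (fun l => @List.rec W (fun _ => Goal) (stepIts x s.length id num r (Nat.add acc v) out)
              (fun w l _ => stepIts x s.length id num r acc (⟨w :: l, e, .done v⟩ :: out)) l)
            (stepW x s.length ws []))
          (stepIts x s.length id num r acc out)
          (Nat.beq v 0) := by
        rw [stepIts_cons, hs]
      cases hb : Nat.beq v 0
      · cases hl : stepW x s.length ws [] with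
        | none => rw [hb, hl] at hu; exact skip _ hu
        | some l =>
          rw [hb, hl] at hu
          cases l with
          | cons w l => exact keep _ _ hl (by rw [hs]; exact hu)
          | nil =>
            obtain ⟨q1, q2⟩ := stepW_spec x s ws [] [] hw (by simp) hl
            obtain ⟨a, b, c, d⟩ := ih (acc + v) out hr h2
            rw [show stepIts x s.length id num (⟨ws, e, t⟩ :: r) acc out = 
              stepIts x s.length id num r (acc + v) out from hu]
            refine ⟨a, b, c, fun u => ?_⟩
            have := d u
            rw [hcons]
            have : icv (u ++ x :: s) ⟨ws, e, t⟩ = v := by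
              unfold icv
              rw [if_neg]
              · unfold F
                rw [show u ++ x :: s ++ e = u ++ (x :: s ++ e) by simp,
                  tsOf_done u (x :: s ++ e) v (by rw [← hts, hs])]; rfl
              · intro hb
                obtain ⟨w, hw, _⟩ := q2 u (Or.inl hb)
                simp at hw
            omega
      · rw [hb] at hu; exact skip _ hu
    | go t' k p =>
      have hu : stepIts x s.length id num (⟨ws, e, t⟩ :: r) acc out =
         @Option.rec (List W) (fun _ => Goal) (stepIts x s.length id num r acc out)
            (fun l => stepIts x s.length id num r acc (⟨l, e, .go t' k p⟩ :: out))
            (stepW x s.length ws []) := by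
        rw [stepIts_cons, hs]
      cases hl : stepW x s.length ws [] with
      | none => rw [hl] at hu; exact skip _ hu
      | some l => rw [hl] at hu; exact keep _ _ hl (by rw [hs]; exact hu)

open Classical in
noncomputable def cv (s : List A4) (q : List (List A4) × List A4) : ℕ :=
  if ∃ e' ∈ q.1, SS (s ++ e') then 0 else F (s ++ q.2)

noncomputable def Gs (id : Option A4) (s : List A4) : ℕ := ((exts id).map (cv s)).sum

def GOK (s : List A4) (g : Goal) : Prop :=
  (∀ i ∈ g.its, IOK s i) ∧ ∀ u, g.acc + isum (u ++ s) g.its ≤ Gs g.id (u ++ s)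

theorem mkGoal_ok (s : List A4) (id : Option A4) (num : ℕ) : GOK s (mkGoal s id num) := by
  constructor
  · intro i hi
    obtain ⟨q, hq, rfl⟩ := List.mem_map.1 hi
    refine ⟨?_, rfl⟩
    intro w hw
    obtain ⟨e, he, rfl⟩ := List.mem_map.1 hw
    exact ⟨rfl, rfl, rfl⟩
  · intro u
    apply le_of_eq
    show 0 + ((List.map _ (List.map _ _)).sum) = _
    rw [List.map_map, Nat.zero_add]
    unfold Gs
    congr 1
    apply List.map_congr_left
    intro q _
    have : Bd (mkItem s q.1 q.2).ws (u ++ s) ↔ ∃ e' ∈ q.1, SS (u ++ s ++ e') := by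
      constructor
      · rintro ⟨w, hw, h⟩
        obtain ⟨e, he, rfl⟩ := List.mem_map.1 hw
        exact ⟨e, he, h⟩
      · rintro ⟨e, he, h⟩
        exact ⟨mkW s e, List.mem_map.2 ⟨e, he, rfl⟩, h⟩
    show icv (u ++ s) (mkItem s q.1 q.2) = cv (u ++ s) q
    unfold icv cv
    by_cases hc : ∃ e' ∈ q.1, SS (u ++ s ++ e')
    · rw [if_pos hc, if_pos (this.2 hc)]
    · rw [if_neg hc, if_neg (fun h => hc (this.1 h))]; rfl

theorem stepGoals_cons (x : A4) (L v : ℕ) (g : Goal) (r out : List Goal) :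
    stepGoals x L v (g :: r) out = @Bool.rec (fun _ => List Goal)
      (stepGoals x L v r (stepIts x L g.id g.num g.its g.acc [] :: out))
      (stepGoals x L v r out)
      (Nat.ble (Nat.mul (stepIts x L g.id g.num g.its g.acc []).num v)
        (Nat.mul (stepIts x L g.id g.num g.its g.acc []).acc 25)) := rfl

def Fine (num : ℕ) (id : Option A4) (w : List A4) : Prop := num * F w ≤ 25 * Gs id w

theorem stepGoals_spec (x : A4) (s : List A4) (gs out : List Goal)
    (h1 : ∀ g ∈ gs, GOK s g) (h2 : ∀ g ∈ out, GOK (x :: s) g) (res : List Goal)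
    (hres : stepGoals x s.length (tsv (tsOf (x :: s))) gs out = res) :
    (∀ g ∈ res, GOK (x :: s) g) ∧
    ∀ g, g ∈ gs ∨ g ∈ out → (∃ g' ∈ res, g'.id = g.id ∧ g'.num = g.num) ∨
      ∀ u, Fine g.num g.id (u ++ x :: s) := by
  induction gs generalizing out with
  | nil =>
    have : out = res := hres
    subst this
    refine ⟨h2, fun g hg => ?_⟩
    rcases hg with hg | hg
    · simp at hg
    · exact Or.inl ⟨g, hg, rfl, rfl⟩
  | cons g r ih =>
    rw [stepGoals_cons] at hres
    have hr : ∀ g ∈ r, GOK s g := fun i hi => h1 i (by simp [hi])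
    obtain ⟨q1, q2⟩ := h1 g (by simp)
    obtain ⟨a, b, c, d⟩ := stepIts_spec x s g.id g.num g.its g.acc [] q1 (by simp)
    generalize stepIts x s.length g.id g.num g.its g.acc [] = G' at *
    have hG : GOK (x :: s) G' := by
      refine ⟨c, fun u => ?_⟩
      have e1 := d u
      have e2 := q2 (u ++ [x])
      rw [show u ++ [x] ++ s = u ++ x :: s by simp] at e2
      have e3 : isum (u ++ x :: s) [] = 0 := rfl
      rw [a]
      omega
    cases hb : Nat.ble (Nat.mul G'.num (tsv (tsOf (x :: s)))) (Nat.mul G'.acc 25)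
    · rw [hb] at hres
      obtain ⟨p1, p2⟩ := ih (G' :: out) hr (by
        intro i hi
        rcases List.mem_cons.1 hi with rfl | hi
        · exact hG
        · exact h2 i hi) hres
      refine ⟨p1, fun g0 hg0 => ?_⟩
      rcases hg0 with hg0 | hg0
      · rcases List.mem_cons.1 hg0 with rfl | hg0
        · have := p2 G' (Or.inr (by simp))
          rwa [a, b] at this
        · exact p2 g0 (Or.inl hg0)
      · exact p2 g0 (Or.inr (by simp [hg0]))
    · rw [hb] at hres
      obtain ⟨p1, p2⟩ := ih out hr h2 hres
      refine ⟨p1, fun g0 hg0 => ?_⟩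
      rcases hg0 with hg0 | hg0
      · rcases List.mem_cons.1 hg0 with rfl | hg0
        · right
          intro u
          have e1 : G'.num * tsv (tsOf (x :: s)) ≤ G'.acc * 25 := Nat.le_of_ble_eq_true hb
          have e2 := F_le_tsv u (x :: s)
          have e3 := hG.2 u
          have e4 := Nat.mul_le_mul_left G'.num e2
          rw [a] at e3
          unfold Fine
          rw [b] at e1 e4
          omega
        · exact p2 g0 (Or.inl hg0)
      · exact p2 g0 (Or.inr hg0)

theorem enc_lt (s : List A4) : enc s < 4 ^ s.length := by
  induction s with
  | nil => simp [enc]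
  | cons x s ih =>
    have : x.n < 4 := by cases x <;> decide
    simp only [enc, List.length_cons, pow_succ]; omega

theorem A4.n_inj (x y : A4) (h : x.n = y.n) : x = y := by
  cases x <;> cases y <;> first | rfl | (exact absurd h (by decide))

theorem enc_inj (s t : List A4) (hl : s.length = t.length) (h : enc s = enc t) : s = t := by
  induction s generalizing t with
  | nil => cases t with
    | nil => rfl
    | cons => simp at hl
  | cons x s ih => cases t with
    | nil => simp at hl
    | cons y t =>
      have h1 : x.n < 4 := by cases x <;> decide
      have h2 : y.n < 4 := by cases y <;> decide
      simp only [enc] at h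
      have := ih t (by simpa using hl) (by omega)
      have := A4.n_inj x y (by omega)
      simp_all

theorem enc_append (s t : List A4) : enc (s ++ t) = enc s + 4 ^ s.length * enc t := by
  induction s with
  | nil => simp [enc]
  | cons x s ih => simp only [enc, List.cons_append, ih, List.length_cons, pow_succ]; ring

theorem sqc_spec (s : List A4) (l : List (ℕ × ℕ))
    (hl : ∀ q ∈ l, ∃ p, 1 ≤ p ∧ p ≤ 10 ∧ q = (2 * p, 4 ^ p))
    (h : sqc (enc s) s.length l = true) :
    ∃ t w : List A4, t ≠ [] ∧ t.length ≤ 10 ∧ s = t ++ (t ++ w) := by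
  induction l with
  | nil => cases h
  | cons q r ih =>
    obtain ⟨p, hp1, hp2, rfl⟩ := hl q (by simp)
    have ih := ih (fun q hq => hl q (by simp [hq]))
    change @Bool.rec (fun _ => Bool) false
        (@Bool.rec (fun _ => Bool) (sqc (enc s) s.length r) true
          (Nat.beq (Nat.mod (enc s) (4^p)) (Nat.mod (Nat.div (enc s) (4^p)) (4^p))))
        (Nat.ble (2*p) s.length) = true at h
    cases hb : Nat.ble (2*p) s.length
    · rw [hb] at h; cases h
    · rw [hb] at h
      cases hb2 : Nat.beq (Nat.mod (enc s) (4^p)) (Nat.mod (Nat.div (enc s) (4^p)) (4^p))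
      · rw [hb2] at h; exact ih h
      · have e1 : 2 * p ≤ s.length := Nat.le_of_ble_eq_true hb
        have e2 : enc s % 4^p = enc s / 4^p % 4^p := Nat.eq_of_beq_eq_true hb2
        obtain ⟨t, s1, rfl, ht⟩ : ∃ t s1, s = t ++ s1 ∧ t.length = p :=
          ⟨s.take p, s.drop p, (List.take_append_drop _ _).symm, by simp; omega⟩
        obtain ⟨t', w, rfl, ht'⟩ : ∃ t' w, s1 = t' ++ w ∧ t'.length = p :=
          ⟨s1.take p, s1.drop p, (List.take_append_drop _ _).symm, by simp at *; omega⟩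
        rw [enc_append, enc_append, ht, ht'] at e2
        have l1 := enc_lt t
        have l2 := enc_lt t'
        rw [ht] at l1
        rw [ht'] at l2
        have hpos : 0 < 4 ^ p := by positivity
        rw [Nat.add_mul_mod_self_left, Nat.mod_eq_of_lt l1, Nat.add_mul_div_left _ _ hpos,
          Nat.div_eq_of_lt l1, Nat.zero_add, Nat.add_mul_mod_self_left, Nat.mod_eq_of_lt l2] at e2
        have := enc_inj t t' (by omega) e2
        subst this
        refine ⟨t, w, ?_, by omega, rfl⟩
        rintro rfl
        simp at ht; omega

theorem sqL_ok : ∀ q ∈ sqL, ∃ p, 1 ≤ p ∧ p ≤ 10 ∧ q = (2 * p, 4 ^ p) := by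
  intro q hq
  simp only [sqL, List.mem_cons, List.not_mem_nil, or_false] at hq
  rcases hq with h|h|h|h|h|h|h|h|h|h
  exacts [⟨1, by simp [h]⟩, ⟨2, by simp [h]⟩, ⟨3, by simp [h]⟩, ⟨4, by simp [h]⟩, ⟨5, by simp [h]⟩,
    ⟨6, by simp [h]⟩, ⟨7, by simp [h]⟩, ⟨8, by simp [h]⟩, ⟨9, by simp [h]⟩, ⟨10, by simp [h]⟩]

theorem node_succ (f L en : ℕ) (ts : TS) (g : Goal) (gr : List Goal) :
    node (f+1) L en ts (g :: gr) = @Bool.rec (fun _ => Bool)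
          ((fun go : A4 → Bool =>
            @Bool.rec (fun _ => Bool) false
            (@Bool.rec (fun _ => Bool) false
            (@Bool.rec (fun _ => Bool) false (go a3) (go a2)) (go a1)) (go a0))
          (fun x =>
            @Bool.rec (fun _ => Bool)
              (node f (Nat.succ L) (Nat.add (Nat.mul 4 en) x.n) (ts.step x)
                (stepGoals x L (tsv (ts.step x)) (g :: gr) []))
              true
              (sqc (Nat.add (Nat.mul 4 en) x.n) (Nat.succ L) sqL)))
      true (Nat.beq (tsv ts) 0) := rfl

theorem Fine_of_dead (num : ℕ) (id : Option A4) (u s : List A4) (h : Nat.beq (tsv (tsOf s)) 0 = true) :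
    Fine num id (u ++ s) := by
  have h1 := F_le_tsv u s
  have h2 : tsv (tsOf s) = 0 := Nat.eq_of_beq_eq_true h
  have : F (u ++ s) = 0 := by omega
  simp [Fine, this]

theorem node_spec (f : ℕ) (s : List A4) (gs : List Goal) (hg : ∀ g ∈ gs, GOK s g)
    (h : node f s.length (enc s) (tsOf s) gs = true) (u : List A4) (hu : f ≤ u.length)
    (hs : SSF (u ++ s)) : ∀ g ∈ gs, Fine g.num g.id (u ++ s) := by
  induction f generalizing s gs u with
  | zero =>
    intro g hgg
    cases gs with
    | nil => simp at hgg
    | cons g' gr =>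
      cases hb : Nat.beq (tsv (tsOf s)) 0
      · change @Bool.rec (fun _ => Bool) false true (Nat.beq (tsv (tsOf s)) 0) = true at h
        rw [hb] at h; cases h
      · exact Fine_of_dead _ _ _ _ hb
  | succ f ih =>
    cases gs with
    | nil => simp
    | cons g' gr =>
      rw [node_succ] at h
      cases hb : Nat.beq (tsv (tsOf s)) 0
      · rw [hb] at h
        have key : ∀ go : A4 → Bool, @Bool.rec (fun _ => Bool) false
            (@Bool.rec (fun _ => Bool) false
            (@Bool.rec (fun _ => Bool) false (go a3) (go a2)) (go a1)) (go a0) = true →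
            ∀ x, go x = true := by
          intro go hgo x
          cases h0 : go a0 <;> rw [h0] at hgo
          · cases hgo
          cases h1 : go a1 <;> rw [h1] at hgo
          · cases hgo
          cases h2 : go a2 <;> rw [h2] at hgo
          · cases hgo
          cases x <;> assumption
        have hall := key (fun x => @Bool.rec (fun _ => Bool)
              (node f (Nat.succ s.length) (Nat.add (Nat.mul 4 (enc s)) x.n) ((tsOf s).step x)
                (stepGoals x s.length (tsv ((tsOf s).step x)) (g' :: gr) []))
              true
              (sqc (Nat.add (Nat.mul 4 (enc s)) x.n) (Nat.succ s.length) sqL)) h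
        have hne : u ≠ [] := by rintro rfl; simp at hu
        obtain ⟨u', x, rfl⟩ : ∃ u' x, u = u' ++ [x] :=
          ⟨u.dropLast, u.getLast hne, (List.dropLast_append_getLast hne).symm⟩
        have hx := hall x
        rw [show u' ++ [x] ++ s = u' ++ x :: s by simp] at hs ⊢
        have hsq : sqc (Nat.add (Nat.mul 4 (enc s)) x.n) (Nat.succ s.length) sqL = false := by
          by_contra hc
          have hc : sqc (enc (x :: s)) (x :: s).length sqL = true := by
            rw [Bool.not_eq_false] at hc; exact hc
          obtain ⟨t, w, t1, t2, t3⟩ := sqc_spec _ _ sqL_ok hc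
          exact hs u' t w t1 t2 (by rw [t3])
        rw [hsq] at hx
        obtain ⟨p1, p2⟩ := stepGoals_spec x s (g' :: gr) [] hg (by simp) _ rfl
        have hx : node f (x :: s).length (enc (x :: s)) (tsOf (x :: s))
          (stepGoals x s.length (tsv (tsOf (x :: s))) (g' :: gr) []) = true := hx
        have := ih (x :: s) _ p1 hx u' (by simp at hu; omega) hs
        intro g hgg
        rcases p2 g (Or.inl hgg) with ⟨g2, h2, h3, h4⟩ | h5
        · have := this g2 h2
          rwa [h3, h4] at this
        · exact h5 u'
      · intro g _
        exact Fine_of_dead _ _ _ _ hb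

def AllFine (w : List A4) : Prop := Fine 46 none w ∧ ∀ y, Fine 92 (some y) w

theorem start_spec (f : ℕ) (s u : List A4) (h : start f s = true) (hu : f ≤ u.length)
    (hs : SSF (u ++ s)) : AllFine (u ++ s) := by
  unfold start at h
  have hg : ∀ g ∈ [mkGoal s none 46, mkGoal s (some a0) 92, mkGoal s (some a1) 92,
      mkGoal s (some a2) 92, mkGoal s (some a3) 92], GOK s g := by
    intro g hg
    rcases List.mem_cons.1 hg with h | hg
    · rw [h]; exact mkGoal_ok _ _ _
    rcases List.mem_cons.1 hg with h | hg
    · rw [h]; exact mkGoal_ok _ _ _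
    rcases List.mem_cons.1 hg with h | hg
    · rw [h]; exact mkGoal_ok _ _ _
    rcases List.mem_cons.1 hg with h | hg
    · rw [h]; exact mkGoal_ok _ _ _
    rcases List.mem_cons.1 hg with h | hg
    · rw [h]; exact mkGoal_ok _ _ _
    · cases hg
  have key := node_spec f s _ hg h u hu hs
  have e0 : Fine 46 none (u ++ s) := key (mkGoal s none 46) (.head _)
  have e1 : Fine 92 (some a0) (u ++ s) := key (mkGoal s (some a0) 92) (.tail _ (.head _))
  have e2 : Fine 92 (some a1) (u ++ s) := key (mkGoal s (some a1) 92) (.tail _ (.tail _ (.head _)))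
  have e3 : Fine 92 (some a2) (u ++ s) := key (mkGoal s (some a2) 92) (.tail _ (.tail _ (.tail _ (.head _))))
  have e4 : Fine 92 (some a3) (u ++ s) := key (mkGoal s (some a3) 92) (.tail _ (.tail _ (.tail _ (.tail _ (.head _)))))
  refine ⟨e0, fun y => ?_⟩
  cases y
  exacts [e1, e2, e3, e4]

/-! symmetry -/
def TSrel (σ : Equiv.Perm A4) : TS → TS → Prop
  | .done v, .done v' => v = v'
  | .go t k p, .go t' k' p' => t = t' ∧ k = k' ∧ ∀ x, p' (σ x) = p x
  | _, _ => False

theorem A4.eq_iff (x y : A4) : A4.eq x y = decide (x = y) := by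
  cases x <;> cases y <;> rfl

theorem mkTS_rel (σ : Equiv.Perm A4) (t : T) (k : A4) (p p' : A4 → Option A4)
    (h : ∀ x, p' (σ x) = p x) : TSrel σ (mkTS t k p) (mkTS t k p') := by
  cases t with
  | lf v => rfl
  | nd => exact ⟨rfl, rfl, h⟩

theorem step_rel (σ : Equiv.Perm A4) (s s' : TS) (x : A4) (h : TSrel σ s s') :
    TSrel σ (s.step x) (s'.step (σ x)) := by
  cases s with
  | done v => cases s' with
    | done v' => exact h
    | go => exact h.elim
  | go t k p => cases s' with
    | done v' => exact h.elim
    | go t' k' p' =>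
      obtain ⟨rfl, rfl, h⟩ := h
      unfold TS.step
      simp only [h]
      cases hp : p x with
      | some l => exact mkTS_rel σ _ _ _ _ h
      | none =>
        apply mkTS_rel
        intro y
        simp only [A4.eq_iff, h, σ.injective.eq_iff]

theorem tsOf_rel (σ : Equiv.Perm A4) (z : List A4) : TSrel σ (tsOf z) (tsOf (z.map σ)) := by
  induction z with
  | nil => exact ⟨rfl, rfl, fun _ => rfl⟩
  | cons x z ih => exact step_rel σ _ _ x ih

theorem F_map (σ : Equiv.Perm A4) (z : List A4) : F (z.map σ) = F z := by
  have := tsOf_rel σ z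
  unfold F
  cases h : tsOf z <;> cases h' : tsOf (z.map σ) <;> rw [h, h'] at this
  · exact (show _ = _ from this).symm
  · exact this.elim
  · exact this.elim
  · rfl

theorem SS_map (σ : Equiv.Perm A4) (z : List A4) (h : SS z) : SS (z.map σ) := by
  obtain ⟨u, t, h1, h2, rfl⟩ := h
  exact ⟨u.map σ, t.map σ, by simpa using h1, by simpa using h2, by simp⟩

theorem SS_map_iff (σ : Equiv.Perm A4) (z : List A4) : SS (z.map σ) ↔ SS z := by
  refine ⟨fun h => ?_, SS_map σ z⟩
  have := SS_map σ.symm _ h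
  simpa [List.map_map] using this

theorem SSF_map (σ : Equiv.Perm A4) (z : List A4) (h : SSF z) : SSF (z.map σ) := by
  intro u t w h1 h2 h3
  apply h (u.map σ.symm) (t.map σ.symm) (w.map σ.symm) (by simpa using h1) (by simpa using h2)
  have := congrArg (List.map σ.symm) h3
  simpa [List.map_map] using this

theorem cv_map (σ : Equiv.Perm A4) (s : List A4) (q : List (List A4) × List A4) :
    cv (s.map σ) (q.1.map (List.map σ), q.2.map σ) = cv s q := by
  have : (∃ e' ∈ q.1.map (List.map σ), SS (s.map σ ++ e')) ↔ ∃ e' ∈ q.1, SS (s ++ e') := by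
    constructor
    · rintro ⟨e, he, h⟩
      obtain ⟨e1, he1, rfl⟩ := List.mem_map.1 he
      rw [← List.map_append, SS_map_iff] at h
      exact ⟨e1, he1, h⟩
    · rintro ⟨e, he, h⟩
      refine ⟨e.map σ, List.mem_map.2 ⟨e, he, rfl⟩, ?_⟩
      rwa [← List.map_append, SS_map_iff]
  unfold cv
  by_cases hc : ∃ e' ∈ q.1, SS (s ++ e')
  · rw [if_pos hc, if_pos (this.2 hc)]
  · rw [if_neg hc, if_neg (fun h => hc (this.1 h)), ← List.map_append, F_map]

theorem sum_A4 (f : A4 → ℕ) : (allA.map f).sum = ∑ a, f a := by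
  have : (Finset.univ : Finset A4) = {a0, a1, a2, a3} := rfl
  rw [this]
  simp [allA]

theorem Gs_none (s : List A4) : Gs none s = ∑ c, cv s ([[c]], [c]) := by
  rw [← sum_A4]; rfl

theorem Gs_some (y : A4) (s : List A4) :
    Gs (some y) s = ∑ a, ∑ b, cv s ([[a], [a,b], [a,b,y]], [a,b,y]) := by
  rw [← sum_A4]
  simp only [← sum_A4]
  simp [Gs, exts, allA, add_assoc]

theorem Gs_none_map (σ : Equiv.Perm A4) (s : List A4) : Gs none (s.map σ) = Gs none s := by
  rw [Gs_none, Gs_none, ← Equiv.sum_comp σ]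
  exact Finset.sum_congr rfl fun c _ => cv_map σ s ([[c]], [c])

theorem Gs_some_map (σ : Equiv.Perm A4) (y : A4) (s : List A4) :
    Gs (some (σ y)) (s.map σ) = Gs (some y) s := by
  rw [Gs_some, Gs_some, ← Equiv.sum_comp σ]
  refine Finset.sum_congr rfl fun a _ => ?_
  rw [← Equiv.sum_comp σ]
  exact Finset.sum_congr rfl fun b _ => cv_map σ s ([[a], [a,b], [a,b,y]], [a,b,y])

theorem AllFine_map (σ : Equiv.Perm A4) (s : List A4) (h : AllFine (s.map σ)) : AllFine s := by
  obtain ⟨h1, h2⟩ := h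
  refine ⟨?_, fun y => ?_⟩
  · unfold Fine at h1 ⊢; rwa [Gs_none_map, F_map] at h1
  · have := h2 (σ y)
    unfold Fine at this ⊢; rwa [Gs_some_map, F_map] at this

theorem exists_perm (p q r : A4) (h1 : p ≠ q) (h2 : q ≠ r) (h3 : p ≠ r) :
    ∃ σ : Equiv.Perm A4, σ p = a2 ∧ σ q = a1 ∧ σ r = a0 := by
  refine ⟨(Equiv.swap p a2).trans ((Equiv.swap (Equiv.swap p a2 q) a1).trans
    (Equiv.swap (Equiv.swap (Equiv.swap p a2 q) a1 (Equiv.swap p a2 r)) a0)), ?_⟩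
  revert p q r
  decide

theorem allFine (s : List A4) (hs : SSF s) (hl : 19 ≤ s.length) : AllFine s := by
  obtain ⟨u, o, p, q, r, rfl⟩ : ∃ u o p q r, s = u ++ [o, p, q, r] := by
    have h4 : (s.drop (s.length - 4)).length = 4 := by simp; omega
    obtain ⟨o, p, q, r, h⟩ := List.length_eq_four.1 h4
    exact ⟨s.take (s.length - 4), o, p, q, r, by rw [← h]; simp⟩
  simp at hl
  have hqr : q ≠ r := by
    rintro rfl; exact hs (u ++ [o, p]) [q] [] (by simp) (by simp) (by simp)
  have hpq : p ≠ q := by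
    rintro rfl; exact hs (u ++ [o]) [p] [r] (by simp) (by simp) (by simp)
  have hop : o ≠ p := by
    rintro rfl; exact hs u [o] [q, r] (by simp) (by simp) (by simp)
  by_cases hpr : p = r
  · subst hpr
    have hoq : o ≠ q := by
      rintro rfl; exact hs u [o, p] [] (by simp) (by simp) (by simp)
    obtain ⟨σ, s1, s2, s3⟩ := exists_perm o q p hoq hqr hop
    apply AllFine_map σ
    have := SSF_map σ _ hs
    have e : (u ++ [o, p, q, p]).map σ = u.map σ ++ [a2, a0, a1, a0] := by simp [s1, s2, s3]
    rw [e] at this ⊢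
    exact start_spec 15 _ _ c2 (by simp; omega) this
  · obtain ⟨σ, s1, s2, s3⟩ := exists_perm p q r hpq hqr hpr
    apply AllFine_map σ
    have := SSF_map σ _ hs
    have e : (u ++ [o, p, q, r]).map σ = (u.map σ ++ [σ o]) ++ [a2, a1, a0] := by simp [s1, s2, s3]
    rw [e] at this ⊢
    exact start_spec 16 _ _ c1 (by simp; omega) this

theorem SSF_snoc (s : List A4) (a : A4) (h : SSF s) (h2 : ¬ SS (s ++ [a])) : SSF (s ++ [a]) := by
  intro u t w h3 h4 h5
  rcases List.eq_nil_or_concat w with rfl | ⟨w', c, rfl⟩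
  · exact h2 ⟨u, t, h3, h4, by simpa using h5⟩
  · have h6 : s ++ [a] = (u ++ (t ++ (t ++ w'))) ++ [c] := by rw [h5]; simp
    exact h u t w' h3 h4 (List.append_inj_left' h6 rfl)

def elen : Option A4 → ℕ
  | none => 1
  | some _ => 3

def enum' : Option A4 → ℕ
  | none => 46
  | some _ => 92

theorem exts_len (τ : Option A4) : ∀ q ∈ exts τ, q.2.length = elen τ := by
  cases τ with
  | none => decide
  | some y => cases y <;> decide

theorem exts_inj (τ : Option A4) : ∀ q ∈ exts τ, ∀ q' ∈ exts τ, q.2 = q'.2 → q = q' := by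
  cases τ with
  | none => decide
  | some y => cases y <;> decide +kernel

theorem exts_nodup (τ : Option A4) : (exts τ).Nodup := by
  cases τ with
  | none => decide
  | some y => cases y <;> decide +kernel

theorem exts_head (τ : Option A4) : ∀ q ∈ exts τ, ∃ a r, q.2 = a :: r ∧ [a] ∈ q.1 := by
  cases τ with
  | none =>
    intro q hq
    obtain ⟨c, _, rfl⟩ := List.mem_map.1 hq
    exact ⟨c, [], rfl, by simp⟩
  | some y =>
    intro q hq
    obtain ⟨a, _, hq⟩ := List.mem_flatMap.1 hq
    obtain ⟨b, _, rfl⟩ := List.mem_map.1 hq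
    exact ⟨a, [b, y], rfl, by simp⟩

theorem exts_last (y : A4) : ∀ q ∈ exts (some y), ∃ a b, q.2 = [a, b, y] := by
  intro q hq
  obtain ⟨a, _, hq⟩ := List.mem_flatMap.1 hq
  obtain ⟨b, _, rfl⟩ := List.mem_map.1 hq
  exact ⟨a, b, rfl⟩

theorem exts_SSF (τ : Option A4) (s : List A4) (hs : SSF s) : ∀ q ∈ exts τ,
    (¬ ∃ e' ∈ q.1, SS (s ++ e')) → SSF (s ++ q.2) := by
  cases τ with
  | none =>
    intro q hq
    obtain ⟨c, _, rfl⟩ := List.mem_map.1 hq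
    intro h
    exact SSF_snoc _ _ hs (fun h2 => h ⟨[c], by simp, h2⟩)
  | some y =>
    intro q hq
    obtain ⟨a, _, hq⟩ := List.mem_flatMap.1 hq
    obtain ⟨b, _, rfl⟩ := List.mem_map.1 hq
    intro h
    have h1 := SSF_snoc _ a hs (fun h2 => h ⟨[a], by simp, h2⟩)
    have h2 := SSF_snoc _ b h1 (fun h2 => h ⟨[a, b], by simp, by simpa using h2⟩)
    have h3 := SSF_snoc _ y h2 (fun h2 => h ⟨[a, b, y], by simp, by simpa using h2⟩)
    simpa using h3

section count
variable (w0 : List A4)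

open Classical in
noncomputable def cand (W : Finset (List A4)) (τ : Option A4) : Finset (List A4) :=
  ((W ×ˢ (exts τ).toFinset).filter (fun x => (¬ ∃ e' ∈ x.2.1, SS (w0 ++ x.1 ++ e')) ∧
    0 < F (w0 ++ x.1 ++ x.2.2))).image (fun x => x.1 ++ x.2.2)

theorem mem_cand (W : Finset (List A4)) (τ : Option A4) (z : List A4) (h : z ∈ cand w0 W τ) :
    ∃ w ∈ W, ∃ q ∈ exts τ, z = w ++ q.2 ∧ (¬ ∃ e' ∈ q.1, SS (w0 ++ w ++ e')) ∧
      0 < F (w0 ++ w ++ q.2) := by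
  unfold cand at h
  simp only [Finset.mem_image, Finset.mem_filter, Finset.mem_product, List.mem_toFinset] at h
  obtain ⟨⟨w, q⟩, ⟨⟨h1, h2⟩, h3, h4⟩, rfl⟩ := h
  exact ⟨w, h1, q, h2, rfl, h3, h4⟩

noncomputable def Sm (W : Finset (List A4)) : ℕ := ∑ w ∈ W, F (w0 ++ w)

theorem cand_sum (W : Finset (List A4)) (τ : Option A4) (n : ℕ) (hl : ∀ w ∈ W, w.length = n) :
    Sm w0 (cand w0 W τ) = ∑ w ∈ W, Gs τ (w0 ++ w) := by
  classical
  unfold Sm cand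
  rw [Finset.sum_image]
  · rw [Finset.sum_filter, Finset.sum_product]
    refine Finset.sum_congr rfl fun w hw => ?_
    unfold Gs
    rw [List.sum_toFinset _ (exts_nodup τ)]
    congr 1
    refine List.map_congr_left fun q hq => ?_
    unfold cv
    by_cases hc : ∃ e' ∈ q.1, SS (w0 ++ w ++ e')
    · rw [if_pos hc, if_neg (fun h => h.1 hc)]
    · rw [if_neg hc]
      by_cases hF : 0 < F (w0 ++ w ++ q.2)
      · rw [if_pos ⟨hc, hF⟩, List.append_assoc]
      · rw [if_neg (fun h => hF h.2)]
        omega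
  · rintro ⟨w, q⟩ h ⟨w', q'⟩ h' he
    simp only [Finset.coe_filter, Finset.mem_product, List.mem_toFinset, Set.mem_ofPred_eq] at h h'
    simp only at he
    have l1 := hl w h.1.1
    have l2 := hl w' h'.1.1
    obtain ⟨e1, e2⟩ := List.append_inj he (by omega)
    rw [e1, exts_inj τ q h.1.2 q' h'.1.2 e2]

theorem cand_grow (W : Finset (List A4)) (τ : Option A4) (n : ℕ) (hl : ∀ w ∈ W, w.length = n)
    (h0 : 19 ≤ w0.length) (hs : ∀ w ∈ W, SSF (w0 ++ w)) :
    enum' τ * Sm w0 W ≤ 25 * Sm w0 (cand w0 W τ) := by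
  rw [cand_sum w0 W τ n hl]
  unfold Sm
  rw [Finset.mul_sum, Finset.mul_sum]
  refine Finset.sum_le_sum fun w hw => ?_
  have := allFine (w0 ++ w) (hs w hw) (by simp; omega)
  cases τ with
  | none => exact this.1
  | some y => exact this.2 y

/-- gap at the end of the word where no condition is imposed -/
def eg : Option A4 → ℕ
  | none => 1
  | some _ => 2

def BadP (τ : Option A4) (z : List A4) (p : ℕ) : Prop :=
  11 ≤ p ∧ 2 * p ≤ z.length + 1 ∧
    ∀ i, z.length + 1 ≤ i + p → i + eg τ ≤ z.length → z[i]? = z[i-p]?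

def Bad (τ : Option A4) (z : List A4) : Prop := ∃ p, BadP τ z p

open Classical in
noncomputable def nxt (W : Finset (List A4)) (τ : Option A4) : Finset (List A4) :=
  (cand w0 W τ).filter (fun z => ¬ Bad τ z)

noncomputable def Nn (W : Finset (List A4)) (q : ℕ) : ℕ := (W.image (List.take q)).card
noncomputable def Yn (W : Finset (List A4)) (m : ℕ) : ℕ := ∑ q ∈ Finset.range (m+1), Nn W q

theorem badP_card (W : Finset (List A4)) (τ : Option A4) (n p : ℕ) (hl : ∀ w ∈ W, w.length = n)
    (B : Finset (List A4)) (hB : ∀ z ∈ B, z ∈ cand w0 W τ ∧ BadP τ z p) :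
    B.card ≤ Nn W (n + elen τ + 1 - p) := by
  classical
  have hlen : ∀ z ∈ B, z.length = n + elen τ := by
    intro z hz
    obtain ⟨w, hw, q, hq, rfl, _⟩ := mem_cand _ _ _ _ (hB z hz).1
    rw [List.length_append, hl w hw, exts_len τ q hq]
  unfold Nn
  apply Finset.card_le_card_of_injOn (List.take (n + elen τ + 1 - p))
  · intro z hz
    have hz : z ∈ B := hz
    obtain ⟨w, hw, q, hq, rfl, _⟩ := mem_cand _ _ _ _ (hB z hz).1
    have h2 := (hB _ hz).2.1
    simp only [Finset.coe_image, Set.mem_image, Finset.mem_coe]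
    refine ⟨w, hw, ?_⟩
    rw [List.take_append_of_le_length]
    rw [hl w hw]
    have : elen τ ≤ 3 := by cases τ <;> simp [elen]
    omega
  · intro z hz z' hz' he
    have hz : z ∈ B := hz
    have hz' : z' ∈ B := hz'
    have l1 := hlen z hz
    have l2 := hlen z' hz'
    obtain ⟨c1, ⟨p1, p2, p3⟩⟩ := hB z hz
    obtain ⟨c2, ⟨_, _, p3'⟩⟩ := hB z' hz'
    have main : ∀ i, i + eg τ ≤ n + elen τ → z[i]? = z'[i]? := by
      intro i
      induction i using Nat.strong_induction_on with
      | _ i ih =>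
        intro hi
        by_cases hc : n + elen τ + 1 ≤ i + p
        · rw [p3 i (by omega) (by omega), p3' i (by omega) (by omega)]
          exact ih (i - p) (by omega) (by omega)
        · have : (z.take (n + elen τ + 1 - p))[i]? = (z'.take (n + elen τ + 1 - p))[i]? := by
            rw [he]
          rwa [List.getElem?_take_of_lt (by omega), List.getElem?_take_of_lt (by omega)] at this
    cases τ with
    | none =>
      apply List.ext_getElem?
      intro i
      by_cases hi : i + 1 ≤ n + 1
      · exact main i hi
      · rw [List.getElem?_eq_none (by simp [l1, elen]; omega),
          List.getElem?_eq_none (by simp [l2, elen]; omega)]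
    | some y =>
      obtain ⟨w, hw, q, hq, rfl, _⟩ := mem_cand _ _ _ _ c1
      obtain ⟨w', hw', q', hq', rfl, _⟩ := mem_cand _ _ _ _ c2
      obtain ⟨a, b, e⟩ := exts_last y q hq
      obtain ⟨a', b', e'⟩ := exts_last y q' hq'
      have lw := hl w hw
      have lw' := hl w' hw'
      have h3 : (w ++ [a, b]) = (w' ++ [a', b']) := by
        apply List.ext_getElem?
        intro i
        by_cases hi : i + 2 ≤ n + 3
        · have := main i hi
          rw [e, e', show w ++ [a, b, y] = (w ++ [a, b]) ++ [y] by simp,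
            show w' ++ [a', b', y] = (w' ++ [a', b']) ++ [y] by simp] at this
          by_cases hi2 : i < n + 2
          · rwa [List.getElem?_append_left (l₁ := w ++ [a, b]) (by simp; omega),
              List.getElem?_append_left (l₁ := w' ++ [a', b']) (by simp; omega)] at this
          · omega
        · rw [List.getElem?_eq_none (by simp; omega), List.getElem?_eq_none (by simp; omega)]
      rw [e, e', show w ++ [a, b, y] = (w ++ [a, b]) ++ [y] by simp, h3]
      simp

theorem bad_card (W : Finset (List A4)) (τ : Option A4) (n : ℕ) (hl : ∀ w ∈ W, w.length = n)
    (B : Finset (List A4)) (hB : ∀ z ∈ B, z ∈ cand w0 W τ ∧ Bad τ z) :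
    B.card = 0 ∨ (18 ≤ n ∧ B.card ≤ Yn W (n + elen τ - 10)) := by
  classical
  have hlen : ∀ z ∈ B, z.length = n + elen τ := by
    intro z hz
    obtain ⟨w, hw, q, hq, rfl, _⟩ := mem_cand _ _ _ _ (hB z hz).1
    rw [List.length_append, hl w hw, exts_len τ q hq]
  by_cases h0 : B.card = 0
  · exact Or.inl h0
  right
  have h3 : elen τ ≤ 3 := by cases τ <;> simp [elen]
  have hne : B.Nonempty := Finset.card_pos.1 (Nat.pos_of_ne_zero h0)
  obtain ⟨z0, hz0⟩ := hne
  obtain ⟨p0, q1, q2, _⟩ := (hB z0 hz0).2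
  have := hlen z0 hz0
  refine ⟨by omega, ?_⟩
  set m := n + elen τ with hm
  have hsub : B ⊆ (Finset.range (m - 10 + 1)).biUnion
      (fun r => B.filter (fun z => BadP τ z (m + 1 - r))) := by
    intro z hz
    obtain ⟨p, hp⟩ := (hB z hz).2
    have := hlen z hz
    have h1 := hp.1
    have h2 := hp.2.1
    simp only [Finset.mem_biUnion, Finset.mem_range, Finset.mem_filter]
    exact ⟨m + 1 - p, by omega, hz, by rwa [show m + 1 - (m + 1 - p) = p by omega]⟩
  calc B.card ≤ _ := Finset.card_le_card hsub
    _ ≤ ∑ r ∈ Finset.range (m - 10 + 1), (B.filter (fun z => BadP τ z (m + 1 - r))).card :=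
      Finset.card_biUnion_le
    _ ≤ Yn W (m - 10) := by
      unfold Yn
      refine Finset.sum_le_sum fun r hr => ?_
      have hr := Finset.mem_range.1 hr
      have := badP_card w0 W τ n (m + 1 - r) hl (B.filter (fun z => BadP τ z (m + 1 - r)))
        (fun z hz => ⟨(hB z (Finset.mem_filter.1 hz).1).1, (Finset.mem_filter.1 hz).2⟩)
      rwa [← hm, show m + 1 - (m + 1 - r) = r by omega] at this

theorem nxt_loss (W : Finset (List A4)) (τ : Option A4) (n : ℕ) (hl : ∀ w ∈ W, w.length = n) :
    Sm w0 (cand w0 W τ) ≤ Sm w0 (nxt w0 W τ) ∨ (18 ≤ n ∧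
    Sm w0 (cand w0 W τ) ≤ Sm w0 (nxt w0 W τ) + 20 * Yn W (n + elen τ - 10)) := by
  classical
  set B := (cand w0 W τ).filter (fun z => Bad τ z) with hB
  have h1 : Sm w0 (cand w0 W τ) = ∑ z ∈ B, F (w0 ++ z) + Sm w0 (nxt w0 W τ) := by
    unfold Sm nxt
    exact (Finset.sum_filter_add_sum_filter_not _ _ _).symm
  have h2 : ∑ z ∈ B, F (w0 ++ z) ≤ B.card * 20 := by
    rw [← smul_eq_mul]
    exact Finset.sum_le_card_nsmul _ _ _ fun z _ => (F_okv _).1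
  rcases bad_card w0 W τ n hl B (fun z hz => Finset.mem_filter.1 hz) with h | ⟨h, h'⟩
  · left; rw [h] at h2; omega
  · right; exact ⟨h, by omega⟩

theorem nxt_sub (W : Finset (List A4)) (τ : Option A4) : nxt w0 W τ ⊆ cand w0 W τ := by
  classical
  unfold nxt
  exact Finset.filter_subset _ _

theorem Nn_nxt_le (W : Finset (List A4)) (τ : Option A4) (n q : ℕ) (hl : ∀ w ∈ W, w.length = n)
    (hq : q ≤ n) : Nn (nxt w0 W τ) q ≤ Nn W q := by
  classical
  apply Finset.card_le_card
  intro x hx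
  obtain ⟨z, hz, rfl⟩ := Finset.mem_image.1 hx
  obtain ⟨w, hw, r, hr, rfl, _⟩ := mem_cand _ _ _ _ (nxt_sub _ _ _ hz)
  rw [List.take_append_of_le_length (by rw [hl w hw]; exact hq)]
  exact Finset.mem_image_of_mem _ hw

theorem Nn_nxt_succ (W : Finset (List A4)) (τ : Option A4) (n : ℕ) (hl : ∀ w ∈ W, w.length = n)
    (h0 : w0 ≠ []) : Nn (nxt w0 W τ) (n+1) ≤ 3 * W.card := by
  classical
  have : (nxt w0 W τ).image (List.take (n+1)) ⊆ W.biUnion (fun w =>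
      ((Finset.univ.erase ((w0 ++ w).getLast (by simp [h0]))).image (fun a => w ++ [a]))) := by
    intro x hx
    obtain ⟨z, hz, rfl⟩ := Finset.mem_image.1 hx
    obtain ⟨w, hw, r, hr, rfl, h1, _⟩ := mem_cand _ _ _ _ (nxt_sub _ _ _ hz)
    obtain ⟨a, r', e, ha⟩ := exts_head τ r hr
    simp only [Finset.mem_biUnion, Finset.mem_image, Finset.mem_erase, Finset.mem_univ, and_true]
    refine ⟨w, hw, a, ?_, ?_⟩
    · intro hc
      apply h1
      refine ⟨[a], ha, (w0 ++ w).dropLast, [a], by simp, by simp, ?_⟩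
      have h2 := List.dropLast_append_getLast (l := w0 ++ w) (by simp [h0])
      rw [← hc] at h2
      rw [← List.append_assoc, h2]
    · rw [e, List.take_append, hl w hw, List.take_of_length_le (by rw [hl w hw]; omega)]
      simp
  calc Nn (nxt w0 W τ) (n+1) ≤ _ := Finset.card_le_card this
    _ ≤ W.card * 3 := Finset.card_biUnion_le_card_mul _ _ _ (fun w _ => by
        refine Finset.card_image_le.trans ?_
        rw [Finset.card_erase_of_mem (Finset.mem_univ _)]
        decide)
    _ = _ := by ring

theorem Nn_le_card (W : Finset (List A4)) (q : ℕ) : Nn W q ≤ W.card := Finset.card_image_le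

theorem card_le_Sm (W : Finset (List A4)) (h : ∀ w ∈ W, 0 < F (w0 ++ w)) : 12 * W.card ≤ Sm w0 W := by
  unfold Sm
  rw [mul_comm, ← smul_eq_mul]
  apply Finset.card_nsmul_le_sum
  intro w hw
  have := h w hw
  have := (F_okv (w0 ++ w)).2
  omega

theorem Yn_succ (W : Finset (List A4)) (m : ℕ) : Yn W (m+1) = Yn W m + Nn W (m+1) :=
  Finset.sum_range_succ _ _

theorem Yn_nxt_le (W : Finset (List A4)) (τ : Option A4) (n m : ℕ) (hl : ∀ w ∈ W, w.length = n)
    (hq : m ≤ n) : Yn (nxt w0 W τ) m ≤ Yn W m :=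
  Finset.sum_le_sum fun q hq' => Nn_nxt_le w0 W τ n q hl (by have := Finset.mem_range.1 hq'; omega)

structure WInv (W : Finset (List A4)) (n : ℕ) : Prop where
  len : ∀ w ∈ W, w.length = n
  ssf : ∀ w ∈ W, SSF (w0 ++ w)
  pos : ∀ w ∈ W, 0 < F (w0 ++ w)
  sm : 0 < Sm w0 W
  y1 : ∀ m d : ℕ, m + d = n → 12 * (Yn W m : ℝ) * (71/50)^d ≤ 271/50 * Sm w0 W
  y2 : 12 * (Yn W n : ℝ) ≤ 469/100 * Sm w0 W

theorem WInv_step (W : Finset (List A4)) (n : ℕ) (τ : Option A4) (h0 : 19 ≤ w0.length)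
    (h : WInv w0 W n) : WInv w0 (nxt w0 W τ) (n + elen τ) := by
  obtain ⟨len, ssf, pos, sm, y1, y2⟩ := h
  have len' : ∀ w ∈ nxt w0 W τ, w.length = n + elen τ := by
    intro z hz
    obtain ⟨w, hw, q, hq, rfl, _⟩ := mem_cand _ _ _ _ (nxt_sub _ _ _ hz)
    rw [List.length_append, len w hw, exts_len τ q hq]
  have ssf' : ∀ w ∈ nxt w0 W τ, SSF (w0 ++ w) := by
    intro z hz
    obtain ⟨w, hw, q, hq, rfl, h1, h2⟩ := mem_cand _ _ _ _ (nxt_sub _ _ _ hz)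
    rw [← List.append_assoc]
    exact exts_SSF τ _ (ssf w hw) q hq h1
  have pos' : ∀ w ∈ nxt w0 W τ, 0 < F (w0 ++ w) := by
    intro z hz
    obtain ⟨w, hw, q, hq, rfl, h1, h2⟩ := mem_cand _ _ _ _ (nxt_sub _ _ _ hz)
    rwa [← List.append_assoc]
  have g1 := cand_grow w0 W τ n len h0 ssf
  have g2 := nxt_loss w0 W τ n len
  have c1 := card_le_Sm w0 W pos
  have c2 := card_le_Sm w0 _ pos'
  have n1 := Nn_nxt_succ w0 W τ n len (by rintro rfl; simp at h0)
  have n2 := Nn_le_card (nxt w0 W τ)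
  have y0 : ∀ m, m ≤ n → Yn (nxt w0 W τ) m ≤ Yn W m := fun m hm => Yn_nxt_le w0 W τ n m len hm
  have ys := Yn_succ (nxt w0 W τ)
  have smR : (0:ℝ) < Sm w0 W := by exact_mod_cast sm
  have c1R : 12 * (W.card : ℝ) ≤ Sm w0 W := by exact_mod_cast c1
  have c2R : 12 * ((nxt w0 W τ).card : ℝ) ≤ Sm w0 (nxt w0 W τ) := by exact_mod_cast c2
  have n1R : (Nn (nxt w0 W τ) (n+1) : ℝ) ≤ 3 * W.card := by exact_mod_cast n1
  have n2R : ∀ q, (Nn (nxt w0 W τ) q : ℝ) ≤ (nxt w0 W τ).card := fun q => by exact_mod_cast n2 q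
  have ysR : ∀ m, (Yn (nxt w0 W τ) (m+1) : ℝ) = Yn (nxt w0 W τ) m + Nn (nxt w0 W τ) (m+1) :=
    fun m => by exact_mod_cast ys m
  have y0R : ∀ m, m ≤ n → (Yn (nxt w0 W τ) m : ℝ) ≤ Yn W m := fun m hm => by exact_mod_cast y0 m hm
  have g1R : (enum' τ : ℝ) * Sm w0 W ≤ 25 * Sm w0 (cand w0 W τ) := by exact_mod_cast g1
  have g2R : (Sm w0 (cand w0 W τ) : ℝ) ≤ Sm w0 (nxt w0 W τ) ∨ (18 ≤ n ∧
    (Sm w0 (cand w0 W τ) : ℝ) ≤ Sm w0 (nxt w0 W τ) + 20 * Yn W (n + elen τ - 10)) := by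
    exact_mod_cast g2
  have grow : (71/50 : ℝ)^(elen τ) * Sm w0 W ≤ Sm w0 (nxt w0 W τ) := by
    cases τ with
    | none =>
      simp only [elen, enum'] at *
      rcases g2R with g | ⟨hn, g⟩
      · norm_num at g1R ⊢; linarith
      · have := y1 (n + 1 - 10) 9 (by omega)
        norm_num at this g1R ⊢
        linarith
    | some y =>
      simp only [elen, enum'] at *
      rcases g2R with g | ⟨hn, g⟩
      · norm_num at g1R ⊢; linarith
      · have := y1 (n + 3 - 10) 7 (by omega)
        norm_num at this g1R ⊢
        linarith
  have old : ∀ m d, m ≤ n → m + d = n + elen τ →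
      12 * (Yn (nxt w0 W τ) m : ℝ) * (71/50)^d ≤ 271/50 * Sm w0 (nxt w0 W τ) := by
    intro m d hm hd
    obtain ⟨d', rfl⟩ : ∃ d', d = d' + elen τ := ⟨n - m, by omega⟩
    have h1 := y1 m d' (by omega)
    have h2 := y0R m hm
    have p1 : (0:ℝ) < (71/50)^d' := by positivity
    have p2 : (0:ℝ) < (71/50)^(elen τ) := by positivity
    rw [pow_add]
    calc 12 * (Yn (nxt w0 W τ) m : ℝ) * ((71/50)^d' * (71/50)^(elen τ))
        = (12 * (Yn (nxt w0 W τ) m : ℝ) * (71/50)^d') * (71/50)^(elen τ) := by ring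
      _ ≤ (12 * (Yn W m : ℝ) * (71/50)^d') * (71/50)^(elen τ) := by gcongr
      _ ≤ (271/50 * Sm w0 W) * (71/50)^(elen τ) := by gcongr
      _ = 271/50 * ((71/50)^(elen τ) * Sm w0 W) := by ring
      _ ≤ _ := by gcongr
  have z0 := y0R n le_rfl
  have s1 := ysR n
  have s2 := ysR (n+1)
  have s3 := ysR (n+2)
  have t2 := n2R (n+2)
  have t3 := n2R (n+3)
  have t1 := n2R (n+1)
  refine ⟨len', ssf', pos', ?_, ?_, ?_⟩
  · have : (0:ℝ) < Sm w0 (nxt w0 W τ) := lt_of_lt_of_le (by positivity) grow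
    exact_mod_cast this
  · intro m d hd
    by_cases hm : m ≤ n
    · exact old m d hm hd
    · cases τ with
      | none =>
        simp only [elen] at *
        obtain ⟨rfl, rfl⟩ : m = n + 1 ∧ d = 0 := by omega
        norm_num at grow ⊢; linarith
      | some y =>
        simp only [elen] at *
        norm_num at grow
        obtain ⟨rfl, rfl⟩ | ⟨rfl, rfl⟩ | ⟨rfl, rfl⟩ :
          (m = n + 1 ∧ d = 2) ∨ (m = n + 2 ∧ d = 1) ∨ (m = n + 3 ∧ d = 0) := by omega
        all_goals norm_num; linarith
  · cases τ with
    | none =>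
      simp only [elen] at *
      norm_num at grow ⊢; linarith
    | some y =>
      simp only [elen] at *
      norm_num at grow ⊢; linarith

noncomputable def Wk (τ : ℕ → Option A4) : ℕ → Finset (List A4)
  | 0 => {[]}
  | k+1 => nxt w0 (Wk τ k) (τ k)

def bk (τ : ℕ → Option A4) : ℕ → ℕ
  | 0 => 0
  | k+1 => bk τ k + elen (τ k)

theorem WInv_all (τ : ℕ → Option A4) (h0 : 19 ≤ w0.length) (h1 : SSF w0) (h2 : 0 < F w0) (k : ℕ) :
    WInv w0 (Wk w0 τ k) (bk τ k) := by
  induction k with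
  | zero =>
    have hS : Sm w0 {[]} = F w0 := by simp [Sm]
    have h12 : 12 ≤ F w0 := by have := (F_okv w0).2; omega
    have h12R : (12:ℝ) ≤ F w0 := by exact_mod_cast h12
    have hY : Yn {[]} 0 = 1 := by simp [Yn, Nn]
    refine ⟨by simp [Wk, bk], by simpa [Wk] using h1, by simpa [Wk] using h2, ?_, ?_, ?_⟩
    · show 0 < Sm w0 {[]}
      rw [hS]; exact h2
    · intro m d hmd
      obtain ⟨rfl, rfl⟩ : m = 0 ∧ d = 0 := by simpa [bk] using hmd
      show 12 * (Yn {[]} 0 : ℝ) * _ ≤ 271/50 * Sm w0 {[]}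
      rw [hS, hY]; norm_num; linarith
    · show 12 * (Yn {[]} 0 : ℝ) ≤ 469/100 * Sm w0 {[]}
      rw [hS, hY]; norm_num; linarith
  | succ k ih => exact WInv_step w0 _ _ _ h0 ih

end count

theorem SSF_of_check (s : List A4) (h : ∀ i < s.length + 1, ∀ p < 11, 1 ≤ p → i + 2 * p ≤ s.length →
    (s.drop i).take p ≠ (s.drop (i + p)).take p) : SSF s := by
  intro u t w h1 h2 h3
  have hp : 1 ≤ t.length := List.length_pos_iff.2 h1
  have hlen : s.length = u.length + (t.length + (t.length + w.length)) := by rw [h3]; simp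
  refine h u.length (by omega) t.length (by omega) hp (by omega) ?_
  rw [h3, ← List.drop_drop, List.drop_left, List.take_left, List.drop_left, List.take_left]

def w00 : List A4 := [a0,a1,a2,a3,a0,a2,a1,a0,a3,a2,a0,a1,a3,a0,a2,a3,a1,a0,a2,a1]

theorem w00_F' : Nat.ble 1 (F w00) = true := by decide +kernel

theorem w00_F : 0 < F w00 := Nat.le_of_ble_eq_true w00_F'

theorem w00_SSF : SSF w00 := SSF_of_check _ (by decide +kernel)

section final
variable (w0 : List A4) (τ : ℕ → Option A4)

theorem bk_mono (k d : ℕ) : bk τ k ≤ bk τ (k + d) := by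
  induction d with
  | zero => exact le_rfl
  | succ d ih => exact ih.trans (Nat.le_add_right _ _)

theorem le_bk (k : ℕ) : k ≤ bk τ k := by
  induction k with
  | zero => exact Nat.zero_le _
  | succ k ih =>
    have : 1 ≤ elen (τ k) := by cases τ k <;> simp [elen]
    show k + 1 ≤ bk τ k + elen (τ k)
    omega

theorem take_mem (hl : ∀ k, ∀ w ∈ Wk w0 τ k, w.length = bk τ k) (k d : ℕ) :
    ∀ z ∈ Wk w0 τ (k + d), z.take (bk τ k) ∈ Wk w0 τ k := by
  induction d with
  | zero =>
    intro z hz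
    rw [← hl k z hz, List.take_length]; exact hz
  | succ d ih =>
    intro z hz
    obtain ⟨w, hw, q, hq, rfl, _⟩ := mem_cand _ _ _ _ (nxt_sub _ _ _ hz)
    rw [List.take_append_of_le_length (by rw [hl _ w hw]; exact bk_mono τ k d)]
    exact ih w hw

theorem konig (hl : ∀ k, ∀ w ∈ Wk w0 τ k, w.length = bk τ k) (hne : ∀ k, (Wk w0 τ k).Nonempty) :
    ∃ u : ℕ → A4, ∀ k, (List.range (bk τ k)).map u ∈ Wk w0 τ k := by
  choose z hz using hne
  have h1 : ∀ i : ℕ, ∃ a : A4, ∀ᶠ k in (Filter.hyperfilter ℕ : Filter ℕ), (z k).getD i a0 = a := by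
    intro i
    obtain ⟨a, ha⟩ := Ultrafilter.eq_pure_of_finite ((Filter.hyperfilter ℕ).map (fun k => (z k).getD i a0))
    refine ⟨a, ?_⟩
    have : ({a} : Set A4) ∈ (Filter.hyperfilter ℕ).map (fun k => (z k).getD i a0) := by
      rw [ha]; exact Set.mem_singleton a
    exact this
  choose u hu using h1
  refine ⟨u, fun k => ?_⟩
  have h2 : ∀ᶠ k' in (Filter.hyperfilter ℕ : Filter ℕ), ∀ i ∈ Finset.range (bk τ k),
      (z k').getD i a0 = u i :=
    (Filter.eventually_all_finset _).2 fun i _ => hu i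
  have h3 : ∀ᶠ k' in (Filter.hyperfilter ℕ : Filter ℕ), k ≤ k' :=
    Nat.hyperfilter_le_atTop (Filter.eventually_ge_atTop k)
  obtain ⟨k', h4, h5⟩ := (h2.and h3).exists
  obtain ⟨d, rfl⟩ := Nat.exists_eq_add_of_le h5
  have h6 := take_mem w0 τ hl k d _ (hz (k + d))
  have hb := bk_mono τ k d
  have hlz := hl _ _ (hz (k + d))
  convert h6 using 1
  apply List.ext_getElem
  · simp; omega
  · intro i hi1 hi2
    have hi : i < bk τ k := by simpa using hi1
    have := h4 i (Finset.mem_range.2 hi)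
    rw [List.getD_eq_getElem _ _ (by omega)] at this
    simp [this]

theorem word_exists (h0 : 19 ≤ w0.length) (h1 : SSF w0) (h2 : 0 < F w0) :
    ∃ u : ℕ → A4, (∀ i n, 1 ≤ n → ∃ k, k < n ∧ u (i + k) ≠ u (i + n + k)) ∧
      ∀ k y, τ k = some y → u (bk τ k + 2) = y := by
  have hI := WInv_all w0 τ h0 h1 h2
  have hl : ∀ k, ∀ w ∈ Wk w0 τ k, w.length = bk τ k := fun k => (hI k).len
  obtain ⟨u, hu⟩ := konig w0 τ hl (fun k => by
    by_contra hc
    rw [Finset.not_nonempty_iff_eq_empty] at hc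
    have := (hI k).sm
    rw [hc] at this
    simp [Sm] at this)
  refine ⟨u, ?_, ?_⟩
  · intro i p hp
    by_contra hc
    push Not at hc
    by_cases hp2 : p ≤ 10
    · have hK := le_bk τ (i + (p + p))
      obtain ⟨r, hr⟩ := Nat.exists_eq_add_of_le hK
      have hs := (hI (i + (p + p))).ssf _ (hu _)
      refine hs (w0 ++ (List.range i).map u) ((List.range p).map (fun k => u (i + k)))
        ((List.range r).map (fun k => u (i + (p + p) + k))) ?_ ?_ ?_
      · intro h
        have := congrArg List.length h
        simp at this
        omega
      · simpa using hp2
      · rw [hr, List.range_add, List.range_add, List.range_add]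
        simp only [List.map_append, List.map_map, List.append_assoc]
        congr 3
        congr 1
        apply List.map_congr_left
        intro k hk
        have := hc k (List.mem_range.1 hk)
        simp only [Function.comp]
        rw [this, add_assoc]
    · have hex : ∃ K, i + 2 * p ≤ bk τ K + 1 := ⟨i + 2 * p, by have := le_bk τ (i + 2 * p); omega⟩
      classical
      have hs := Nat.find_spec hex
      have hm := fun k => Nat.find_min hex (m := k)
      rcases hk : Nat.find hex with _ | k
      · rw [hk] at hs
        simp only [bk] at hs
        omega
      · rw [hk] at hs
        have hm' := hm k (by omega)
        have hz := hu (k + 1)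
        have hbad : ¬ Bad (τ k) ((List.range (bk τ (k+1))).map u) := (Finset.mem_filter.1 hz).2
        apply hbad
        have hb : bk τ (k+1) = bk τ k + elen (τ k) := rfl
        have he : elen (τ k) + 1 = 2 * eg (τ k) := by cases τ k <;> rfl
        have he2 : 1 ≤ eg (τ k) := by cases τ k <;> simp [eg]
        have he3 : eg (τ k) ≤ 2 := by cases τ k <;> simp [eg]
        refine ⟨p, by omega, by simp; omega, ?_⟩
        intro i' h3 h4
        simp only [List.length_map, List.length_range] at h3 h4
        have h5 : i' < bk τ (k+1) := by omega
        have h6 : i' - p < bk τ (k+1) := by omega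
        rw [List.getElem?_map, List.getElem?_map, List.getElem?_range h5, List.getElem?_range h6]
        simp only [Option.map_some]
        have := hc (i' - p - i) (by omega)
        rw [show i + (i' - p - i) = i' - p by omega, show i + p + (i' - p - i) = i' by omega] at this
        rw [this]
  · intro k y hy
    have hz := hu (k + 1)
    obtain ⟨w, hw, q, hq, h3, _⟩ := mem_cand _ _ _ _ (nxt_sub _ _ _ hz)
    rw [hy] at hq
    obtain ⟨a, b, e⟩ := exts_last y q hq
    have hlw := hl k w hw
    have hb : bk τ (k+1) = bk τ k + 3 := by show bk τ k + elen (τ k) = _; rw [hy]; rfl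
    have h4 := congrArg (fun l : List A4 => l[bk τ k + 2]?) h3
    simp only [e] at h4
    rw [List.getElem?_map, List.getElem?_range (by omega), List.getElem?_append_right (by omega),
      hlw, show bk τ k + 2 - bk τ k = 2 by omega] at h4
    simpa using h4

end final

def toA : Fin 4 → A4 := ![a0, a1, a2, a3]
def ofA : A4 → Fin 4
  | a0 => 0
  | a1 => 1
  | a2 => 2
  | a3 => 3
theorem ofA_toA (x : Fin 4) : ofA (toA x) = x := by revert x; decide
theorem ofA_inj (x y : A4) (h : ofA x = ofA y) : x = y := by
  cases x <;> cases y <;> first | rfl | (exact absurd h (by decide))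

def bb (pres : ℕ → Option A4) : ℕ → ℕ
  | 0 => 0
  | k+1 => bb pres k + elen (pres (bb pres k + 2))

theorem bk_bb (pres : ℕ → Option A4) (k : ℕ) : bk (fun k => pres (bb pres k + 2)) k = bb pres k := by
  induction k with
  | zero => rfl
  | succ k ih =>
    show bk (fun k => pres (bb pres k + 2)) k + _ = _
    rw [ih]; rfl

theorem gap_lt (q : ℕ → ℕ) (h : ∀ i : ℕ, 1 ≤ i → q i + 3 ≤ q (i + 1)) (i d : ℕ) (hi : 1 ≤ i) :
    q i + 3 ≤ q (i + (d + 1)) := by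
  induction d with
  | zero => exact h i hi
  | succ d ih => have := h (i + (d + 1)) (by omega); rw [← add_assoc i (d+1) 1]; omega

theorem gap_ne (q : ℕ → ℕ) (h : ∀ i : ℕ, 1 ≤ i → q i + 3 ≤ q (i + 1)) (i j : ℕ) (hi : 1 ≤ i)
    (hj : 1 ≤ j) : i = j ∨ q i + 3 ≤ q j ∨ q j + 3 ≤ q i := by
  rcases lt_trichotomy i j with h1 | h1 | h1
  · obtain ⟨d, rfl⟩ := Nat.exists_eq_add_of_lt h1
    exact Or.inr (Or.inl (gap_lt q h i d hi))
  · exact Or.inl h1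
  · obtain ⟨d, rfl⟩ := Nat.exists_eq_add_of_lt h1
    exact Or.inr (Or.inr (gap_lt q h j d hj))

theorem d_four_letters_le_3 :
    ∀ v : ℕ → Fin 4, ∀ q : ℕ → ℕ, 1 ≤ q 1 →
      (∀ i : ℕ, 1 ≤ i → q i + 3 ≤ q (i + 1)) →
      ∃ u : ℕ → Fin 4, SqFreeSeq u ∧ ∀ i : ℕ, 1 ≤ i → u (q i) = v i := by
  intro v q h1 hq
  classical
  have hge : ∀ i, 1 ≤ i → 1 ≤ q i := by
    intro i hi
    rcases gap_ne q hq 1 i le_rfl hi with rfl | h | h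
    · exact h1
    · omega
    · obtain ⟨d, rfl⟩ := Nat.exists_eq_add_of_le hi
      cases d with
      | zero => exact h1
      | succ d => have := gap_lt q hq 1 d le_rfl; omega
  obtain ⟨pres, hp1, hp2⟩ : ∃ pres : ℕ → Option A4, (∀ i, 1 ≤ i → pres (q i + 1) = some (toA (v i))) ∧
      ∀ P y, pres P = some y → ∃ i, 1 ≤ i ∧ P = q i + 1 := by
    refine ⟨fun P => if h : ∃ i, 1 ≤ i ∧ P = q i + 1 then some (toA (v h.choose)) else none, ?_, ?_⟩
    · intro i hi
      have h : ∃ j, 1 ≤ j ∧ q i + 1 = q j + 1 := ⟨i, hi, rfl⟩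
      simp only [dif_pos h]
      have hs := h.choose_spec
      have : i = h.choose := by
        rcases gap_ne q hq i h.choose hi hs.1 with h | h | h
        · exact h
        · omega
        · omega
      rw [← this]
    · intro P y hy
      by_contra hc
      simp [dif_neg hc] at hy
  have hno : ∀ k, ∀ i, 1 ≤ i → q i + 1 < bb pres k ∨ bb pres k + 2 ≤ q i + 1 := by
    intro k
    induction k with
    | zero =>
      intro i hi
      have := hge i hi
      simp only [bb]; omega
    | succ k ih =>
      intro i hi
      have := ih i hi
      rcases hc : pres (bb pres k + 2) with _ | y
      · have hb : bb pres (k+1) = bb pres k + 1 := by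
          show bb pres k + elen (pres (bb pres k + 2)) = _; rw [hc]; rfl
        have hne : q i + 1 ≠ bb pres k + 2 := by
          intro h
          have := hp1 i hi
          rw [h, hc] at this
          cases this
        omega
      · have hb : bb pres (k+1) = bb pres k + 3 := by
          show bb pres k + elen (pres (bb pres k + 2)) = _; rw [hc]; rfl
        obtain ⟨j, hj, hj2⟩ := hp2 _ _ hc
        rcases gap_ne q hq i j hi hj with rfl | h | h <;> omega
  obtain ⟨u, hu1, hu2⟩ := word_exists w00 (fun k => pres (bb pres k + 2)) (by decide) w00_SSF w00_F
  refine ⟨fun j => ofA (u (j + 1)), ?_, ?_⟩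
  · intro i n hi hn
    obtain ⟨k, hk, hne⟩ := hu1 (i + 1) n hn
    refine ⟨k, hk, fun h => hne ?_⟩
    have := ofA_inj _ _ h
    rw [show i + 1 + k = i + k + 1 by omega, show i + 1 + n + k = i + n + k + 1 by omega]
    exact this
  · intro i hi
    have hex : ∃ K, q i + 1 < bb pres K := ⟨q i + 2, by
      have := le_bk (fun k => pres (bb pres k + 2)) (q i + 2)
      rw [bk_bb] at this; omega⟩
    have hs := Nat.find_spec hex
    have hm := fun k => Nat.find_min hex (m := k)
    rcases hk : Nat.find hex with _ | k
    · rw [hk] at hs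
      simp only [bb] at hs
      omega
    · rw [hk] at hs
      have hm' := hm k (by omega)
      have hn := hno k i hi
      have hb : bb pres (k+1) = bb pres k + elen (pres (bb pres k + 2)) := rfl
      have he : elen (pres (bb pres k + 2)) ≤ 3 := by cases pres (bb pres k + 2) <;> simp [elen]
      have hP : q i + 1 = bb pres k + 2 := by omega
      have := hu2 k (toA (v i)) (by show pres (bb pres k + 2) = _; rw [← hP]; exact hp1 i hi)
      rw [bk_bb, ← hP] at this
      show ofA (u (q i + 1)) = v i
      rw [this, ofA_toA]
end

section
/- The set of finite square-free words u = u_1 … u_{|u|} over the alphabet {0,1,2,3} such that for every integer j ≥ 0 with 2j + 1 ≤ |u| one has u_{2j+1} = j mod 4 (i.e., the finite square-free words over {0,1,2,3} compatible with the infinite partial word (0⋄1⋄2⋄3⋄)^ω) is finite and has exactly 636 elements. -/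
/-- A finite word is square-free: no factor is of the form `v ++ v` with `v` nonempty. -/
def SqFree {α : Type*} (u : List α) : Prop :=
  ∀ v : List α, v ≠ [] → ¬ ((v ++ v) <:+: u)

namespace SqAux

def sq (w : List (Fin 4)) : Bool :=
  (List.range w.length).any fun k => (w.take (k+1)).isPrefixOf (w.drop (k+1))

def ok (w : List (Fin 4)) (c : Fin 4) : Bool :=
  (!(w.length % 2 == 0) || c.val == (w.length / 2) % 4) && !(sq (c :: w))

def cands (w : List (Fin 4)) : List (Fin 4) :=
  [⟨0, by decide⟩, ⟨1, by decide⟩, ⟨2, by decide⟩, ⟨3, by decide⟩].filter (ok w)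

def tree : ℕ → List (Fin 4) → List (List (Fin 4))
  | 0, _ => []
  | f+1, w => w :: (cands w).flatMap (fun c => tree f (c :: w))

def cnt : ℕ → List (Fin 4) → ℕ
  | 0, _ => 0
  | f+1, w => 1 + ((cands w).map (fun c => cnt f (c :: w))).sum

def dead : ℕ → List (Fin 4) → Bool
  | 0, _ => false
  | f+1, w => (cands w).all (fun c => dead f (c :: w))

/-- the predicate on reversed words -/
def Q : List (Fin 4) → Prop
  | [] => True
  | c :: w => ok w c = true ∧ Q w

theorem mem_cands (w : List (Fin 4)) (c : Fin 4) : c ∈ cands w ↔ ok w c = true := by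
  unfold cands
  rw [List.mem_filter]
  constructor
  · exact fun h => h.2
  · intro h
    refine ⟨?_, h⟩
    fin_cases c <;> simp

theorem cands_nodup (w : List (Fin 4)) : (cands w).Nodup :=
  List.Nodup.filter _ (by decide)

theorem length_tree (f : ℕ) : ∀ w, (tree f w).length = cnt f w := by
  induction f with
  | zero => intro w; rfl
  | succ f ih => intro w; simp [tree, cnt, List.length_flatMap, ih, add_comm]

theorem tree_suffix (f : ℕ) : ∀ w x, x ∈ tree f w → w <:+ x := by
  induction f with
  | zero => intro w x h; simp [tree] at h
  | succ f ih =>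
    intro w x h
    simp only [tree, List.mem_cons, List.mem_flatMap] at h
    rcases h with rfl | ⟨c, -, h⟩
    · exact List.suffix_rfl
    · exact (List.suffix_cons c w).trans (ih _ _ h)

theorem tree_nodup (f : ℕ) : ∀ w, (tree f w).Nodup := by
  induction f with
  | zero => intro w; simp [tree]
  | succ f ih =>
    intro w
    simp only [tree, List.nodup_cons, List.mem_flatMap, not_exists, not_and]
    refine ⟨fun c _ h => ?_, ?_⟩
    · have := (tree_suffix _ _ _ h).length_le
      simp at this
    · rw [List.nodup_flatMap]
      refine ⟨fun c _ => ih _, ?_⟩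
      refine (cands_nodup w).imp ?_
      intro a b hab x hx hy
      have h1 := tree_suffix _ _ _ hx
      have h2 := tree_suffix _ _ _ hy
      have h3 := List.suffix_of_suffix_length_le h1 h2 (by simp)
      have h4 := h3.eq_of_length (by simp)
      simp at h4
      exact hab h4

theorem Q_of_suffix {w x : List (Fin 4)} (h : w <:+ x) (hx : Q x) : Q w := by
  obtain ⟨y, rfl⟩ := h
  induction y with
  | nil => exact hx
  | cons a y ih => exact ih hx.2

theorem mem_tree (f : ℕ) : ∀ w x, Q w → dead f w = true → (x ∈ tree f w ↔ w <:+ x ∧ Q x) := by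
  induction f with
  | zero => intro w x _ h; simp [dead] at h
  | succ f ih =>
    intro w x hw hd
    simp only [dead, List.all_eq_true] at hd
    simp only [tree, List.mem_cons, List.mem_flatMap]
    constructor
    · rintro (rfl | ⟨c, hc, h⟩)
      · exact ⟨List.suffix_rfl, hw⟩
      · have := (ih (c :: w) x ⟨(mem_cands _ _).1 hc, hw⟩ (hd c hc)).1 h
        exact ⟨(List.suffix_cons c w).trans this.1, this.2⟩
    · rintro ⟨⟨y, rfl⟩, hx⟩
      rcases List.eq_nil_or_concat y with rfl | ⟨z, c, rfl⟩
      · left; rfl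
      · right
        have hs : (c :: w) <:+ (z.concat c ++ w) := ⟨z, by simp⟩
        have hq := Q_of_suffix hs (by simpa using hx)
        have hc := (mem_cands _ _).2 hq.1
        exact ⟨c, hc, (ih _ _ hq (hd c hc)).2 ⟨hs, by simpa using hx⟩⟩

theorem sq_iff (w : List (Fin 4)) : sq w = true ↔ ∃ v, v ≠ [] ∧ (v ++ v) <+: w := by
  unfold sq
  simp only [List.any_eq_true, List.mem_range, List.isPrefixOf_iff_prefix]
  constructor
  · rintro ⟨k, hk, t, ht⟩
    refine ⟨w.take (k+1), ?_, t, ?_⟩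
    · intro h
      have := congrArg List.length h
      simp at this
      subst this
      simp at hk
    · rw [List.append_assoc, ht, List.take_append_drop]
  · rintro ⟨v, hv, t, rfl⟩
    have hl : 0 < v.length := List.length_pos_iff.2 hv
    refine ⟨v.length - 1, by simp; omega, t, ?_⟩
    have : v.length - 1 + 1 = v.length := by omega
    rw [this]
    simp

theorem sqfree_cons (c : Fin 4) (w : List (Fin 4)) :
    SqFree (c :: w) ↔ SqFree w ∧ sq (c :: w) = false := by
  rw [← Bool.not_eq_true, sq_iff]
  unfold SqFree
  simp only [List.infix_cons_iff]
  push Not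
  constructor
  · intro h
    exact ⟨fun v hv => (h v hv).2, fun v hv => (h v hv).1⟩
  · rintro ⟨h1, h2⟩ v hv
    exact ⟨h2 v hv, h1 v hv⟩

theorem sqfree_reverse (w : List (Fin 4)) (h : SqFree w) : SqFree w.reverse := by
  intro v hv hi
  refine h v.reverse (by simpa using hv) ?_
  rw [← List.reverse_infix]
  simpa using hi

def P (u : List (Fin 4)) : Prop :=
  ∀ j : ℕ, 2 * j + 1 ≤ u.length → u[2 * j]? = some (Fin.ofNat 4 j)

theorem P_concat (u : List (Fin 4)) (c : Fin 4) :
    P (u ++ [c]) ↔ P u ∧ (u.length % 2 = 0 → c.val = (u.length / 2) % 4) := by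
  unfold P
  constructor
  · intro h
    refine ⟨fun j hj => ?_, fun he => ?_⟩
    · have := h j (by simp; omega)
      rwa [List.getElem?_append_left (by omega)] at this
    · have := h (u.length / 2) (by simp; omega)
      have e : 2 * (u.length / 2) = u.length := by omega
      rw [e] at this
      simp at this
      rw [this]
      rfl
  · rintro ⟨h1, h2⟩ j hj
    simp at hj
    by_cases hlt : 2 * j < u.length
    · rw [List.getElem?_append_left hlt]
      exact h1 j (by omega)
    · have e : u.length = 2 * j := by omega
      have := h2 (by omega)
      rw [← e]
      simp
      apply Fin.ext
      rw [this]
      show _ = j % 4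
      congr 1
      omega

theorem Q_iff (w : List (Fin 4)) : Q w ↔ SqFree w ∧ P w.reverse := by
  induction w with
  | nil =>
    simp only [Q, true_iff]
    refine ⟨fun v hv h => ?_, fun j hj => by simp at hj⟩
    simp at h
    exact hv h
  | cons c w ih =>
    rw [sqfree_cons, List.reverse_cons, P_concat, Q, ih, ok]
    simp only [Bool.and_eq_true, Bool.or_eq_true, Bool.not_eq_true', List.length_reverse,
      beq_iff_eq, beq_eq_false_iff_ne]
    tauto

theorem dead_all : dead 40 [] = true := by decide +kernel

theorem cnt_all : cnt 40 [] = 636 := by decide +kernel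

theorem set_eq : {u : List (Fin 4) | SqFree u ∧ P u} =
    (((tree 40 []).map List.reverse).toFinset : Set (List (Fin 4))) := by
  ext u
  simp only [Set.mem_ofPred_eq, List.coe_toFinset, List.mem_map]
  constructor
  · rintro ⟨h1, h2⟩
    refine ⟨u.reverse, ?_, by simp⟩
    rw [mem_tree 40 [] _ trivial dead_all, Q_iff]
    exact ⟨List.nil_suffix, sqfree_reverse _ h1, by simpa using h2⟩
  · rintro ⟨w, hw, rfl⟩
    rw [mem_tree 40 [] _ trivial dead_all, Q_iff] at hw
    exact ⟨sqfree_reverse _ hw.2.1, hw.2.2⟩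

end SqAux

theorem count_squarefree_quaternary_forced_2 :
    {u : List (Fin 4) | SqFree u ∧
        ∀ j : ℕ, 2 * j + 1 ≤ u.length → u[2 * j]? = some ⟨j % 4, by omega⟩}.Finite ∧
      {u : List (Fin 4) | SqFree u ∧
        ∀ j : ℕ, 2 * j + 1 ≤ u.length → u[2 * j]? = some ⟨j % 4, by omega⟩}.ncard = 636 := by
  change {u : List (Fin 4) | SqFree u ∧ SqAux.P u}.Finite ∧
    {u : List (Fin 4) | SqFree u ∧ SqAux.P u}.ncard = 636
  rw [SqAux.set_eq]
  refine ⟨Finset.finite_toSet _, ?_⟩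
  rw [Set.ncard_coe_finset, List.toFinset_card_of_nodup, List.length_map, SqAux.length_tree,
    SqAux.cnt_all]
  exact (SqAux.tree_nodup _ _).map List.reverse_injective
end

section
/- Let Σ be an alphabet with at least 6 letters. For every sequence v_1, v_2, v_3, … of letters of Σ and every strictly increasing sequence of positive integers p_1 < p_2 < p_3 < … such that p_{i+1} − p_i ≥ 2 for all i ≥ 1, there exists an infinite square-free word u = u_1 u_2 u_3 … over Σ such that u_{p_i} = v_i for all i ≥ 1. (In other words, d(Σ) ≤ 2 for every alphabet Σ with |Σ| ≥ 6.) -/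
namespace SqW

def Sq {α : Type*} (u : ℕ → α) (e p : ℕ) : Prop :=
  2 * p ≤ e + 1 ∧ ∀ i, e < i + p → i ≤ e → u i = u (i - p)

def Ok {α : Type*} (P : ℕ → Prop) (F : ℕ → α) (k : ℕ) (u : ℕ → α) : Prop :=
  (∀ i ≤ k, P i → u i = F i) ∧ ∀ e ≤ k, ∀ p, 1 ≤ p → ¬ Sq u e p

def G {α : Type*} (P : ℕ → Prop) (F : ℕ → α) (c : α) (k : ℕ) : Set (ℕ → α) :=
  {u | Ok P F k u ∧ ∀ i, k < i → u i = c}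

noncomputable def N {α : Type*} (P : ℕ → Prop) (F : ℕ → α) (c : α) (k : ℕ) : ℕ :=
  (G P F c k).ncard

section
variable {α : Type*} {P : ℕ → Prop} {F : ℕ → α} {c : α}

lemma Sq.congr {u u' : ℕ → α} {e p : ℕ} (h : ∀ i ≤ e, u i = u' i) (hs : Sq u e p) :
    Sq u' e p := by
  refine ⟨hs.1, fun i h1 h2 => ?_⟩
  rw [← h i h2, ← h (i - p) (by omega)]
  exact hs.2 i h1 h2

lemma Ok.congr {u u' : ℕ → α} {k : ℕ} (h : ∀ i ≤ k, u i = u' i) (hs : Ok P F k u) :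
    Ok P F k u' := by
  refine ⟨fun i hi hp => by rw [← h i hi]; exact hs.1 i hi hp, fun e he p hp hsq => ?_⟩
  exact hs.2 e he p hp (hsq.congr (fun i hi => (h i (by omega)).symm))

lemma Ok.mono {u : ℕ → α} {k m : ℕ} (hm : m ≤ k) (hs : Ok P F k u) : Ok P F m u :=
  ⟨fun i hi => hs.1 i (by omega), fun e he => hs.2 e (by omega)⟩

lemma finite_tail [Fintype α] (k : ℕ) (T : ℕ → α) (S : Set (ℕ → α))
    (hS : ∀ u ∈ S, ∀ i, k < i → u i = T i) : S.Finite := by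
  refine Set.Finite.of_finite_image
    (f := fun (u : ℕ → α) (i : Fin (k + 1)) => u i) (Set.toFinite _) ?_
  intro u hu u' hu' h
  funext i
  by_cases hi : k < i
  · rw [hS u hu i hi, hS u' hu' i hi]
  · exact congrFun h ⟨i, by omega⟩

lemma G_finite [Fintype α] (k : ℕ) : (G P F c k).Finite :=
  finite_tail k (fun _ => c) _ (fun _ hu => hu.2)

/-- counting by truncation -/
lemma ncard_le_N [Fintype α] (B : Set (ℕ → α)) (m : ℕ) (h1 : ∀ u ∈ B, Ok P F m u)
    (h2 : ∀ u ∈ B, ∀ u' ∈ B, (∀ i ≤ m, u i = u' i) → ∀ i, u i = u' i) :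
    B.ncard ≤ N P F c m := by
  refine Set.ncard_le_ncard_of_injOn (fun u i => if i ≤ m then u i else c) ?_ ?_ (G_finite m)
  · intro u hu
    refine ⟨(h1 u hu).congr (fun i hi => by simp [hi]), fun i hi => ?_⟩
    simp [Nat.not_le.mpr hi]
  · intro u hu u' hu' h
    funext i
    refine h2 u hu u' hu' (fun i hi => ?_) i
    have := congrFun h i
    simpa [hi] using this

/-- candidates -/
def Cand (P : ℕ → Prop) (F : ℕ → α) (k : ℕ) (T : ℕ → α) (ex : (ℕ → α) → Finset α) :
    Set (ℕ → α) :=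
  {u | Ok P F k u ∧ (∀ i, k + 1 < i → u i = T i) ∧ u (k + 1) ∉ ex u}

lemma Cand_finite [Fintype α] (k : ℕ) (T : ℕ → α) (ex : (ℕ → α) → Finset α) :
    (Cand P F k T ex).Finite :=
  finite_tail (k + 1) T _ (fun _ hu => hu.2.1)

lemma Cand_card [Fintype α] (k K : ℕ) (T : ℕ → α) (ex : (ℕ → α) → Finset α)
    (hex : ∀ u u' : ℕ → α, (∀ i ≤ k, u i = u' i) → ex u = ex u')
    (hK : ∀ u, Ok P F k u → K + (ex u).card ≤ Fintype.card α) :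
    K * N P F c k ≤ (Cand P F k T ex).ncard := by
  classical
  have hfin := G_finite (P := P) (F := F) (c := c) k
  set S := hfin.toFinset.sigma (fun u => (ex u)ᶜ) with hS
  have h1 : K * N P F c k ≤ S.card := by
    rw [hS, Finset.card_sigma, N, Set.ncard_eq_toFinset_card _ hfin, mul_comm]
    rw [← smul_eq_mul]
    apply Finset.card_nsmul_le_sum
    intro u hu
    rw [Finset.card_compl]
    have := hK u ((hfin.mem_toFinset.mp hu).1)
    omega
  refine h1.trans ?_
  rw [← Set.ncard_coe_finset S]
  refine Set.ncard_le_ncard_of_injOn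
    (fun x i => if i ≤ k then x.1 i else if i = k + 1 then x.2 else T i) ?_ ?_
    (Cand_finite k T ex)
  · rintro ⟨u, a⟩ hx
    have hx' : u ∈ hfin.toFinset ∧ a ∈ (ex u)ᶜ := by simpa [hS] using hx
    have hu := hfin.mem_toFinset.mp hx'.1
    refine ⟨hu.1.congr (fun i hi => by simp [hi]), fun i hi => ?_, ?_⟩
    · have h1 : ¬ i ≤ k := by omega
      have h2 : ¬ i = k + 1 := by omega
      simp [h1, h2]
    · rw [← hex u _ (fun i hi => by simp [hi])]
      simpa using hx'.2
  · rintro ⟨u, a⟩ hx ⟨u', a'⟩ hx' h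
    have hx1 : u ∈ hfin.toFinset ∧ a ∈ (ex u)ᶜ := by simpa [hS] using hx
    have hx2 : u' ∈ hfin.toFinset ∧ a' ∈ (ex u')ᶜ := by simpa [hS] using hx'
    have hu := hfin.mem_toFinset.mp hx1.1
    have hu' := hfin.mem_toFinset.mp hx2.1
    have e1 : u = u' := by
      funext i
      by_cases hi : i ≤ k
      · have := congrFun h i
        simpa [hi] using this
      · rw [hu.2 i (by omega), hu'.2 i (by omega)]
    have e2 : a = a' := by
      have := congrFun h (k + 1)
      simpa using this
    rw [e1, e2]

lemma step_count [Fintype α] {k k' K : ℕ} (T : ℕ → α) (ex : (ℕ → α) → Finset α)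
    (hex : ∀ u u' : ℕ → α, (∀ i ≤ k, u i = u' i) → ex u = ex u')
    (hK : ∀ u, Ok P F k u → K + (ex u).card ≤ Fintype.card α)
    (hk' : k + 1 ≤ k') (hT : ∀ i, k' < i → T i = c)
    (I : Finset ℕ) (Bad : ℕ → (ℕ → α) → Prop) (cost : ℕ → ℕ)
    (hcov : ∀ u ∈ Cand P F k T ex, Ok P F k' u ∨ ∃ j ∈ I, Bad j u)
    (hbad : ∀ j ∈ I, {u | u ∈ Cand P F k T ex ∧ Bad j u}.ncard ≤ cost j) :
    K * N P F c k ≤ N P F c k' + ∑ j ∈ I, cost j := by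
  classical
  refine (Cand_card (c := c) k K T ex hex hK).trans ?_
  have hfin := Cand_finite (P := P) (F := F) k T ex
  have hsub : Cand P F k T ex ⊆ G P F c k' ∪ ⋃ j ∈ I, {u | u ∈ Cand P F k T ex ∧ Bad j u} := by
    intro u hu
    rcases hcov u hu with h | ⟨j, hj, h⟩
    · left
      exact ⟨h, fun i hi => by rw [hu.2.1 i (by omega), hT i hi]⟩
    · right
      simp only [Set.mem_iUnion]
      exact ⟨j, hj, hu, h⟩
  have hfin2 : (⋃ j ∈ I, {u | u ∈ Cand P F k T ex ∧ Bad j u}).Finite := by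
    refine hfin.subset ?_
    intro u hu
    simp only [Set.mem_iUnion] at hu
    obtain ⟨j, hj, h⟩ := hu
    exact h.1
  refine (Set.ncard_le_ncard hsub ((G_finite k').union hfin2)).trans ?_
  refine (Set.ncard_union_le _ _).trans ?_
  refine Nat.add_le_add_left ?_ _
  clear hsub hfin2 hcov
  induction I using Finset.induction_on with
  | empty => simp
  | insert a s ha ih =>
    rw [Finset.sum_insert ha, Finset.set_biUnion_insert]
    refine (Set.ncard_union_le _ _).trans ?_
    exact Nat.add_le_add (hbad a (by simp)) (ih (fun j hj => hbad j (by simp [hj])))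


/-- the tail: the forced letter at `k+2` followed by the default -/
def TT (F : ℕ → α) (c : α) (k : ℕ) : ℕ → α := fun i => if i = k + 2 then F (k + 2) else c

lemma bad1 [Fintype α] {k j : ℕ} (T : ℕ → α) (ex : (ℕ → α) → Finset α) (hj : j ≤ k) :
    {u | u ∈ Cand P F k T ex ∧ (Sq u (k + 1) (k + 2 - j) ∨ Sq u (k + 2) (k + 2 - j))}.ncard
      ≤ N P F c j := by
  refine ncard_le_N _ j (fun u hu => hu.1.1.mono hj) ?_
  intro u hu u' hu' h i
  have key : ∀ w : ℕ → α, (Sq w (k + 1) (k + 2 - j) ∨ Sq w (k + 2) (k + 2 - j)) →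
      ∀ i, j < i → i ≤ k + 1 → w i = w (i - (k + 2 - j)) := by
    rintro w (hw | hw) i h1 h2
    · exact hw.2 i (by omega) (by omega)
    · exact hw.2 i (by omega) (by omega)
  induction i using Nat.strong_induction_on with
  | _ i ih =>
    by_cases h1 : i ≤ j
    · exact h i h1
    by_cases h2 : i ≤ k + 1
    · rw [key u hu.2 i (by omega) h2, key u' hu'.2 i (by omega) h2]
      exact ih _ (by omega)
    · rw [hu.1.2.1 i (by omega), hu'.1.2.1 i (by omega)]

lemma bad2 [Fintype α] {k j e : ℕ} (T : ℕ → α) (ex : (ℕ → α) → Finset α) (hj : j ≤ k)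
    (hj1 : 1 ≤ j) (he : e = k + 1 ∨ e = k + 2) :
    {u | u ∈ Cand P F k T ex ∧ Sq u e (k + 2 - j)}.ncard ≤ N P F c (j - 1) := by
  refine ncard_le_N _ (j - 1) (fun u hu => hu.1.1.mono (by omega)) ?_
  intro u hu u' hu' h i
  have key : ∀ w : ℕ → α, Sq w e (k + 2 - j) →
      ∀ i, j < i → i ≤ k + 1 → w i = w (i - (k + 2 - j)) := by
    intro w hw i h1 h2
    exact hw.2 i (by omega) (by omega)
  induction i using Nat.strong_induction_on with
  | _ i ih =>
    by_cases h1 : i ≤ j - 1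
    · exact h i h1
    by_cases h3 : i = j
    · subst h3
      rcases he with he | he
      · rw [hu.2.2 i (by omega) (by omega), hu'.2.2 i (by omega) (by omega)]
        exact ih _ (by omega)
      · have e1 := hu.2.2 (k + 2) (by omega) (by omega)
        have e2 := hu'.2.2 (k + 2) (by omega) (by omega)
        have e3 : k + 2 - (k + 2 - i) = i := by omega
        rw [e3] at e1 e2
        rw [← e1, ← e2, hu.1.2.1 _ (by omega), hu'.1.2.1 _ (by omega)]
    by_cases h2 : i ≤ k + 1
    · rw [key u hu.2 i (by omega) h2, key u' hu'.2 i (by omega) h2]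
      exact ih _ (by omega)
    · rw [hu.1.2.1 i (by omega), hu'.1.2.1 i (by omega)]

lemma bad3 [Fintype α] {k j e : ℕ} (T : ℕ → α) (ex : (ℕ → α) → Finset α) (hj : j + 1 ≤ k)
    (hj1 : 3 ≤ j) (he : e = k + 1 ∨ e = k + 2) (hPk : P k) (hPj : P (j - 1)) :
    {u | u ∈ Cand P F k T ex ∧ Sq u e (k + 2 - j)}.ncard ≤ N P F c (j - 3) := by
  refine ncard_le_N _ (j - 3) (fun u hu => hu.1.1.mono (by omega)) ?_
  intro u hu u' hu' h i
  have key : ∀ w : ℕ → α, Sq w e (k + 2 - j) →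
      ∀ i, j < i → i ≤ k + 1 → w i = w (i - (k + 2 - j)) := by
    intro w hw i h1 h2
    exact hw.2 i (by omega) (by omega)
  induction i using Nat.strong_induction_on with
  | _ i ih =>
    by_cases h1 : i ≤ j - 3
    · exact h i h1
    by_cases h4 : i = j - 2
    · have e1 := hu.2.2 k (by omega) (by omega)
      have e2 := hu'.2.2 k (by omega) (by omega)
      have e3 : k - (k + 2 - j) = i := by omega
      rw [e3] at e1 e2
      rw [← e1, ← e2, hu.1.1.1 k le_rfl hPk, hu'.1.1.1 k le_rfl hPk]
    by_cases h5 : i = j - 1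
    · rw [h5, hu.1.1.1 _ (by omega) hPj, hu'.1.1.1 _ (by omega) hPj]
    by_cases h3 : i = j
    · subst h3
      rcases he with he | he
      · rw [hu.2.2 i (by omega) (by omega), hu'.2.2 i (by omega) (by omega)]
        exact ih _ (by omega)
      · have e1 := hu.2.2 (k + 2) (by omega) (by omega)
        have e2 := hu'.2.2 (k + 2) (by omega) (by omega)
        have e3 : k + 2 - (k + 2 - i) = i := by omega
        rw [e3] at e1 e2
        rw [← e1, ← e2, hu.1.2.1 _ (by omega), hu'.1.2.1 _ (by omega)]
    by_cases h2 : i ≤ k + 1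
    · rw [key u hu.2 i (by omega) h2, key u' hu'.2 i (by omega) h2]
      exact ih _ (by omega)
    · rw [hu.1.2.1 i (by omega), hu'.1.2.1 i (by omega)]

lemma badd1 [Fintype α] {k j m : ℕ} (T : ℕ → α) (ex : (ℕ → α) → Finset α) (hj : j ≤ m)
    (hm : m ≤ k) :
    {u | u ∈ Cand P F k T ex ∧ Sq u (k + 1) (k + 1 - j)}.ncard ≤ N P F c m := by
  refine ncard_le_N _ m (fun u hu => hu.1.1.mono (by omega)) ?_
  intro u hu u' hu' h i
  induction i using Nat.strong_induction_on with
  | _ i ih =>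
    by_cases h1 : i ≤ m
    · exact h i h1
    by_cases h2 : i ≤ k + 1
    · rw [hu.2.2 i (by omega) h2, hu'.2.2 i (by omega) h2]
      exact ih _ (by omega)
    · rw [hu.1.2.1 i (by omega), hu'.1.2.1 i (by omega)]

lemma badd2 [Fintype α] {k j : ℕ} (T : ℕ → α) (ex : (ℕ → α) → Finset α) (hj : j + 1 ≤ k)
    (hj2 : 2 ≤ j) (hPk : P k) (hPj : P j) :
    {u | u ∈ Cand P F k T ex ∧ Sq u (k + 1) (k + 1 - j)}.ncard ≤ N P F c (j - 2) := by
  refine ncard_le_N _ (j - 2) (fun u hu => hu.1.1.mono (by omega)) ?_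
  intro u hu u' hu' h i
  induction i using Nat.strong_induction_on with
  | _ i ih =>
    by_cases h1 : i ≤ j - 2
    · exact h i h1
    by_cases h4 : i = j - 1
    · have e1 := hu.2.2 k (by omega) (by omega)
      have e2 := hu'.2.2 k (by omega) (by omega)
      have e3 : k - (k + 1 - j) = i := by omega
      rw [e3] at e1 e2
      rw [← e1, ← e2, hu.1.1.1 k le_rfl hPk, hu'.1.1.1 k le_rfl hPk]
    by_cases h5 : i = j
    · rw [h5, hu.1.1.1 _ (by omega) hPj, hu'.1.1.1 _ (by omega) hPj]
    by_cases h2 : i ≤ k + 1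
    · rw [hu.2.2 i (by omega) h2, hu'.2.2 i (by omega) h2]
      exact ih _ (by omega)
    · rw [hu.1.2.1 i (by omega), hu'.1.2.1 i (by omega)]

open Classical in
noncomputable def half (P : ℕ → Prop) (F : ℕ → α) (c : α) (j : ℕ) : ℕ :=
  if P (j - 1) then N P F c (j - 3) else N P F c (j - 1)

open Classical in
noncomputable def chS (P : ℕ → Prop) (F : ℕ → α) (c : α) (j : ℕ) : ℕ :=
  if P j then N P F c j else 2 * half P F c j

open Classical in
noncomputable def chD (P : ℕ → Prop) (F : ℕ → α) (c : α) (j : ℕ) : ℕ :=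
  if P j then N P F c (j - 2) else if P (j + 1) then N P F c (j + 1) else N P F c j

open Classical in
noncomputable def chE (P : ℕ → Prop) (F : ℕ → α) (c : α) (j : ℕ) : ℕ :=
  if P j then N P F c j else 2 * N P F c (j - 1)

lemma ncard_or [Fintype α] {k : ℕ} {T : ℕ → α} {ex : (ℕ → α) → Finset α}
    {A B : (ℕ → α) → Prop} {a b : ℕ}
    (hA : {u | u ∈ Cand P F k T ex ∧ A u}.ncard ≤ a)
    (hB : {u | u ∈ Cand P F k T ex ∧ B u}.ncard ≤ b) :
    {u | u ∈ Cand P F k T ex ∧ (A u ∨ B u)}.ncard ≤ a + b := by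
  have : {u | u ∈ Cand P F k T ex ∧ (A u ∨ B u)} =
      {u | u ∈ Cand P F k T ex ∧ A u} ∪ {u | u ∈ Cand P F k T ex ∧ B u} := by
    ext u
    simp only [Set.mem_ofPred_eq, Set.mem_union]
    tauto
  rw [this]
  exact (Set.ncard_union_le _ _).trans (Nat.add_le_add hA hB)

/-- one square ending at `e`, first half ending around `j` -/
lemma bad_half [Fintype α] {k j e : ℕ} (T : ℕ → α) (ex : (ℕ → α) → Finset α)
    (h1 : ¬ P 1) (hj : j + 1 ≤ k)
    (hj1 : 2 ≤ j) (he : e = k + 1 ∨ e = k + 2) (hPk : P k) :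
    {u | u ∈ Cand P F k T ex ∧ Sq u e (k + 2 - j)}.ncard ≤ half P F c j := by
  unfold half
  split_ifs with h
  · have : j ≠ 2 := by
      rintro rfl
      exact h1 h
    exact bad3 T ex hj (by omega) he hPk h
  · exact bad2 T ex (by omega) (by omega) he

lemma bad_S [Fintype α] {k j : ℕ} (T : ℕ → α) (ex : (ℕ → α) → Finset α)
    (h1 : ¬ P 1) (hj : j + 1 ≤ k) (hj1 : 2 ≤ j) (hPk : P k) :
    {u | u ∈ Cand P F k T ex ∧ (Sq u (k + 1) (k + 2 - j) ∨ Sq u (k + 2) (k + 2 - j))}.ncard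
      ≤ chS P F c j := by
  unfold chS
  split_ifs with h
  · exact bad1 T ex (by omega)
  · rw [two_mul]
    exact ncard_or (bad_half T ex h1 hj hj1 (Or.inl rfl) hPk)
      (bad_half T ex h1 hj hj1 (Or.inr rfl) hPk)

lemma bad_E [Fintype α] {k j : ℕ} (T : ℕ → α) (ex : (ℕ → α) → Finset α)
    (hj : j ≤ k) (hj1 : 1 ≤ j) :
    {u | u ∈ Cand P F k T ex ∧ (Sq u (k + 1) (k + 2 - j) ∨ Sq u (k + 2) (k + 2 - j))}.ncard
      ≤ chE P F c j := by
  unfold chE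
  split_ifs with h
  · exact bad1 T ex (by omega)
  · rw [two_mul]
    exact ncard_or (bad2 T ex hj hj1 (Or.inl rfl)) (bad2 T ex hj hj1 (Or.inr rfl))

lemma bad_D [Fintype α] {k j : ℕ} (T : ℕ → α) (ex : (ℕ → α) → Finset α)
    (hj : j + 1 ≤ k) (hj1 : 2 ≤ j) (hPk : P k) :
    {u | u ∈ Cand P F k T ex ∧ Sq u (k + 1) (k + 1 - j)}.ncard ≤ chD P F c j := by
  unfold chD
  split_ifs with h h'
  · exact badd2 T ex hj hj1 hPk h
  · exact badd1 T ex (by omega) (by omega)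
  · exact badd1 T ex (by omega) (by omega)

lemma cov2 {k : ℕ} {ex : (ℕ → α) → Finset α} (hP1 : ¬ P (k + 1)) {u : ℕ → α}
    (hu : u ∈ Cand P F k (TT F c k) ex)
    (h : ∀ p, 1 ≤ p → ¬ Sq u (k + 1) p ∧ ¬ Sq u (k + 2) p) : Ok P F (k + 2) u := by
  refine ⟨fun i hi hp => ?_, fun e he p hp hs => ?_⟩
  · by_cases h1 : i ≤ k
    · exact hu.1.1 i h1 hp
    by_cases h2 : i = k + 1
    · subst h2
      exact absurd hp hP1
    have : i = k + 2 := by omega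
    subst this
    rw [hu.2.1 _ (by omega)]
    simp [TT]
  · by_cases h1 : e ≤ k
    · exact hu.1.2 e h1 p hp hs
    by_cases h2 : e = k + 1
    · subst h2
      exact (h p hp).1 hs
    have : e = k + 2 := by omega
    subst this
    exact (h p hp).2 hs

lemma cov1 {k : ℕ} {T : ℕ → α} {ex : (ℕ → α) → Finset α} (hP1 : ¬ P (k + 1)) {u : ℕ → α}
    (hu : u ∈ Cand P F k T ex)
    (h : ∀ p, 1 ≤ p → ¬ Sq u (k + 1) p) : Ok P F (k + 1) u := by
  refine ⟨fun i hi hp => ?_, fun e he p hp hs => ?_⟩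
  · by_cases h1 : i ≤ k
    · exact hu.1.1 i h1 hp
    have : i = k + 1 := by omega
    subst this
    exact absurd hp hP1
  · by_cases h1 : e ≤ k
    · exact hu.1.2 e h1 p hp hs
    have : e = k + 1 := by omega
    subst this
    exact h p hp hs

lemma s_core [Fintype α] {f K C3 : ℕ} (ex : (ℕ → α) → Finset α)
    (hex : ∀ u u' : ℕ → α, (∀ i ≤ f, u i = u' i) → ex u = ex u')
    (hK : ∀ u, Ok P F f u → K + (ex u).card ≤ Fintype.card α)
    (h1 : ¬ P 1) (hPf : P f) (hPf1 : ¬ P (f + 1))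
    (h12 : ∀ u ∈ Cand P F f (TT F c f) ex, ∀ p, 1 ≤ p → p ≤ 2 →
      ¬ Sq u (f + 1) p ∧ ¬ Sq u (f + 2) p)
    (h3 : {u | u ∈ Cand P F f (TT F c f) ex ∧ (Sq u (f + 1) 3 ∨ Sq u (f + 2) 3)}.ncard ≤ C3) :
    K * N P F c f ≤ N P F c (f + 2) + (C3 + ∑ j ∈ Finset.Ico 2 (f - 1), chS P F c j) := by
  classical
  have := step_count (P := P) (F := F) (c := c) (k := f) (k' := f + 2) (K := K) (TT F c f) ex
    hex hK (by omega) (fun i hi => by simp [TT]; omega) (insert 0 (Finset.Ico 2 (f - 1)))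
    (fun j u => if j = 0 then (Sq u (f + 1) 3 ∨ Sq u (f + 2) 3) else
      (Sq u (f + 1) (f + 2 - j) ∨ Sq u (f + 2) (f + 2 - j)))
    (fun j => if j = 0 then C3 else chS P F c j) ?_ ?_
  · rw [Finset.sum_insert (by simp)] at this
    have e : ∑ j ∈ Finset.Ico 2 (f - 1), (if j = 0 then C3 else chS P F c j) =
        ∑ j ∈ Finset.Ico 2 (f - 1), chS P F c j := by
      refine Finset.sum_congr rfl (fun j hj => ?_)
      have := (Finset.mem_Ico.mp hj).1
      rw [if_neg (by omega)]
    rw [e] at this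
    simpa using this
  · intro u hu
    by_cases hc : ∃ p, 1 ≤ p ∧ (Sq u (f + 1) p ∨ Sq u (f + 2) p)
    · right
      obtain ⟨p, hp, hs⟩ := hc
      have hp2 : ¬ p ≤ 2 := by
        intro hp2
        have := h12 u hu p hp hp2
        tauto
      by_cases hp3 : p = 3
      · exact ⟨0, by simp, by simpa [hp3] using hs⟩
      · have hsz : 2 * p ≤ f + 3 := by
          rcases hs with hs | hs <;> have := hs.1 <;> omega
        refine ⟨f + 2 - p, ?_, ?_⟩
        · simp only [Finset.mem_insert, Finset.mem_Ico]
          right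
          omega
        · rw [if_neg (by omega)]
          have : f + 2 - (f + 2 - p) = p := by omega
          rw [this]
          exact hs
    · left
      push Not at hc
      exact cov2 hPf1 hu hc
  · intro j hj
    simp only [Finset.mem_insert, Finset.mem_Ico] at hj
    by_cases hj0 : j = 0
    · simpa [hj0] using h3
    · simp only [hj0, if_false]
      exact bad_S _ ex h1 (by omega) (by omega) hPf

lemma d_step [Fintype α] (hcard : 6 ≤ Fintype.card α) {f : ℕ} (hPf : P f) (hPf1 : ¬ P (f + 1)) :
    4 * N P F c f ≤ N P F c (f + 1) + ∑ j ∈ Finset.Ico 2 (f - 1), chD P F c j := by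
  classical
  refine step_count (P := P) (F := F) (c := c) (k := f) (k' := f + 1) (K := 4) (fun _ => c)
    (fun u => {u f, u (f - 1)}) ?_ ?_ (by omega) (fun i hi => rfl) _
    (fun j u => Sq u (f + 1) (f + 1 - j)) _ ?_ ?_
  · intro u u' h
    simp only [h f le_rfl, h (f - 1) (by omega)]
  · intro u _
    have := Finset.card_le_two (a := u f) (b := u (f - 1))
    omega
  · intro u hu
    have hx := hu.2.2
    simp only [Finset.mem_insert, Finset.mem_singleton, not_or] at hx
    by_cases hc : ∃ p, 1 ≤ p ∧ Sq u (f + 1) p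
    · right
      obtain ⟨p, hp, hs⟩ := hc
      have hsz := hs.1
      have hp1 : p ≠ 1 := by
        rintro rfl
        exact hx.1 (hs.2 (f + 1) (by omega) le_rfl)
      have hp2 : p ≠ 2 := by
        rintro rfl
        exact hx.2 (hs.2 (f + 1) (by omega) le_rfl)
      refine ⟨f + 1 - p, ?_, ?_⟩
      · simp only [Finset.mem_Ico]
        omega
      · have : f + 1 - (f + 1 - p) = p := by omega
        simpa only [this] using hs
    · left
      push Not at hc
      exact cov1 hPf1 hu hc
  · intro j hj
    simp only [Finset.mem_Ico] at hj
    exact bad_D _ _ (by omega) (by omega) hPf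

lemma e_step [Fintype α] (hcard : 6 ≤ Fintype.card α) {f : ℕ} (hPf : P f)
    (hPf2 : ¬ P (f + 2)) :
    4 * N P F c (f + 1) ≤ N P F c (f + 3) +
      (2 * N P F c f + ∑ j ∈ Finset.Ico 2 f, chE P F c j) := by
  classical
  have := step_count (P := P) (F := F) (c := c) (k := f + 1) (k' := f + 3) (K := 4)
    (TT F c (f + 1))
    (fun u => if u (f + 1) = F (f + 3) then {F (f + 3), F f} else {u (f + 1), F (f + 3)})
    ?_ ?_ (by omega)
    (fun i hi => by simp [TT]; omega) (insert 0 (Finset.Ico 2 f))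
    (fun j u => if j = 0 then (Sq u (f + 2) 2 ∨ (Sq u (f + 2) (f + 3 - f) ∨
        Sq u (f + 3) (f + 3 - f))) else
      (Sq u (f + 2) (f + 3 - j) ∨ Sq u (f + 3) (f + 3 - j)))
    (fun j => if j = 0 then N P F c f + N P F c f else chE P F c j) ?_ ?_
  · rw [Finset.sum_insert (by simp)] at this
    have e : ∑ j ∈ Finset.Ico 2 f, (if j = 0 then N P F c f + N P F c f else chE P F c j) =
        ∑ j ∈ Finset.Ico 2 f, chE P F c j := by
      refine Finset.sum_congr rfl (fun j hj => ?_)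
      have := (Finset.mem_Ico.mp hj).1
      rw [if_neg (by omega)]
    rw [e, if_pos rfl] at this
    omega
  · intro u u' h
    simp only [h (f + 1) le_rfl]
  · intro u _
    split_ifs
    · have := Finset.card_le_two (a := F (f + 3)) (b := F f)
      omega
    · have := Finset.card_le_two (a := u (f + 1)) (b := F (f + 3))
      omega
  · intro u hu
    have hx := hu.2.2
    have hT : u (f + 3) = F (f + 3) := by
      rw [hu.2.1 _ (by omega)]
      simp [TT]
    have hF : u f = F f := hu.1.1 f (by omega) hPf
    have x1 : u (f + 2) ≠ u (f + 1) ∧ u (f + 2) ≠ F (f + 3) ∧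
        (u (f + 1) = F (f + 3) → u (f + 2) ≠ F f) := by
      by_cases h : u (f + 1) = F (f + 3)
      · simp only [h, if_true, Finset.mem_insert, Finset.mem_singleton, not_or] at hx
        rw [h]
        exact ⟨hx.1, hx.1, fun _ => hx.2⟩
      · simp only [h, if_false, Finset.mem_insert, Finset.mem_singleton, not_or] at hx
        exact ⟨hx.1, hx.2, fun h' => absurd h' h⟩
    by_cases hc : ∃ p, 1 ≤ p ∧ (Sq u (f + 2) p ∨ Sq u (f + 3) p)
    · right
      obtain ⟨p, hp, hs⟩ := hc
      have hsz : 2 * p ≤ f + 4 := by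
        rcases hs with hs | hs <;> have := hs.1 <;> omega
      have hp1 : p ≠ 1 := by
        rintro rfl
        rcases hs with hs | hs
        · exact x1.1 (hs.2 (f + 2) (by omega) le_rfl)
        · have := hs.2 (f + 3) (by omega) le_rfl
          rw [hT] at this
          exact x1.2.1 this.symm
      by_cases hp2 : p = 2
      · subst hp2
        refine ⟨0, by simp, ?_⟩
        rcases hs with hs | hs
        · simp [hs]
        · exfalso
          have a1 := hs.2 (f + 3) (by omega) le_rfl
          have a2 := hs.2 (f + 2) (by omega) (by omega)
          rw [hT] at a1
          exact x1.2.2 a1.symm (a2.trans hF)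
      by_cases hp3 : p = 3
      · subst hp3
        refine ⟨0, by simp, ?_⟩
        have : f + 3 - f = 3 := by omega
        rw [if_pos rfl, this]
        exact Or.inr hs
      · refine ⟨f + 3 - p, ?_, ?_⟩
        · simp only [Finset.mem_insert, Finset.mem_Ico]
          right
          omega
        · rw [if_neg (by omega)]
          have : f + 3 - (f + 3 - p) = p := by omega
          rw [this]
          exact hs
    · left
      push Not at hc
      exact cov2 hPf2 hu hc
  · intro j hj
    simp only [Finset.mem_insert, Finset.mem_Ico] at hj
    by_cases hj0 : j = 0
    · simp only [hj0, if_true]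
      refine ncard_or ?_ (bad1 (k := f + 1) (j := f) _ _ (by omega))
      have := bad2 (P := P) (F := F) (c := c) (k := f + 1) (j := f + 1) (e := f + 2)
        (TT F c (f + 1))
        (fun u => if u (f + 1) = F (f + 3) then {F (f + 3), F f} else {u (f + 1), F (f + 3)})
        le_rfl (by omega) (Or.inl rfl)
      have e : f + 1 + 2 - (f + 1) = 2 := by omega
      rw [e] at this
      simpa using this
    · simp only [hj0, if_false]
      exact bad_E (k := f + 1) _ _ (by omega) (by omega)

noncomputable def ww (P : ℕ → Prop) (F : ℕ → α) (c : α) (f : ℕ) : ℕ :=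
  if f < 3 then 0 else half P F c (f - 1)

noncomputable def zz (P : ℕ → Prop) (F : ℕ → α) (c : α) (f : ℕ) : ℕ :=
  if f < 2 then 0 else N P F c (f - 2)

noncomputable def sA (P : ℕ → Prop) (F : ℕ → α) (c : α) (f : ℕ) : ℕ :=
  ∑ j ∈ Finset.Ico 2 (f - 1), chS P F c j

noncomputable def sD (P : ℕ → Prop) (F : ℕ → α) (c : α) (f : ℕ) : ℕ :=
  ∑ j ∈ Finset.Ico 2 (f - 1), chD P F c j

noncomputable def sE (P : ℕ → Prop) (F : ℕ → α) (c : α) (f : ℕ) : ℕ :=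
  ∑ j ∈ Finset.Ico 2 f, chE P F c j

lemma Ok.ne {u : ℕ → α} {k i : ℕ} (h : Ok P F k u) (hi : i + 1 ≤ k) : u (i + 1) ≠ u i := by
  intro he
  refine h.2 (i + 1) hi 1 le_rfl ⟨by omega, fun j h1 h2 => ?_⟩
  have : j = i + 1 := by omega
  subst this
  exact he

lemma cand_facts {f : ℕ} {ex : (ℕ → α) → Finset α} {u : ℕ → α} (hPf : P f)
    (hu : u ∈ Cand P F f (TT F c f) ex) : u f = F f ∧ u (f + 2) = F (f + 2) := by
  refine ⟨hu.1.1 f le_rfl hPf, ?_⟩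
  rw [hu.2.1 _ (by omega)]
  simp [TT]

lemma sq1 {u : ℕ → α} {f : ℕ} (h1 : u (f + 1) ≠ u f) (h2 : u (f + 1) ≠ u (f + 2)) :
    ¬ Sq u (f + 1) 1 ∧ ¬ Sq u (f + 2) 1 :=
  ⟨fun hs => h1 (hs.2 (f + 1) (by omega) le_rfl),
    fun hs => h2 (hs.2 (f + 2) (by omega) le_rfl).symm⟩

lemma sq2 {u : ℕ → α} {f : ℕ} (h1 : u (f + 1) ≠ u (f - 1)) :
    ¬ Sq u (f + 1) 2 ∧ ¬ Sq u (f + 2) 2 :=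
  ⟨fun hs => h1 (hs.2 (f + 1) (by omega) le_rfl),
    fun hs => h1 (hs.2 (f + 1) (by omega) (by omega))⟩

lemma sq2' {u : ℕ → α} {f : ℕ} (h1 : 2 ≤ f → u f ≠ u (f - 2)) (h2 : u (f + 2) ≠ u f) :
    ¬ Sq u (f + 1) 2 ∧ ¬ Sq u (f + 2) 2 :=
  ⟨fun hs => h1 (by have := hs.1; omega) (hs.2 f (by omega) (by omega)),
    fun hs => h2 (hs.2 (f + 2) (by omega) (by omega))⟩

lemma s_eq [Fintype α] (hcard : 6 ≤ Fintype.card α) {f : ℕ} (h1 : ¬ P 1) (hPf : P f)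
    (hPf1 : ¬ P (f + 1)) (heq : F f = F (f + 2)) :
    4 * N P F c f ≤ N P F c (f + 2) + (ww P F c f + sA P F c f) := by
  classical
  refine s_core (fun u => {F f, u (f - 1)}) ?_ ?_ h1 hPf hPf1 ?_ ?_
  · intro u u' h
    simp only [h (f - 1) (by omega)]
  · intro u _
    have := Finset.card_le_two (a := F f) (b := u (f - 1))
    omega
  · intro u hu p hp hp2
    obtain ⟨e1, e2⟩ := cand_facts hPf hu
    have hx := hu.2.2
    simp only [Finset.mem_insert, Finset.mem_singleton, not_or] at hx
    obtain rfl | rfl : p = 1 ∨ p = 2 := by omega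
    · exact sq1 (by rw [e1]; exact hx.1) (by rw [e2, ← heq]; exact hx.1)
    · exact sq2 hx.2
  · unfold ww
    split_ifs with hf
    · rw [Nat.le_zero, Set.ncard_eq_zero ((Cand_finite _ _ _).subset (fun u hu => hu.1))]
      ext u
      simp only [Set.mem_empty_iff_false, iff_false]
      rintro ⟨_, hs | hs⟩ <;> have := hs.1 <;> omega
    · have hb := bad_half (P := P) (F := F) (c := c) (k := f) (j := f - 1) (e := f + 1)
        (TT F c f) (fun u => {F f, u (f - 1)}) h1 (by omega) (by omega) (Or.inl rfl) hPf
      have e : f + 2 - (f - 1) = 3 := by omega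
      rw [e] at hb
      refine le_trans (Set.ncard_le_ncard ?_
        ((Cand_finite _ _ _).subset (fun u hu => hu.1))) hb
      rintro u ⟨hu, hs | hs⟩
      · exact ⟨hu, hs⟩
      · exfalso
        obtain ⟨e1, e2⟩ := cand_facts hPf hu
        have a := hs.2 (f + 2) (by omega) le_rfl
        have b := hu.1.ne (i := f - 1) (by omega)
        have e3 : f - 1 + 1 = f := by omega
        have e4 : f + 2 - 3 = f - 1 := by omega
        rw [e3] at b
        rw [e4] at a
        exact b (by rw [← a, e1, e2, heq])

lemma s_b [Fintype α] (hcard : 6 ≤ Fintype.card α) {f : ℕ} (h1 : ¬ P 1) (hPf : P f)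
    (hPf1 : ¬ P (f + 1)) (hP' : P (f - 2)) (hne : F (f - 2) ≠ F f) (heq : F f ≠ F (f + 2)) :
    4 * N P F c f ≤ N P F c (f + 2) + (2 * ww P F c f + sA P F c f) := by
  classical
  refine s_core (fun u => {F f, F (f + 2)}) ?_ ?_ h1 hPf hPf1 ?_ ?_
  · intro u u' h
    rfl
  · intro u _
    have := Finset.card_le_two (a := F f) (b := F (f + 2))
    omega
  · intro u hu p hp hp2
    obtain ⟨e1, e2⟩ := cand_facts hPf hu
    have hx := hu.2.2
    simp only [Finset.mem_insert, Finset.mem_singleton, not_or] at hx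
    obtain rfl | rfl : p = 1 ∨ p = 2 := by omega
    · exact sq1 (by rw [e1]; exact hx.1) (by rw [e2]; exact hx.2)
    · refine sq2' (fun _ => ?_) (by rw [e1, e2]; exact heq.symm)
      rw [e1, hu.1.1 (f - 2) (by omega) hP']
      exact hne.symm
  · unfold ww
    split_ifs with hf
    · rw [Nat.le_zero, Set.ncard_eq_zero ((Cand_finite _ _ _).subset (fun u hu => hu.1))]
      ext u
      simp only [Set.mem_empty_iff_false, iff_false]
      rintro ⟨_, hs | hs⟩ <;> have := hs.1 <;> omega
    · rw [two_mul]
      have e : f + 2 - (f - 1) = 3 := by omega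
      refine ncard_or ?_ ?_
      · have hb := bad_half (P := P) (F := F) (c := c) (k := f) (j := f - 1) (e := f + 1)
          (TT F c f) (fun u => {F f, F (f + 2)}) h1 (by omega) (by omega) (Or.inl rfl) hPf
        rwa [e] at hb
      · have hb := bad_half (P := P) (F := F) (c := c) (k := f) (j := f - 1) (e := f + 2)
          (TT F c f) (fun u => {F f, F (f + 2)}) h1 (by omega) (by omega) (Or.inr rfl) hPf
        rwa [e] at hb

lemma s_c [Fintype α] (hcard : 6 ≤ Fintype.card α) {f : ℕ} (h1 : ¬ P 1) (hPf : P f)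
    (hPf1 : ¬ P (f + 1)) (hP' : P (f - 2)) (hne : F (f - 2) = F f) :
    3 * N P F c f ≤ N P F c (f + 2) + (0 + sA P F c f) := by
  classical
  refine s_core (fun u => {F f, F (f + 2), u (f - 1)}) ?_ ?_ h1 hPf hPf1 ?_ ?_
  · intro u u' h
    simp only [h (f - 1) (by omega)]
  · intro u _
    have := Finset.card_le_three (a := F f) (b := F (f + 2)) (c := u (f - 1))
    omega
  · intro u hu p hp hp2
    obtain ⟨e1, e2⟩ := cand_facts hPf hu
    have hx := hu.2.2
    simp only [Finset.mem_insert, Finset.mem_singleton, not_or] at hx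
    obtain rfl | rfl : p = 1 ∨ p = 2 := by omega
    · exact sq1 (by rw [e1]; exact hx.1) (by rw [e2]; exact hx.2.1)
    · exact sq2 hx.2.2
  · rw [Nat.le_zero, Set.ncard_eq_zero ((Cand_finite _ _ _).subset (fun u hu => hu.1))]
    ext u
    simp only [Set.mem_empty_iff_false, iff_false]
    rintro ⟨hu, hs⟩
    obtain ⟨e1, e2⟩ := cand_facts hPf hu
    have hf : 3 ≤ f := by
      rcases hs with hs | hs <;> have := hs.1 <;> omega
    have a : u f = u (f - 3) := by
      rcases hs with hs | hs
      · exact hs.2 f (by omega) (by omega)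
      · exact hs.2 f (by omega) (by omega)
    have b := hu.1.ne (i := f - 3) (by omega)
    have e3 : f - 3 + 1 = f - 2 := by omega
    rw [e3, ← a, e1, hu.1.1 (f - 2) (by omega) hP'] at b
    exact b hne

lemma s_g [Fintype α] (hcard : 6 ≤ Fintype.card α) {f : ℕ} (h1 : ¬ P 1) (hPf : P f)
    (hPf1 : ¬ P (f + 1)) (hf : 3 ≤ f) (hP' : P (f - 3)) (heq : F f ≠ F (f + 2)) :
    3 * N P F c f ≤ N P F c (f + 2) + (0 + sA P F c f) := by
  classical
  refine s_core (fun u => {F f, F (f + 2), if F (f - 3) = F f then u (f - 2) else u (f - 1)})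
    ?_ ?_ h1 hPf hPf1 ?_ ?_
  · intro u u' h
    simp only [h (f - 1) (by omega), h (f - 2) (by omega)]
  · intro u _
    have := Finset.card_le_three (a := F f) (b := F (f + 2))
      (c := if F (f - 3) = F f then u (f - 2) else u (f - 1))
    omega
  · intro u hu p hp hp2
    obtain ⟨e1, e2⟩ := cand_facts hPf hu
    have hx := hu.2.2
    simp only [Finset.mem_insert, Finset.mem_singleton, not_or] at hx
    obtain rfl | rfl : p = 1 ∨ p = 2 := by omega
    · exact sq1 (by rw [e1]; exact hx.1) (by rw [e2]; exact hx.2.1)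
    · by_cases h : F (f - 3) = F f
      · refine sq2' (fun _ => ?_) (by rw [e1, e2]; exact heq.symm)
        have b := hu.1.ne (i := f - 3) (by omega)
        have e3 : f - 3 + 1 = f - 2 := by omega
        rw [e3, hu.1.1 (f - 3) (by omega) hP', h] at b
        rw [e1]
        exact b.symm
      · rw [if_neg h] at hx
        exact sq2 hx.2.2
  · rw [Nat.le_zero, Set.ncard_eq_zero ((Cand_finite _ _ _).subset (fun u hu => hu.1))]
    ext u
    simp only [Set.mem_empty_iff_false, iff_false]
    rintro ⟨hu, hs⟩
    obtain ⟨e1, e2⟩ := cand_facts hPf hu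
    have hx := hu.2.2
    simp only [Finset.mem_insert, Finset.mem_singleton, not_or] at hx
    have a : u f = u (f - 3) := by
      rcases hs with hs | hs
      · exact hs.2 f (by omega) (by omega)
      · exact hs.2 f (by omega) (by omega)
    have a' : u (f + 1) = u (f - 2) := by
      rcases hs with hs | hs
      · exact hs.2 (f + 1) (by omega) (by omega)
      · exact hs.2 (f + 1) (by omega) (by omega)
    rw [e1, hu.1.1 (f - 3) (by omega) hP'] at a
    rw [if_pos a.symm] at hx
    exact hx.2.2 a'

lemma sum_top (g : ℕ → ℕ) (f : ℕ) :
    ∑ j ∈ Finset.Ico 2 (f + 1), g j ≤ ∑ j ∈ Finset.Ico 2 f, g j + (if f < 2 then 0 else g f) := by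
  split_ifs with h
  · rw [Finset.Ico_eq_empty (by omega)]
    simp
  · rw [Finset.sum_Ico_succ_top (by omega)]

lemma sum_top' (g : ℕ → ℕ) (f : ℕ) :
    ∑ j ∈ Finset.Ico 2 f, g j ≤
      ∑ j ∈ Finset.Ico 2 (f - 1), g j + (if f < 3 then 0 else g (f - 1)) := by
  rcases f with _ | f
  · simp
  · have := sum_top g f
    simp only [Nat.add_sub_cancel]
    refine this.trans (le_of_eq ?_)
    congr 1
    by_cases h : f < 2
    · rw [if_pos h, if_pos (by omega)]
    · rw [if_neg h, if_neg (by omega)]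

lemma upd_common {f : ℕ} (hPf : P f) (hadj : ∀ n, P n → ¬ P (n + 1)) :
    sA P F c (f + 2) ≤ sA P F c f + 2 * ww P F c f + N P F c f ∧
    sD P F c (f + 2) ≤ sD P F c f + N P F c f + zz P F c f ∧
    sE P F c (f + 2) ≤ sE P F c f + 3 * N P F c f := by
  have hp : 3 ≤ f → ¬ P (f - 1) := by
    intro h hp
    have := hadj _ hp
    rw [show f - 1 + 1 = f by omega] at this
    exact this hPf
  refine ⟨?_, ?_, ?_⟩
  · unfold sA ww
    have a := sum_top (chS P F c) f
    have b := sum_top' (chS P F c) f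
    have e1 : chS P F c f = N P F c f := by simp [chS, hPf]
    rw [e1] at a
    show ∑ j ∈ Finset.Ico 2 (f + 1), _ ≤ _
    by_cases h : f < 3
    · simp only [h, if_true] at b ⊢
      split_ifs at a <;> omega
    · have e2 : chS P F c (f - 1) = 2 * half P F c (f - 1) := by
        simp [chS, hp (by omega)]
      simp only [h, if_false, e2] at b ⊢
      split_ifs at a <;> omega
  · unfold sD zz
    have a := sum_top (chD P F c) f
    have b := sum_top' (chD P F c) f
    have e1 : chD P F c f = N P F c (f - 2) := by simp [chD, hPf]
    rw [e1] at a
    show ∑ j ∈ Finset.Ico 2 (f + 1), _ ≤ _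
    by_cases h : f < 3
    · simp only [h, if_true] at b
      omega
    · have e2 : chD P F c (f - 1) = N P F c f := by
        simp [chD, hp (by omega), show f - 1 + 1 = f by omega, hPf]
      simp only [h, if_false, e2] at b
      omega
  · unfold sE
    have a := sum_top (chE P F c) f
    have b := sum_top (chE P F c) (f + 1)
    have e1 : chE P F c f = N P F c f := by simp [chE, hPf]
    have e2 : chE P F c (f + 1) = 2 * N P F c f := by simp [chE, hadj f hPf]
    rw [e1] at a
    rw [e2] at b
    show ∑ j ∈ Finset.Ico 2 (f + 1 + 1), chE P F c j ≤ _
    split_ifs at a b <;> omega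

lemma upd2 {f : ℕ} (hPf : P f) (hf : f ≠ 1) :
    ww P F c (f + 2) ≤ zz P F c f ∧ zz P F c (f + 2) = N P F c f := by
  refine ⟨?_, by simp [zz]⟩
  unfold ww zz
  by_cases h : f < 1
  · rw [if_pos (by omega)]
    omega
  rw [if_neg (by omega)]
  by_cases h2 : f < 2
  · omega
  · rw [if_neg h2]
    simp [half, hPf]

lemma upd3 {f : ℕ} (hPf : P f) (h1 : ¬ P (f + 1)) (h2 : ¬ P (f + 2)) (hf : f ≠ 1)
    (hadj : ∀ n, P n → ¬ P (n + 1)) :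
    sA P F c (f + 3) ≤ sA P F c f + 2 * ww P F c f + N P F c f + 2 * zz P F c f ∧
    sD P F c (f + 3) ≤ sD P F c f + N P F c f + zz P F c f + N P F c (f + 1) ∧
    sE P F c (f + 3) ≤ sE P F c f + 3 * N P F c f + 2 * N P F c (f + 1) ∧
    ww P F c (f + 3) = N P F c (f + 1) ∧ zz P F c (f + 3) = N P F c (f + 1) := by
  obtain ⟨a1, a2, a3⟩ := upd_common (c := c) (F := F) hPf hadj
  refine ⟨?_, ?_, ?_, ?_, by simp [zz]⟩
  · have b : sA P F c (f + 3) ≤ sA P F c (f + 2) + _ := sum_top (chS P F c) (f + 1)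
    have e : chS P F c (f + 1) = 2 * N P F c (f - 2) := by simp [chS, half, hPf, h1]
    rw [e] at b
    unfold zz
    split_ifs at b ⊢ <;> omega
  · have b : sD P F c (f + 3) ≤ sD P F c (f + 2) + _ := sum_top (chD P F c) (f + 1)
    have e : chD P F c (f + 1) = N P F c (f + 1) := by simp [chD, h1, h2]
    rw [e] at b
    split_ifs at b <;> omega
  · have b : sE P F c (f + 3) ≤ sE P F c (f + 2) + _ := sum_top (chE P F c) (f + 2)
    have e : chE P F c (f + 2) = 2 * N P F c (f + 1) := by simp [chE, h2]
    rw [e] at b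
    split_ifs at b <;> omega
  · simp [ww, half, h1]

structure Bd (P : ℕ → Prop) (F : ℕ → α) (c : α) (f a1 a2 a3 a4 a5 : ℕ) : Prop where
  hA : 1000 * sA P F c f ≤ a1 * N P F c f
  hw : 1000 * ww P F c f ≤ a2 * N P F c f
  hz : 1000 * zz P F c f ≤ a3 * N P F c f
  hD : 1000 * sD P F c f ≤ a4 * N P F c f
  hE : 1000 * sE P F c f ≤ a5 * N P F c f
  hN : 0 < N P F c f

structure Inv (P : ℕ → Prop) (F : ℕ → α) (c : α) (f : ℕ) : Prop where
  a : P (f - 2) → F (f - 2) = F f → Bd P F c f 833 165 355 886 1860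
  b : P (f - 2) → F (f - 2) ≠ F f → Bd P F c f 999 176 463 1036 2247
  g : ¬ P (f - 2) → Bd P F c f 431 391 391 719 1470

lemma N_zero (hP0 : P 0) : 0 < N P F c 0 := by
  unfold N
  have : G P F c 0 = {fun i => if i = 0 then F 0 else c} := by
    ext u
    simp only [Set.mem_singleton_iff]
    constructor
    · intro hu
      funext i
      by_cases hi : i = 0
      · subst hi
        simpa using hu.1.1 0 le_rfl hP0
      · simpa [hi] using hu.2 i (by omega)
    · rintro rfl
      refine ⟨⟨fun i hi _ => ?_, fun e he p hp hs => ?_⟩, fun i hi => ?_⟩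
      · have : i = 0 := by omega
        subst this
        simp
      · have := hs.1
        omega
      · simp [show i ≠ 0 by omega]
  rw [this]
  simp

lemma inv_zero (hP0 : P 0) : Inv P F c 0 := by
  have h0 := N_zero (F := F) (c := c) hP0
  have e1 : sA P F c 0 = 0 := by simp [sA]
  have e2 : sD P F c 0 = 0 := by simp [sD]
  have e3 : sE P F c 0 = 0 := by simp [sE]
  have e4 : ww P F c 0 = 0 := by simp [ww]
  have e5 : zz P F c 0 = 0 := by simp [zz]
  refine ⟨fun _ _ => ?_, fun _ h => absurd rfl h, fun h => absurd hP0 h⟩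
  constructor <;> omega

lemma step2 [Fintype α] (hcard : 6 ≤ Fintype.card α) {f : ℕ} (hP0 : P 0)
    (hadj : ∀ n, P n → ¬ P (n + 1)) (hgap : ∀ n, ¬ P n → ¬ P (n + 1) → P (n + 2))
    (hPf : P f) (hi : Inv P F c f) : Inv P F c (f + 2) := by
  have h1 : ¬ P 1 := hadj 0 hP0
  have hPf1 := hadj f hPf
  obtain ⟨u1, u2, u3⟩ := upd_common (c := c) (F := F) hPf hadj
  obtain ⟨u4, u5⟩ := upd2 (c := c) (F := F) hPf (fun h => h1 (h ▸ hPf))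
  refine ⟨fun _ heq => ?_, fun _ hne => ?_, fun h => absurd hPf h⟩
  · have hs := s_eq (c := c) hcard h1 hPf hPf1 heq
    by_cases hp : P (f - 2)
    · by_cases hq : F (f - 2) = F f
      · obtain ⟨b1, b2, b3, b4, b5, b6⟩ := hi.a hp hq
        constructor <;> omega
      · obtain ⟨b1, b2, b3, b4, b5, b6⟩ := hi.b hp hq
        constructor <;> omega
    · obtain ⟨b1, b2, b3, b4, b5, b6⟩ := hi.g hp
      constructor <;> omega
  · have hne' : F f ≠ F (f + 2) := hne
    by_cases hp : P (f - 2)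
    · by_cases hq : F (f - 2) = F f
      · have hs := s_c (c := c) hcard h1 hPf hPf1 hp hq
        obtain ⟨b1, b2, b3, b4, b5, b6⟩ := hi.a hp hq
        constructor <;> omega
      · have hs := s_b (c := c) hcard h1 hPf hPf1 hp hq hne'
        obtain ⟨b1, b2, b3, b4, b5, b6⟩ := hi.b hp hq
        constructor <;> omega
    · have hf : 3 ≤ f := by
        by_contra h
        exact hp (by rw [show f - 2 = 0 by omega]; exact hP0)
      have hp3 : P (f - 3) := by
        by_contra h
        have := hgap (f - 3) h (by rw [show f - 3 + 1 = f - 2 by omega]; exact hp)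
        have := hadj _ this
        rw [show f - 3 + 2 + 1 = f by omega] at this
        exact this hPf
      have hs := s_g (c := c) hcard h1 hPf hPf1 hf hp3 hne'
      obtain ⟨b1, b2, b3, b4, b5, b6⟩ := hi.g hp
      constructor <;> omega

lemma step3 [Fintype α] (hcard : 6 ≤ Fintype.card α) {f : ℕ} (hP0 : P 0)
    (hadj : ∀ n, P n → ¬ P (n + 1))
    (hPf : P f) (hPf2 : ¬ P (f + 2)) (hi : Inv P F c f) : Inv P F c (f + 3) := by
  have h1 : ¬ P 1 := hadj 0 hP0
  have hPf1 := hadj f hPf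
  have hf1 : f ≠ 1 := by
    rintro rfl
    exact h1 hPf
  obtain ⟨u1, u2, u3, u4, u5⟩ := upd3 (c := c) (F := F) hPf hPf1 hPf2 hf1 hadj
  refine ⟨fun h => absurd h hPf1, fun h => absurd h hPf1, fun _ => ?_⟩
  have hd : _ ≤ _ + sD P F c f := d_step (F := F) (c := c) hcard hPf hPf1
  have he : _ ≤ _ + (_ + sE P F c f) := e_step (F := F) (c := c) hcard hPf hPf2
  by_cases hp : P (f - 2)
  · by_cases hq : F (f - 2) = F f
    · obtain ⟨b1, b2, b3, b4, b5, b6⟩ := hi.a hp hq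
      constructor <;> omega
    · obtain ⟨b1, b2, b3, b4, b5, b6⟩ := hi.b hp hq
      constructor <;> omega
  · obtain ⟨b1, b2, b3, b4, b5, b6⟩ := hi.g hp
    constructor <;> omega

lemma inv_all [Fintype α] (hcard : 6 ≤ Fintype.card α) (hP0 : P 0)
    (hadj : ∀ n, P n → ¬ P (n + 1)) (hgap : ∀ n, ¬ P n → ¬ P (n + 1) → P (n + 2))
    (f : ℕ) (hPf : P f) : Inv P F c f := by
  induction f using Nat.strong_induction_on with
  | _ f ih =>
    rcases f with _ | _ | _ | f
    · exact inv_zero hP0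
    · exact absurd hPf (hadj 0 hP0)
    · exact step2 hcard hP0 hadj hgap hP0 (ih 0 (by omega) hP0)
    · by_cases h1 : P (f + 1)
      · exact step2 hcard hP0 hadj hgap h1 (ih (f + 1) (by omega) h1)
      · have h2 : ¬ P (f + 2) := fun h => hadj _ h hPf
        have h0 : P f := by
          by_contra h
          exact h2 (hgap f h h1)
        exact step3 hcard hP0 hadj h0 h2 (ih f (by omega) h0)

lemma exists_ok [Fintype α] (c : α) (hcard : 6 ≤ Fintype.card α) (hP0 : P 0)
    (hadj : ∀ n, P n → ¬ P (n + 1)) (hgap : ∀ n, ¬ P n → ¬ P (n + 1) → P (n + 2))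
    (k : ℕ) : ∃ u : ℕ → α, Ok P F k u := by
  have key : ∀ f, P f → ∃ u : ℕ → α, Ok P F f u := by
    intro f hf
    have hi := inv_all (F := F) (c := c) hcard hP0 hadj hgap f hf
    have hN : 0 < N P F c f := by
      by_cases hp : P (f - 2)
      · by_cases hq : F (f - 2) = F f
        · exact (hi.a hp hq).hN
        · exact (hi.b hp hq).hN
      · exact (hi.g hp).hN
    have hN' : (G P F c f).ncard ≠ 0 := by
      unfold N at hN
      omega
    obtain ⟨u, hu⟩ := Set.nonempty_of_ncard_ne_zero hN'
    exact ⟨u, hu.1⟩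
  by_cases h0 : P k
  · exact key k h0
  by_cases h1 : P (k + 1)
  · obtain ⟨u, hu⟩ := key _ h1
    exact ⟨u, hu.mono (by omega)⟩
  obtain ⟨u, hu⟩ := key _ (hgap k h0 h1)
  exact ⟨u, hu.mono (by omega)⟩

lemma exists_inf [Finite α] (h : ∀ k, ∃ u : ℕ → α, Ok P F k u) :
    ∃ u : ℕ → α, ∀ k, Ok P F k u := by
  letI : TopologicalSpace α := ⊥
  haveI : DiscreteTopology α := ⟨rfl⟩
  have hcl : ∀ k, IsClosed {u : ℕ → α | Ok P F k u} := by
    intro k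
    have hcong : ∀ u : ℕ → α, {u' : ℕ → α | ∀ i ≤ k, u i = u' i} ∈ nhds u := by
      intro u
      have : {u' : ℕ → α | ∀ i ≤ k, u i = u' i} = ⋂ i ∈ Finset.range (k + 1), {u' | u' i = u i} := by
        ext u'
        simp only [Set.mem_ofPred_eq, Set.mem_iInter, Finset.mem_range]
        exact ⟨fun h i hi => (h i (by omega)).symm, fun h i hi => (h i (by omega)).symm⟩
      rw [this, Filter.biInter_finset_mem]
      intro i _
      have hc : Continuous (fun w : ℕ → α => w i) := continuous_apply i
      have ho : IsOpen {w : ℕ → α | w i = u i} := (isOpen_discrete ({u i} : Set α)).preimage hc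
      exact ho.mem_nhds rfl
    rw [← isOpen_compl_iff, isOpen_iff_mem_nhds]
    intro u hu
    filter_upwards [hcong u] with u' hu' h'
    exact hu (h'.congr (fun i hi => (hu' i hi).symm))
  obtain ⟨u, hu⟩ := IsCompact.nonempty_iInter_of_sequence_nonempty_isCompact_isClosed
    (fun k => {u : ℕ → α | Ok P F k u}) (fun k u hu => Ok.mono (Nat.le_succ k) hu) h
    (hcl 0).isCompact hcl
  exact ⟨u, fun k => Set.mem_iInter.mp hu k⟩

end

/-- extended set of forced positions -/
def PP (R : ℕ → Prop) : ℕ → Prop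
  | 0 => True
  | n + 1 => R (n + 1) ∨ (¬ PP R n ∧ ¬ R (n + 2))

end SqW

open SqW

theorem d_six_letters_le_2 {α : Type*} [Fintype α] (hcard : 6 ≤ Fintype.card α) :
    ∀ v : ℕ → α, ∀ q : ℕ → ℕ, 1 ≤ q 1 →
      (∀ i : ℕ, 1 ≤ i → q i + 2 ≤ q (i + 1)) →
      ∃ u : ℕ → α, SqFreeSeq u ∧ ∀ i : ℕ, 1 ≤ i → u (q i) = v i := by
  classical
  intro v q hq1 hq
  have hmono : ∀ i d, 1 ≤ i → q i + 2 * d ≤ q (i + d) := by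
    intro i d hi
    induction d with
    | zero => simp
    | succ d ih =>
      have := hq (i + d) (by omega)
      rw [show i + (d + 1) = i + d + 1 by omega]
      omega
  have hlt : ∀ i j, 1 ≤ i → i < j → q i + 2 ≤ q j := by
    intro i j hi hij
    have := hmono i (j - i) hi
    rw [show i + (j - i) = j by omega] at this
    omega
  have hpos : ∀ i, 1 ≤ i → 1 ≤ q i := by
    intro i hi
    rcases Nat.lt_or_ge 1 i with h | h
    · have := hlt 1 i le_rfl h
      omega
    · rw [show i = 1 by omega]
      exact hq1
  set R : ℕ → Prop := fun n => ∃ i, 1 ≤ i ∧ n = q i + 1 with hR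
  have hRadj : ∀ n, R n → ¬ R (n + 1) := by
    rintro n ⟨i, hi, hn⟩ ⟨j, hj, hn'⟩
    rcases Nat.lt_trichotomy i j with h | h | h
    · have := hlt i j hi h
      omega
    · subst h
      omega
    · have := hlt j i hj h
      omega
  have hR1 : ¬ R 1 := by
    rintro ⟨i, hi, hn⟩
    have := hpos i hi
    omega
  have hadj : ∀ n, PP R n → ¬ PP R (n + 1) := by
    intro n hn hn1
    rcases hn1 with h | ⟨h, _⟩
    · rcases n with _ | n
      · exact hR1 h
      · rcases hn with h' | ⟨_, h'⟩
        · exact hRadj _ h' h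
        · exact h' h
    · exact h hn
  have hgap : ∀ n, ¬ PP R n → ¬ PP R (n + 1) → PP R (n + 2) := by
    intro n h0 h1
    left
    by_contra h
    exact h1 (Or.inr ⟨h0, h⟩)
  have c : α := v 0
  let F : ℕ → α := fun n => if h : R n then v h.choose else c
  obtain ⟨u, hu⟩ := exists_inf (exists_ok (P := PP R) (F := F) c hcard trivial hadj hgap)
  refine ⟨fun n => u (n + 1), ?_, ?_⟩
  · intro i n hi hn
    by_contra hcon
    push Not at hcon
    refine (hu (i + 2 * n)).2 (i + 2 * n) le_rfl n hn ⟨by omega, fun j h1 h2 => ?_⟩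
    have := hcon (j - i - n - 1) (by omega)
    rw [show i + (j - i - n - 1) + 1 = j - n by omega,
      show i + n + (j - i - n - 1) + 1 = j by omega] at this
    exact this.symm
  · intro i hi
    have hRi : R (q i + 1) := ⟨i, hi, rfl⟩
    show u (q i + 1) = v i
    rw [(hu (q i + 1)).1 (q i + 1) le_rfl (Or.inl hRi)]
    show (if h : R (q i + 1) then v h.choose else c) = v i
    rw [dif_pos hRi]
    obtain ⟨h1, h2⟩ := hRi.choose_spec
    congr 1
    rcases Nat.lt_trichotomy hRi.choose i with h | h | h
    · have := hlt _ _ h1 h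
      omega
    · exact h
    · have := hlt _ _ hi h
      omega
end
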